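/- Let n ≥ 2, let S ⊆ ℝ^n be a Borel measurable set symmetric about the origin with Lebesgue measure V, and let k be a positive integer. For any integers α and β with k ≤ α ≤ √(n/2), k ≤ β ≤ √(n/2), α − k even and β − k odd, the integral ∫_{X_n} F_{S,k}(L) dμ_n satisfies: Σ_{h=k}^{β} (−1)^{h−k} (V/2)^h / (h·(h−k)!·(k−1)!) − E ≤ ∫_{X_n} F_{S,k} dμ_n ≤ Σ_{h=k}^{α} (−1)^{h−k} (V/2)^h / (h·(h−k)!·(k−1)!) + E, where E = (12/k!)·√(n/2)·(0.999)^n·(V/2+1)^{√(n/2)}. -/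

import Mathlib

open MeasureTheory Matrix
open scoped Nat Classical

noncomputable section

abbrev SLR (n : ℕ) := Matrix.SpecialLinearGroup (Fin n) ℝ

instance (n : ℕ) : MeasurableSpace (SLR n) :=
  MeasurableSpace.comap (fun g : SLR n => (g : Matrix (Fin n) (Fin n) ℝ))
    (inferInstanceAs (MeasurableSpace (Fin n → Fin n → ℝ)))

/-- The image of SL_n(ℤ) in SL_n(ℝ), as a subgroup. -/
def SLZ (n : ℕ) : Subgroup (SLR n) :=
  (Matrix.SpecialLinearGroup.map (Int.castRingHom ℝ)).range

/-- The space of lattices `X_n = SL_n(ℤ) \ SL_n(ℝ)` (space of right cosets). -/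
def LatSpace (n : ℕ) := Quotient (QuotientGroup.rightRel (SLZ n))

instance (n : ℕ) : MeasurableSpace (LatSpace n) :=
  inferInstanceAs (MeasurableSpace (Quotient _))

/-- The coset of `g`. -/
def latMk (n : ℕ) (g : SLR n) : LatSpace n :=
  Quotient.mk (QuotientGroup.rightRel (SLZ n)) g

/-- Right translation action of `SL_n(ℝ)` on `X_n`. -/
def rTranslate (n : ℕ) (a : SLR n) (x : LatSpace n) : LatSpace n :=
  Quotient.lift (fun g => latMk n (g * a))
    (fun g g' hgg' => Quotient.sound (QuotientGroup.rightRel_apply.mpr (by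
      have h : g' * g⁻¹ ∈ SLZ n := QuotientGroup.rightRel_apply.mp hgg'
      simpa [_root_.mul_inv_rev, mul_assoc] using h))) x

/-- The lattice `ℤ^n g` associated to `g ∈ SL_n(ℝ)`. -/
def latticeOf (n : ℕ) (g : SLR n) : Set (Fin n → ℝ) :=
  Set.range (fun m : Fin n → ℤ =>
    Matrix.vecMul (fun i => (m i : ℝ)) (g : Matrix (Fin n) (Fin n) ℝ))

/-- `S'`: the set of points of `S` whose first nonzero coordinate is positive. -/
def posHalf (n : ℕ) (S : Set (Fin n → ℝ)) : Set (Fin n → ℝ) :=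
  {x ∈ S | ∃ i : Fin n, 0 < x i ∧ ∀ j < i, x j = 0}

/-- `A` has at least `k` elements. -/
def hasAtLeast {α : Type*} (A : Set α) (k : ℕ) : Prop :=
  ∃ t : Finset α, ↑t ⊆ A ∧ t.card = k

/-- `ρ_{S',h}(L)`: the number of `h`-element subsets of `L ∩ S'`. -/
def rhoSub (n : ℕ) (S : Set (Fin n → ℝ)) (h : ℕ) (g : SLR n) : ℕ :=
  Nat.card {t : Finset (Fin n → ℝ) // ↑t ⊆ latticeOf n g ∩ posHalf n S ∧ t.card = h}

end

section Riemann

open Filter Topology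

theorem measurePreserving_uncurry (ι κ : Type*) [Fintype ι] [Fintype κ] :
    MeasurePreserving (MeasurableEquiv.curry ι κ ℝ).symm := by
  refine ⟨MeasurableEquiv.measurable _, ?_⟩
  symm
  refine Measure.pi_eq fun s hs => ?_
  rw [MeasurableEquiv.map_apply]
  have : (MeasurableEquiv.curry ι κ ℝ).symm ⁻¹' (Set.univ.pi s)
      = Set.univ.pi fun i => Set.univ.pi fun k => s (i, k) := by
    ext x
    simp [MeasurableEquiv.coe_curry_symm, Function.uncurry]
  rw [this, volume_pi_pi]
  simp_rw [volume_pi_pi]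
  rw [← Finset.univ_product_univ, Finset.prod_product]

theorem tendsto_riemann_sum_flat {σ : Type*} [Fintype σ] (f : (σ → ℝ) → ℝ)
    (hf : Continuous f) (hc : HasCompactSupport f) :
    Tendsto (fun N : ℕ => (∑' M : σ → ℤ, f (fun i => (M i : ℝ) / N)) / (N : ℝ) ^ Fintype.card σ)
      atTop (𝓝 (∫ x, f x)) := by
  obtain ⟨R, hR0, hR⟩ := hc.isCompact.isBounded.subset_closedBall_lt 0 0
  have hsupp : Function.support f ⊆ Metric.closedBall 0 R := (subset_tsupport f).trans hR
  have h := tendsto_tsum_div_pow_atTop_integral (Metric.closedBall (0 : σ → ℝ) R) f hf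
    Metric.isBounded_closedBall measurableSet_closedBall (by
      rw [frontier_closedBall _ hR0.ne']
      exact Measure.addHaar_sphere_of_ne_zero _ _ hR0.ne')
  rw [setIntegral_eq_integral_of_forall_compl_eq_zero
    (fun x hx => Function.notMem_support.mp fun h => hx (hsupp h))] at h
  refine h.congr' ?_
  filter_upwards [eventually_gt_atTop 0] with N hN
  congr 1
  have hN' : (N : ℝ) ≠ 0 := by positivity
  have : NeZero N := ⟨hN.ne'⟩
  have hinj : Function.Injective (fun M : σ → ℤ => fun i => (M i : ℝ) / N) := by
    intro M M' h
    funext i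
    have := congrFun h i
    simp only at this
    rw [div_left_inj' hN'] at this
    exact_mod_cast this
  rw [tsum_subtype (Metric.closedBall (0 : σ → ℝ) R ∩ _) f, ← hinj.tsum_eq]
  · refine tsum_congr fun M => ?_
    by_cases hM : (fun i => (M i : ℝ) / N) ∈ Metric.closedBall (0 : σ → ℝ) R
    · rw [Set.indicator_of_mem]
      refine ⟨hM, BoxIntegral.unitPartition.mem_smul_span_iff.mpr fun i => ⟨M i, ?_⟩⟩
      simp [mul_div_cancel₀ _ hN']
    · rw [Set.indicator_of_notMem (fun h => hM h.1)]
      exact (Function.notMem_support.mp fun h => hM (hsupp h)).symm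
  · intro x hx
    have hx' := (Set.mem_of_indicator_ne_zero hx).2
    choose M hM using BoxIntegral.unitPartition.mem_smul_span_iff.mp hx'
    refine ⟨M, funext fun i => ?_⟩
    have := hM i
    simp only [eq_intCast] at this
    simp [this, mul_div_cancel_left₀ _ hN']

/-- Riemann sums over the grid `N⁻¹ ℤ^{ι × κ}` of a continuous compactly supported function
converge to its integral. -/
theorem tendsto_riemann_sum {ι κ : Type*} [Fintype ι] [Fintype κ] (f : (ι → κ → ℝ) → ℝ)
    (hf : Continuous f) (hc : HasCompactSupport f) :
    Tendsto (fun N : ℕ => (∑' M : ι → κ → ℤ, f (fun i k => (M i k : ℝ) / N)) /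
      (N : ℝ) ^ (Fintype.card ι * Fintype.card κ)) atTop (𝓝 (∫ x, f x)) := by
  let e : (ι × κ → ℝ) ≃ₜ (ι → κ → ℝ) :=
    { toEquiv := Equiv.curry ι κ ℝ
      continuous_toFun := by
        refine continuous_pi fun i => continuous_pi fun k => ?_
        exact continuous_apply (i, k)
      continuous_invFun := by
        refine continuous_pi fun p => ?_
        exact (continuous_apply p.2).comp (continuous_apply p.1) }
  have h := tendsto_riemann_sum_flat (fun y => f (e y)) (hf.comp e.continuous)
    (hc.comp_homeomorph e)
  have hval : ∫ y, f (e y) = ∫ x, f x := by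
    rw [← (measurePreserving_uncurry ι κ).integral_comp' (g := fun y => f (e y))]
    rfl
  rw [hval, Fintype.card_prod] at h
  refine h.congr fun N => ?_
  congr 1
  exact (Equiv.curry ι κ ℤ).tsum_eq (fun M : ι → κ → ℤ => f (fun i k => (M i k : ℝ) / N))

end Riemann

section Lattice

open Filter Topology

variable {ι κ : Type*} [Fintype κ]

/-- The action of a matrix on tuples of row vectors. -/
def rowMul (g : Matrix κ κ ℝ) (X : ι → κ → ℝ) : ι → κ → ℝ := fun i => X i ᵥ* g

/-- An integral tuple viewed as a real tuple. -/
def castTuple (M : ι → κ → ℤ) : ι → κ → ℝ := fun i k => (M i k : ℝ)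

theorem continuous_rowMul (g : Matrix κ κ ℝ) : Continuous (rowMul (ι := ι) g) := by
  refine continuous_pi fun i => ?_
  exact (continuous_apply i).matrix_vecMul continuous_const

theorem rowMul_mul (g h : Matrix κ κ ℝ) (X : ι → κ → ℝ) :
    rowMul (g * h) X = rowMul h (rowMul g X) := by
  funext i
  simp [rowMul, Matrix.vecMul_vecMul]

theorem rowMul_one [DecidableEq κ] (X : ι → κ → ℝ) : rowMul (1 : Matrix κ κ ℝ) X = X := by
  funext i
  simp [rowMul]

theorem measurePreserving_vecMul [DecidableEq κ] (g : Matrix κ κ ℝ) (hg : g.det = 1) :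
    MeasurePreserving (fun v : κ → ℝ => v ᵥ* g) := by
  have h := Real.map_matrix_volume_pi_eq_smul_volume_pi (M := gᵀ) (by simp [hg])
  refine ⟨(continuous_id.matrix_vecMul continuous_const).measurable, ?_⟩
  have h2 : (fun v : κ → ℝ => v ᵥ* g) = ⇑(toLin' gᵀ) := by
    funext v
    simp [Matrix.mulVec_transpose]
  rw [h2, h]
  simp [hg]

theorem measurePreserving_rowMul [Fintype ι] [DecidableEq κ] (g : Matrix κ κ ℝ) (hg : g.det = 1) :
    MeasurePreserving (rowMul (ι := ι) g) :=
  volume_preserving_pi fun _ => measurePreserving_vecMul g hg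

theorem finite_castTuple_mem [Fintype ι] {s : Set (ι → κ → ℝ)} (hs : Bornology.IsBounded s) :
    {M : ι → κ → ℤ | castTuple M ∈ s}.Finite := by
  obtain ⟨R, hR⟩ := hs.subset_closedBall 0
  refine Set.Finite.subset (Set.Finite.pi fun _ : ι => Set.Finite.pi fun _ : κ =>
    Set.finite_Icc (-⌈R⌉) ⌈R⌉) fun M hM => ?_
  have h1 := mem_closedBall_zero_iff.mp (hR hM)
  intro i _ k _
  have h2 : |(M i k : ℝ)| ≤ R :=
    ((norm_le_pi_norm (castTuple M i) k).trans (norm_le_pi_norm (castTuple M) i)).trans h1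
  have h3 := abs_le.mp (h2.trans (Int.le_ceil R))
  exact ⟨by exact_mod_cast h3.1, by exact_mod_cast h3.2⟩

theorem finite_rowMul_mem [Fintype ι] [DecidableEq κ] {s : Set (ι → κ → ℝ)}
    (hs : Bornology.IsBounded s) (g : Matrix κ κ ℝ) (hg : g.det ≠ 0) :
    {M : ι → κ → ℤ | rowMul g (castTuple M) ∈ s}.Finite := by
  obtain ⟨R, hR⟩ := hs.subset_closedBall 0
  have hb : Bornology.IsBounded (rowMul g⁻¹ '' Metric.closedBall (0 : ι → κ → ℝ) R) :=
    ((isCompact_closedBall _ _).image (continuous_rowMul _)).isBounded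
  refine (finite_castTuple_mem hb).subset fun M hM => ⟨_, hR hM, ?_⟩
  rw [← rowMul_mul, Matrix.mul_nonsing_inv _ (isUnit_iff_ne_zero.mpr hg), rowMul_one]

/-- Riemann sums over `N⁻¹ ℤ^{ι × κ} g` of a continuously varying family of functions with
common compact support. -/
theorem tendsto_riemann_sum_family [Fintype ι] [DecidableEq κ] (g : Matrix κ κ ℝ) (hg : g.det = 1)
    (G : ℝ → (ι → κ → ℝ) → ℝ) (hG : Continuous (Function.uncurry G))
    {K : Set (ι → κ → ℝ)} (hK : IsCompact K)
    (hGK : ∀ ε ∈ Set.Icc (0 : ℝ) 1, ∀ Z, Z ∉ K → G ε Z = 0)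
    (ε : ℕ → ℝ) (hε : ∀ N, ε N ∈ Set.Icc (0 : ℝ) 1) (hlim : Tendsto ε atTop (𝓝 0)) :
    Tendsto (fun N : ℕ => (∑' M : ι → κ → ℤ, G (ε N) (rowMul g (castTuple M) / (N : ι → κ → ℝ))) /
      (N : ℝ) ^ (Fintype.card ι * Fintype.card κ)) atTop (𝓝 (∫ Z, G 0 Z)) := by
  set σ := fun N : ℕ => (N : ℝ) ^ (Fintype.card ι * Fintype.card κ) with hσ
  have key : ∀ (h : (ι → κ → ℝ) → ℝ), Continuous h → HasCompactSupport h →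
      Tendsto (fun N : ℕ => (∑' M : ι → κ → ℤ, h (rowMul g (castTuple M) / (N : ι → κ → ℝ))) / σ N)
        atTop (𝓝 (∫ Z, h Z)) := by
    intro h hh hc
    have h1 := tendsto_riemann_sum (h ∘ rowMul g) (hh.comp (continuous_rowMul g)) (by
      have hdet : g.det ≠ 0 := by simp [hg]
      have hu := isUnit_iff_ne_zero.mpr hdet
      refine HasCompactSupport.intro
        ((hc.isCompact).image (continuous_rowMul (ι := ι) g⁻¹)) fun x hx => ?_
      by_contra hne
      exact hx ⟨rowMul g x, subset_tsupport _ hne, by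
        rw [← rowMul_mul, Matrix.mul_nonsing_inv _ hu, rowMul_one]⟩)
    have h2 : ∫ x, (h ∘ rowMul g) x = ∫ Z, h Z := by
      have hmp := measurePreserving_rowMul (ι := ι) g hg
      have hemb : MeasurableEmbedding (rowMul (ι := ι) g) := by
        have hu : IsUnit g.det := by simp [hg]
        refine (Continuous.measurableEmbedding (continuous_rowMul g) ?_)
        refine Function.LeftInverse.injective (g := rowMul g⁻¹) fun x => ?_
        rw [← rowMul_mul, Matrix.mul_nonsing_inv _ hu, rowMul_one]
      exact hmp.integral_comp hemb h
    rw [h2] at h1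
    refine h1.congr fun N => ?_
    congr 1
    refine tsum_congr fun M => ?_
    simp only [Function.comp]
    congr 1
    funext i k
    simp [rowMul, castTuple, Matrix.vecMul, dotProduct, Finset.sum_div, div_mul_eq_mul_div]
  obtain ⟨R, hR⟩ := hK.isBounded.subset_closedBall (0 : ι → κ → ℝ)
  set χ : (ι → κ → ℝ) → ℝ := fun Z => max 0 (R + 1 - ‖Z‖) with hχ
  have hχc : Continuous χ := by fun_prop
  have hχs : HasCompactSupport χ := by
    refine HasCompactSupport.intro (isCompact_closedBall (0 : ι → κ → ℝ) (R + 1)) fun x hx => ?_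
    simp only [Metric.mem_closedBall, dist_zero_right, not_le] at hx
    simp only [hχ, max_eq_left_iff]
    linarith
  have hχ0 : ∀ Z, 0 ≤ χ Z := fun Z => le_max_left _ _
  have hχ1 : ∀ Z ∈ K, 1 ≤ χ Z := fun Z hZ => by
    have := mem_closedBall_zero_iff.mp (hR hZ)
    exact le_max_of_le_right (by linarith)
  have hG0c : Continuous (G 0) := hG.comp (by fun_prop : Continuous fun Z => ((0 : ℝ), Z))
  have hG0s : HasCompactSupport (G 0) :=
    HasCompactSupport.intro hK fun x hx => hGK 0 (by simp) x hx
  have hA := key (G 0) hG0c hG0s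
  have hB := key χ hχc hχs
  have hfin : ∀ (N : ℕ), N ≠ 0 → {M : ι → κ → ℤ | rowMul g (castTuple M) / (N : ι → κ → ℝ) ∈
      Metric.closedBall (0 : ι → κ → ℝ) (R + 1)}.Finite := by
    intro N hN
    have hb : Bornology.IsBounded
        ((fun Z : ι → κ → ℝ => Z * (N : ι → κ → ℝ)) '' Metric.closedBall 0 (R + 1)) :=
      ((isCompact_closedBall _ _).image (by fun_prop)).isBounded
    refine (finite_rowMul_mem hb g (by simp [hg])).subset fun M hM => ⟨_, hM, ?_⟩
    funext i k
    simp [hN]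
  have hsumm : ∀ (N : ℕ), N ≠ 0 → ∀ h : (ι → κ → ℝ) → ℝ, (∀ Z, Z ∉ Metric.closedBall 0 (R + 1) →
      h Z = 0) → Summable fun M : ι → κ → ℤ => h (rowMul g (castTuple M) / (N : ι → κ → ℝ)) := by
    intro N hN h hh
    refine summable_of_hasFiniteSupport ((hfin N hN).subset fun M hM => ?_)
    by_contra hc
    exact hM (hh _ hc)
  have hKR : ∀ Z, Z ∉ Metric.closedBall (0 : ι → κ → ℝ) (R + 1) → Z ∉ K := fun Z hZ hZK =>
    hZ (Metric.closedBall_subset_closedBall (by linarith) (hR hZK))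
  have hUC : UniformContinuousOn (Function.uncurry G) (Set.Icc (0 : ℝ) 1 ×ˢ K) :=
    (isCompact_Icc.prod hK).uniformContinuousOn_of_continuous hG.continuousOn
  have hdiff : Tendsto (fun N : ℕ =>
      (∑' M : ι → κ → ℤ, G (ε N) (rowMul g (castTuple M) / (N : ι → κ → ℝ))) / σ N -
      (∑' M : ι → κ → ℤ, G 0 (rowMul g (castTuple M) / (N : ι → κ → ℝ))) / σ N) atTop (𝓝 0) := by
    rw [Metric.tendsto_atTop]
    intro e he
    set I := ∫ Z, χ Z
    have hI : 0 ≤ I := integral_nonneg hχ0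
    obtain ⟨δ, hδ, hd⟩ := Metric.uniformContinuousOn_iff.mp hUC (e / (I + 1)) (by positivity)
    obtain ⟨N1, hN1⟩ := Metric.tendsto_atTop.mp hlim δ hδ
    obtain ⟨N2, hN2⟩ := eventually_atTop.mp (hB.eventually_lt_const (show I < I + 1 by linarith))
    refine ⟨max (max N1 N2) 1, fun N hN => ?_⟩
    have hN0 : N ≠ 0 := by have := le_trans (le_max_right _ _) hN; omega
    have h1 := hN1 N ((le_max_left _ _).trans ((le_max_left _ _).trans hN))
    have h2 := hN2 N ((le_max_right _ _).trans ((le_max_left _ _).trans hN))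
    have hσN : 0 < σ N := by simp only [hσ]; positivity
    have hpt : ∀ Z, |G (ε N) Z - G 0 Z| ≤ e / (I + 1) * χ Z := by
      intro Z
      by_cases hZ : Z ∈ K
      · have := hd (ε N, Z) ⟨hε N, hZ⟩ (0, Z) ⟨by simp, hZ⟩ (by simpa [Prod.dist_eq] using h1)
        rw [Real.dist_eq] at this
        have h3 : e / (I + 1) * 1 ≤ e / (I + 1) * χ Z :=
          mul_le_mul_of_nonneg_left (hχ1 Z hZ) (by positivity)
        simp only [Function.uncurry] at this
        linarith
      · rw [hGK _ (hε N) Z hZ, hGK 0 (by simp) Z hZ]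
        simpa using mul_nonneg (by positivity : 0 ≤ e / (I + 1)) (hχ0 Z)
    have s1 := hsumm N hN0 (G (ε N)) fun Z hZ => hGK _ (hε N) Z (hKR Z hZ)
    have s2 := hsumm N hN0 (G 0) fun Z hZ => hGK _ (by simp) Z (hKR Z hZ)
    have s3 := hsumm N hN0 χ fun Z hZ => by
      simp only [Metric.mem_closedBall, dist_zero_right, not_le] at hZ
      simp only [hχ, max_eq_left_iff]
      linarith
    have h4 : |∑' M : ι → κ → ℤ, (G (ε N) (rowMul g (castTuple M) / (N : ι → κ → ℝ)) -
        G 0 (rowMul g (castTuple M) / (N : ι → κ → ℝ)))| ≤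
        ∑' M : ι → κ → ℤ, e / (I + 1) * χ (rowMul g (castTuple M) / (N : ι → κ → ℝ)) := by
      rw [← Real.norm_eq_abs]
      exact tsum_of_norm_bounded (s3.mul_left _).hasSum fun M => hpt _
    rw [dist_zero_right, ← sub_div, ← s1.tsum_sub s2, Real.norm_eq_abs, abs_div,
      abs_of_pos hσN, div_lt_iff₀ hσN]
    rw [div_lt_iff₀ hσN] at h2
    refine h4.trans_lt ?_
    rw [tsum_mul_left]
    calc _ < e / (I + 1) * ((I + 1) * σ N) := mul_lt_mul_of_pos_left h2 (by positivity)
      _ = e * σ N := by field_simp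
  have := hdiff.add hA
  simpa using this

end Lattice

section Shear

open Filter Topology

variable {ι κ : Type*}

/-- The square block of a tuple formed by the columns `J`. -/
def colBlock (J : ι → κ) (Z : ι → κ → ℝ) : Matrix ι ι ℝ := Matrix.of fun i l => Z i (J l)

/-- Replace the column `k₀` of a tuple. -/
noncomputable def replCol (k₀ : κ) (Z : ι → κ → ℝ) (v : ι → ℝ) : ι → κ → ℝ :=
  fun i => Function.update (Z i) k₀ (v i)

theorem continuous_replCol (k₀ : κ) :
    Continuous fun p : (ι → κ → ℝ) × (ι → ℝ) => replCol k₀ p.1 p.2 := by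
  refine continuous_pi fun i => ?_
  exact Continuous.update (by fun_prop) k₀ (by fun_prop)

theorem continuous_colBlock (J : ι → κ) : Continuous (colBlock J) := by
  refine continuous_matrix fun i l => ?_
  simp only [colBlock, Matrix.of_apply]
  fun_prop

theorem colBlock_replCol {J : ι → κ} {k₀ : κ} (hJ : ∀ l, J l ≠ k₀) (Z : ι → κ → ℝ) (v : ι → ℝ) :
    colBlock J (replCol k₀ Z v) = colBlock J Z := by
  ext i l
  simp [colBlock, replCol, hJ l]

theorem lintegral_comp_add_mulVec [Fintype ι] (A : Matrix ι ι ℝ) (hA : A.det ≠ 0) (z : ι → ℝ)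
    {h : (ι → ℝ) → ENNReal} (hh : Measurable h) :
    ∫⁻ B, h (z + A *ᵥ B) = ENNReal.ofReal |A.det|⁻¹ * ∫⁻ v, h v := by
  have h1 : ∫⁻ B, h (z + A *ᵥ B) = ∫⁻ v, h (z + v) ∂(Measure.map (toLin' A) volume) := by
    rw [lintegral_map (by fun_prop) (toLin' A).continuous_of_finiteDimensional.measurable]
    simp
  rw [h1, Real.map_matrix_volume_pi_eq_smul_volume_pi hA, lintegral_smul_measure,
    lintegral_add_left_eq_self, abs_inv, smul_eq_mul]

/-- A continuous extension of the matrix inverse away from small determinants. -/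
noncomputable def regInv [Fintype ι] (δ : ℝ) (A : Matrix ι ι ℝ) : Matrix ι ι ℝ :=
  (A.det / max (A.det ^ 2) (δ ^ 2)) • A.adjugate

theorem continuous_regInv [Fintype ι] {δ : ℝ} (hδ : 0 < δ) : Continuous (regInv (ι := ι) δ) := by
  unfold regInv
  have hd : Continuous fun A : Matrix ι ι ℝ => A.det := continuous_id.matrix_det
  refine Continuous.smul (Continuous.div hd ((hd.pow 2).max continuous_const) fun A => ?_)
    continuous_id.matrix_adjugate
  exact (lt_max_of_lt_right (by positivity)).ne'

theorem regInv_eq [Fintype ι] {δ : ℝ} (hδ : 0 < δ) {A : Matrix ι ι ℝ} (hA : δ ≤ |A.det|) :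
    regInv δ A = A⁻¹ := by
  have h0 : A.det ≠ 0 := abs_pos.mp (hδ.trans_le hA)
  rw [regInv, Matrix.inv_def, max_eq_left (by simpa using pow_le_pow_left₀ hδ.le hA 2)]
  congr 1
  rw [Ring.inverse_eq_inv']
  field_simp

/-- The kernel obtained by averaging `f` over shears. -/
noncomputable def shearKernel [Fintype ι] (J : ι → κ) (k₀ : κ) (δ : ℝ)
    (f : (ι → κ → ℝ) → ℝ) (w : (ι → ℝ) → ℝ)
    (ε : ℝ) (Z : ι → κ → ℝ) (v : ι → ℝ) : ℝ :=
  (max |(colBlock J Z).det| δ)⁻¹ * f (replCol k₀ Z v) *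
    w (regInv δ (colBlock J Z) *ᵥ (ε • v - fun i => Z i k₀))

theorem continuous_shearKernel [Fintype ι] {J : ι → κ} {k₀ : κ} {δ : ℝ} (hδ : 0 < δ)
    {f : (ι → κ → ℝ) → ℝ}
    (hf : Continuous f) {w : (ι → ℝ) → ℝ} (hw : Continuous w) :
    Continuous fun p : (ℝ × (ι → κ → ℝ)) × (ι → ℝ) => shearKernel J k₀ δ f w p.1.1 p.1.2 p.2 := by
  have hA : Continuous fun p : (ℝ × (ι → κ → ℝ)) × (ι → ℝ) => colBlock J p.1.2 :=
    (continuous_colBlock J).comp (by fun_prop)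
  unfold shearKernel
  refine ((Continuous.inv₀ (hA.matrix_det.abs.max continuous_const) fun p => ?_).mul ?_).mul ?_
  · exact (lt_max_of_lt_right hδ).ne'
  · exact hf.comp ((continuous_replCol k₀).comp
      (by fun_prop : Continuous fun p : (ℝ × (ι → κ → ℝ)) × (ι → ℝ) => (p.1.2, p.2)))
  · exact hw.comp (((continuous_regInv hδ).comp hA).matrix_mulVec (by fun_prop))

theorem lintegral_shear [Fintype ι] {J : ι → κ} {k₀ : κ} (hJ : ∀ l, J l ≠ k₀) {δ : ℝ} (hδ : 0 < δ)
    {f : (ι → κ → ℝ) → ℝ} (hf : Continuous f) (hf0 : ∀ Z, 0 ≤ f Z)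
    (hfδ : ∀ Z, f Z ≠ 0 → δ ≤ |(colBlock J Z).det|) {w : (ι → ℝ) → ℝ} (hw : Continuous w)
    {c : ℝ} (hc : 0 < c) (Z : ι → κ → ℝ) :
    ∫⁻ B, ENNReal.ofReal (w B) *
      ENNReal.ofReal (f (replCol k₀ Z (c • ((fun i => Z i k₀) + colBlock J Z *ᵥ B)))) =
    ENNReal.ofReal (c ^ Fintype.card ι)⁻¹ *
      ∫⁻ v, ENNReal.ofReal (shearKernel J k₀ δ f w c⁻¹ Z v) := by
  by_cases hA : δ ≤ |(colBlock J Z).det|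
  · have h0 : (colBlock J Z).det ≠ 0 := abs_pos.mp (hδ.trans_le hA)
    set A := colBlock J Z with hAdef
    set z : ι → ℝ := fun i => Z i k₀
    have hdet : (c • A).det = c ^ Fintype.card ι * A.det := Matrix.det_smul _ _
    have hm : Measurable fun v : ι → ℝ => ENNReal.ofReal (w (A⁻¹ *ᵥ (c⁻¹ • v - z))) *
        ENNReal.ofReal (f (replCol k₀ Z v)) := by
      refine Measurable.fun_mul ?_ ?_
      · exact ((hw.comp (Continuous.matrix_mulVec (A := fun _ => A⁻¹) continuous_const
          (by fun_prop))).measurable).ennreal_ofReal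
      · exact (hf.comp ((continuous_replCol k₀).comp
          (by fun_prop : Continuous fun v : ι → ℝ => (Z, v)))).measurable.ennreal_ofReal
    have h1 := lintegral_comp_add_mulVec (c • A) (by rw [hdet]; positivity) (c • z) hm
    have h2 : ∀ B, A⁻¹ *ᵥ (c⁻¹ • (c • z + (c • A) *ᵥ B) - z) = B := by
      intro B
      rw [Matrix.smul_mulVec, ← smul_add, smul_smul, inv_mul_cancel₀ hc.ne', one_smul,
        add_sub_cancel_left, Matrix.mulVec_mulVec,
        Matrix.nonsing_inv_mul _ (isUnit_iff_ne_zero.mpr h0), Matrix.one_mulVec]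
    simp only [h2] at h1
    have h3 : ∀ B, c • (z + A *ᵥ B) = c • z + (c • A) *ᵥ B := fun B => by
      rw [Matrix.smul_mulVec, smul_add]
    simp only [h3]
    rw [h1, hdet, abs_mul, mul_inv, abs_of_pos (by positivity : 0 < c ^ Fintype.card ι),
      ENNReal.ofReal_mul (by positivity), mul_assoc]
    congr 1
    rw [← lintegral_const_mul _ hm]
    refine lintegral_congr fun v => ?_
    rw [shearKernel, ← hAdef, regInv_eq hδ hA, max_eq_left hA, mul_assoc,
      ENNReal.ofReal_mul (by positivity), ENNReal.ofReal_mul (hf0 _),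
      mul_comm (ENNReal.ofReal (w _))]
  · have hz : ∀ v, f (replCol k₀ Z v) = 0 := fun v => by
      by_contra h
      exact hA (by simpa [colBlock_replCol hJ] using hfδ _ h)
    simp [hz, shearKernel]

/-- The shear kernel integrates to `∫ f`. -/
theorem lintegral_shearKernel [Fintype ι] [Fintype κ] {J : ι → κ} {k₀ : κ}
    (hJ : ∀ l, J l ≠ k₀) {δ : ℝ} (hδ : 0 < δ)
    {f : (ι → κ → ℝ) → ℝ} (hf : Continuous f) (hf0 : ∀ Z, 0 ≤ f Z)
    (hfδ : ∀ Z, f Z ≠ 0 → δ ≤ |(colBlock J Z).det|) {w : (ι → ℝ) → ℝ} (hw : Continuous w)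
    (hw1 : ∫⁻ B, ENNReal.ofReal (w B) = 1) :
    ∫⁻ Z, ∫⁻ v, ENNReal.ofReal (shearKernel J k₀ δ f w 0 Z v) = ∫⁻ Z, ENNReal.ofReal (f Z) := by
  let T : ((ι → κ → ℝ) × (ι → ℝ)) →ₗ[ℝ] ((ι → κ → ℝ) × (ι → ℝ)) :=
    { toFun := fun p => (replCol k₀ p.1 p.2, fun i => p.1 i k₀)
      map_add' := fun p q => by
        refine Prod.ext (funext fun i => funext fun k => ?_) rfl
        by_cases hk : k = k₀ <;> simp [replCol, hk]
      map_smul' := fun c p => by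
        refine Prod.ext (funext fun i => funext fun k => ?_) rfl
        by_cases hk : k = k₀ <;> simp [replCol, hk] }
  have hTT : T ∘ₗ T = LinearMap.id := by
    refine LinearMap.ext fun p => Prod.ext (funext fun i => funext fun k => ?_) ?_
    · by_cases hk : k = k₀ <;> simp [T, replCol, hk]
    · funext i
      simp [T, replCol]
  have hdet : LinearMap.det T * LinearMap.det T = 1 := by
    rw [← LinearMap.det_comp, hTT, LinearMap.det_id]
  have hdet1 : |LinearMap.det T| = 1 := by
    rcases mul_self_eq_one_iff.mp hdet with h | h <;> simp [h]
  have hdet0 : LinearMap.det T ≠ 0 := by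
    intro h
    simp [h] at hdet
  have h1 : (volume : Measure (ι → κ → ℝ)).IsAddHaarMeasure :=
    Measure.pi.isAddHaarMeasure fun _ : ι => (volume : Measure (κ → ℝ))
  have h2 : (volume : Measure (ι → ℝ)).IsAddHaarMeasure := inferInstance
  have : ((volume : Measure (ι → κ → ℝ)).prod (volume : Measure (ι → ℝ))).IsAddHaarMeasure :=
    Measure.prod.instIsAddHaarMeasure _ _
  have hmp : Measure.map T ((volume : Measure (ι → κ → ℝ)).prod (volume : Measure (ι → ℝ)))
      = (volume : Measure (ι → κ → ℝ)).prod (volume : Measure (ι → ℝ)) := by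
    rw [Measure.map_linearMap_addHaar_eq_smul_addHaar _ hdet0, abs_inv, hdet1]
    simp
  have hTm : Measurable T := T.continuous_of_finiteDimensional.measurable
  have hkc : Measurable fun p : (ι → κ → ℝ) × (ι → ℝ) =>
      ENNReal.ofReal (shearKernel J k₀ δ f w 0 p.1 p.2) :=
    ((continuous_shearKernel hδ hf hw).comp (by fun_prop :
      Continuous fun p : (ι → κ → ℝ) × (ι → ℝ) => (((0 : ℝ), p.1), p.2))).measurable.ennreal_ofReal
  rw [← lintegral_prod (fun p => ENNReal.ofReal (shearKernel J k₀ δ f w 0 p.1 p.2))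
      hkc.aemeasurable,
    ← hmp, lintegral_map hkc hTm]
  refine (lintegral_prod _ (hkc.comp hTm).aemeasurable).trans ?_
  simp only [Function.comp_apply]
  refine lintegral_congr fun Z => ?_
  have hZ : ∀ v : ι → ℝ, shearKernel J k₀ δ f w 0 (T (Z, v)).1 (T (Z, v)).2 =
      (max |(colBlock J Z).det| δ)⁻¹ * f Z * w (regInv δ (colBlock J Z) *ᵥ (-v)) := by
    intro v
    have h1 : replCol k₀ (replCol k₀ Z v) (fun i => Z i k₀) = Z := by
      funext i k
      by_cases hk : k = k₀ <;> simp [replCol, hk, Function.update_apply]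
    simp only [T, LinearMap.coe_mk, AddHom.coe_mk, shearKernel, colBlock_replCol hJ, h1]
    congr 3
    funext i
    simp [replCol]
  simp only [hZ]
  by_cases hA : δ ≤ |(colBlock J Z).det|
  · have h0 : (colBlock J Z).det ≠ 0 := abs_pos.mp (hδ.trans_le hA)
    set A := colBlock J Z
    have hmw : Measurable fun v : ι → ℝ => ENNReal.ofReal (w (A⁻¹ *ᵥ (-v))) :=
      (hw.comp (Continuous.matrix_mulVec (A := fun _ => A⁻¹) continuous_const
          (by fun_prop))).measurable.ennreal_ofReal
    have hneg : |(-A).det| = |A.det| := by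
      rw [Matrix.det_neg, abs_mul, abs_pow]
      simp
    have h1 := lintegral_comp_add_mulVec (-A)
      (abs_pos.mp (by rw [hneg]; exact abs_pos.mpr h0)) 0 hmw
    have h2 : ∀ B, A⁻¹ *ᵥ (-(0 + (-A) *ᵥ B)) = B := fun B => by
      rw [zero_add, Matrix.neg_mulVec, neg_neg, Matrix.mulVec_mulVec,
        Matrix.nonsing_inv_mul _ (isUnit_iff_ne_zero.mpr h0), Matrix.one_mulVec]
    simp only [h2, hw1, hneg] at h1
    rw [max_eq_left hA, regInv_eq hδ hA]
    have h3 : ∀ v, ENNReal.ofReal (|A.det|⁻¹ * f Z * w (A⁻¹ *ᵥ -v)) =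
        ENNReal.ofReal (f Z) * (ENNReal.ofReal |A.det|⁻¹ * ENNReal.ofReal (w (A⁻¹ *ᵥ -v))) := by
      intro v
      rw [mul_assoc, mul_left_comm, ENNReal.ofReal_mul (hf0 _), ENNReal.ofReal_mul (by positivity)]
    simp only [h3]
    rw [lintegral_const_mul _ (by fun_prop), lintegral_const_mul _ hmw, ← h1, mul_one]
  · have hz : f Z = 0 := by
      by_contra h
      exact hA (hfδ _ h)
    simp [hz]

end Shear

section Averaging

open Filter Topology

variable {ι : Type*} {n : ℕ}

/-- A shear of the coordinate `k₀` followed by a diagonal contraction of the other coordinates. -/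
noncomputable def shearMat [Fintype ι] (J : ι → Fin n) (k₀ : Fin n) (N : ℝ) (B : ι → ℝ) :
    Matrix (Fin n) (Fin n) ℝ :=
  (1 : Matrix (Fin n) (Fin n) ℝ).updateCol k₀
      (Pi.single k₀ 1 + ∑ l, B l • (Pi.single (J l) 1 : Fin n → ℝ)) *
    diagonal fun k => if k = k₀ then N ^ (n - 1) else N⁻¹

theorem det_shearMat [Fintype ι] {J : ι → Fin n} {k₀ : Fin n} (hJ : ∀ l, J l ≠ k₀) {N : ℝ}
    (hN : N ≠ 0) (B : ι → ℝ) : (shearMat J k₀ N B).det = 1 := by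
  rw [shearMat, det_mul, det_diagonal, ← cramer_apply, cramer_one,
    Finset.prod_ite, Finset.prod_const, Finset.prod_const]
  have h1 : (Finset.univ.filter fun k => k = k₀).card = 1 := by
    rw [Finset.filter_eq' Finset.univ k₀]; simp
  have h2 : (Finset.univ.filter fun k => ¬ k = k₀).card = n - 1 := by
    rw [Finset.filter_ne' Finset.univ k₀]; simp
  have h3 : (∑ l, B l • (Pi.single (J l) 1 : Fin n → ℝ)) k₀ = 0 := by
    rw [Finset.sum_apply]
    exact Finset.sum_eq_zero fun l _ => by simp [(hJ l).symm]
  simp [h1, h2, h3, hN]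

theorem rowMul_shearMat [Fintype ι] {J : ι → Fin n} {k₀ : Fin n} (hJ : ∀ l, J l ≠ k₀) {N : ℝ}
    (hN : N ≠ 0) (B : ι → ℝ) (X : ι → Fin n → ℝ) :
    rowMul (shearMat J k₀ N B) X = replCol k₀ (N⁻¹ • X) (N ^ n •
      ((fun i => (N⁻¹ • X) i k₀) + colBlock J (N⁻¹ • X) *ᵥ B)) := by
  have hn : N ^ n = N ^ (n - 1) * N := by
    rw [← pow_succ]
    congr 1
    have := k₀.pos
    omega
  funext i k
  rw [rowMul, shearMat, ← vecMul_vecMul, vecMul_diagonal]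
  by_cases hk : k = k₀
  · subst hk
    have h1 : (X i ᵥ* (1 : Matrix (Fin n) (Fin n) ℝ).updateCol k
        (Pi.single k 1 + ∑ l, B l • (Pi.single (J l) 1 : Fin n → ℝ))) k =
        X i k + ∑ l, B l * X i (J l) := by
      have : (X i ᵥ* (1 : Matrix (Fin n) (Fin n) ℝ).updateCol k
        (Pi.single k 1 + ∑ l, B l • (Pi.single (J l) 1 : Fin n → ℝ))) k =
        X i ⬝ᵥ (Pi.single k 1 + ∑ l, B l • (Pi.single (J l) 1 : Fin n → ℝ)) := by
        simp [vecMul, dotProduct]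
      rw [this, dotProduct_add, dotProduct_sum]
      simp
    rw [h1]
    simp only [if_true, replCol, Function.update_self, Pi.smul_apply, Pi.add_apply, smul_eq_mul,
      mulVec, dotProduct, colBlock, Matrix.of_apply]
    rw [hn]
    field_simp
    simp only [Finset.mul_sum]
    congr 1
    refine Finset.sum_congr rfl fun l _ => ?_
    field_simp
  · have h1 : (X i ᵥ* (1 : Matrix (Fin n) (Fin n) ℝ).updateCol k₀
        (Pi.single k₀ 1 + ∑ l, B l • (Pi.single (J l) 1 : Fin n → ℝ))) k = X i k := by
      simp [vecMul, dotProduct, hk, Matrix.one_apply]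
    rw [h1]
    simp [replCol, hk, mul_comm]

/-- The shear matrix as an element of `SL_n(ℝ)`. -/
noncomputable def shearSL [Fintype ι] (J : ι → Fin n) (k₀ : Fin n) (hJ : ∀ l, J l ≠ k₀) (N : ℕ)
    (B : ι → ℝ) : SLR n :=
  ⟨shearMat J k₀ (N + 1 : ℕ) B, det_shearMat hJ (by positivity) B⟩

theorem rowMul_mul_shearSL [Fintype ι] {J : ι → Fin n} {k₀ : Fin n} (hJ : ∀ l, J l ≠ k₀) (N : ℕ)
    (B : ι → ℝ) (g : SLR n) (X : ι → Fin n → ℝ) :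
    rowMul (g * shearSL J k₀ hJ N B).1 X =
      replCol k₀ (((N + 1 : ℕ) : ℝ)⁻¹ • rowMul g.1 X) (((N + 1 : ℕ) : ℝ) ^ n •
        ((fun i => (((N + 1 : ℕ) : ℝ)⁻¹ • rowMul g.1 X) i k₀) +
          colBlock J (((N + 1 : ℕ) : ℝ)⁻¹ • rowMul g.1 X) *ᵥ B)) := by
  change rowMul (g.1 * shearMat J k₀ (N + 1 : ℕ) B) X = _
  rw [rowMul_mul, rowMul_shearMat hJ (by positivity)]

/-- The Siegel transform of a function of tuples. -/
noncomputable def siegel (F : (ι → Fin n → ℝ) → ENNReal) (g : SLR n) : ENNReal :=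
  ∑' M : ι → Fin n → ℤ, F (rowMul (g : Matrix (Fin n) (Fin n) ℝ) (castTuple M))

theorem measurable_coe_SLR : Measurable fun g : SLR n => (fun i j => g.1 i j : Fin n → Fin n → ℝ) :=
  comap_measurable _

/-- A normalised bump function. -/
noncomputable def unitBump (ι : Type*) [Fintype ι] : (ι → ℝ) → ℝ :=
  (⟨1, 2, one_pos, one_lt_two⟩ : ContDiffBump (0 : ι → ℝ)).normed volume

theorem continuous_unitBump [Fintype ι] : Continuous (unitBump ι) :=
  ContDiffBump.continuous_normed _

theorem unitBump_nonneg [Fintype ι] (B : ι → ℝ) : 0 ≤ unitBump ι B := ContDiffBump.nonneg_normed _ _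

theorem unitBump_eq_zero [Fintype ι] {B : ι → ℝ} (hB : 2 < ‖B‖) : unitBump ι B = 0 := by
  by_contra h
  have : B ∈ Function.support (unitBump ι) := h
  rw [unitBump, ContDiffBump.support_normed_eq] at this
  simp only [Metric.mem_ball, dist_zero_right] at this
  linarith

theorem lintegral_unitBump [Fintype ι] : ∫⁻ B, ENNReal.ofReal (unitBump ι B) = 1 := by
  rw [← ofReal_integral_eq_lintegral_ofReal]
  · simp [unitBump, ContDiffBump.integral_normed]
  · exact ContDiffBump.integrable_normed _
  · exact ae_of_all _ unitBump_nonneg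

theorem exists_averaged_kernel [Fintype ι] {J : ι → Fin n} {k₀ : Fin n} (hJ : ∀ l, J l ≠ k₀) {δ : ℝ}
    (hδ : 0 < δ) {f : (ι → Fin n → ℝ) → ℝ} (hf : Continuous f) (hf0 : ∀ Z, 0 ≤ f Z)
    (hfδ : ∀ Z, f Z ≠ 0 → δ ≤ |(colBlock J Z).det|) {R : ℝ} (hfR : ∀ Z, f Z ≠ 0 → ‖Z‖ ≤ R) :
    ∃ (G : ℝ → (ι → Fin n → ℝ) → ℝ) (R' : ℝ), Continuous (Function.uncurry G) ∧
      (∀ ε ∈ Set.Icc (0 : ℝ) 1, ∀ Z, Z ∉ Metric.closedBall (0 : ι → Fin n → ℝ) R' → G ε Z = 0) ∧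
      (∀ ε Z, 0 ≤ G ε Z) ∧ ∀ ε Z, ENNReal.ofReal (G ε Z) =
        ∫⁻ v, ENNReal.ofReal (shearKernel J k₀ δ f (unitBump ι) ε Z v) := by
  have hwc : Continuous (unitBump ι) := continuous_unitBump
  set H := shearKernel J k₀ δ f (unitBump ι) with hH
  have hHc : Continuous fun p : (ℝ × (ι → Fin n → ℝ)) × (ι → ℝ) => H p.1.1 p.1.2 p.2 :=
    continuous_shearKernel hδ hf hwc
  have hH0 : ∀ ε Z v, 0 ≤ H ε Z v := fun ε Z v =>
    mul_nonneg (mul_nonneg (inv_nonneg.mpr (le_max_of_le_right hδ.le)) (hf0 _)) (unitBump_nonneg _)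
  have hHf : ∀ ε Z v, H ε Z v ≠ 0 → f (replCol k₀ Z v) ≠ 0 := fun ε Z v h h0 => h (by
    simp [hH, shearKernel, h0])
  have hHv : ∀ ε Z v, H ε Z v ≠ 0 → ‖v‖ ≤ R := by
    intro ε Z v h
    have h1 := hfR _ (hHf ε Z v h)
    refine (pi_norm_le_iff_of_nonneg ((norm_nonneg _).trans h1)).mpr fun i => ?_
    have h2 := ((norm_le_pi_norm (replCol k₀ Z v i) k₀).trans
      (norm_le_pi_norm (replCol k₀ Z v) i)).trans h1
    simpa [replCol] using h2
  set G : ℝ → (ι → Fin n → ℝ) → ℝ := fun ε Z => ∫ v in Metric.closedBall (0 : ι → ℝ) R, H ε Z v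
    with hG
  have hGc : Continuous (Function.uncurry G) := by
    refine continuous_parametric_integral_of_continuous
      (f := fun (p : ℝ × (ι → Fin n → ℝ)) v => H p.1 p.2 v) ?_ (isCompact_closedBall _ _)
    exact hHc
  have hGH : ∀ ε Z, ENNReal.ofReal (G ε Z) = ∫⁻ v, ENNReal.ofReal (H ε Z v) := by
    intro ε Z
    have hc : Continuous fun v => H ε Z v :=
      hHc.comp (by fun_prop : Continuous fun v : ι → ℝ => ((ε, Z), v))
    rw [hG, ofReal_integral_eq_lintegral_ofReal]
    · refine setLIntegral_eq_of_support_subset fun v hv => ?_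
      have : H ε Z v ≠ 0 := fun h => by simp [h] at hv
      simpa using hHv ε Z v this
    · exact hc.continuousOn.integrableOn_compact (isCompact_closedBall _ _)
    · exact ae_of_all _ fun v => hH0 _ _ _
  set R' := R + Fintype.card ι * (R * 2) with hR'
  have hGK : ∀ ε ∈ Set.Icc (0 : ℝ) 1, ∀ Z, Z ∉ Metric.closedBall (0 : ι → Fin n → ℝ) R' →
      G ε Z = 0 := by
    intro ε hε Z hZ
    refine integral_eq_zero_of_ae (ae_of_all _ fun v => ?_)
    by_contra hne
    refine hZ ?_
    have hne : H ε Z v ≠ 0 := hne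
    have hv := hHv _ _ _ hne
    have hR0 : 0 ≤ R := (norm_nonneg _).trans hv
    have hfne := hHf _ _ _ hne
    have hfr := hfR _ hfne
    have hd := hfδ _ hfne
    rw [colBlock_replCol hJ] at hd
    have hwne : unitBump ι (regInv δ (colBlock J Z) *ᵥ (ε • v - fun i => Z i k₀)) ≠ 0 :=
      fun h => hne (by
      simp [hH, shearKernel, h])
    rw [regInv_eq hδ hd] at hwne
    set u := (colBlock J Z)⁻¹ *ᵥ (ε • v - fun i => Z i k₀)
    have hu : ‖u‖ ≤ 2 := by
      by_contra h
      exact hwne (unitBump_eq_zero (not_le.mp h))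
    have hent : ∀ i k, k ≠ k₀ → |Z i k| ≤ R := fun i k hk => by
      have h2 := ((norm_le_pi_norm (replCol k₀ Z v i) k).trans
        (norm_le_pi_norm (replCol k₀ Z v) i)).trans hfr
      simpa [replCol, hk] using h2
    have hd0 : (colBlock J Z).det ≠ 0 := abs_pos.mp (hδ.trans_le hd)
    have hAu : colBlock J Z *ᵥ u = ε • v - fun i => Z i k₀ := by
      simp only [u]
      rw [mulVec_mulVec, mul_nonsing_inv _ (isUnit_iff_ne_zero.mpr hd0), one_mulVec]
    have hR'0 : 0 ≤ R' := by positivity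
    rw [mem_closedBall_zero_iff]
    refine (pi_norm_le_iff_of_nonneg hR'0).mpr fun i => (pi_norm_le_iff_of_nonneg hR'0).mpr
      fun k => ?_
    rw [Real.norm_eq_abs]
    by_cases hk : k = k₀
    · subst hk
      have h1 := congrFun hAu i
      simp only [mulVec, dotProduct, Pi.sub_apply, Pi.smul_apply, smul_eq_mul] at h1
      have h2 : |∑ l, colBlock J Z i l * u l| ≤ Fintype.card ι * (R * 2) := by
        refine (Finset.abs_sum_le_sum_abs _ _).trans ?_
        rw [← nsmul_eq_mul, ← Finset.card_univ]
        refine Finset.sum_le_card_nsmul _ _ _ fun l _ => ?_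
        rw [abs_mul]
        exact mul_le_mul (hent i (J l) (hJ l)) ((norm_le_pi_norm u l).trans hu) (abs_nonneg _) hR0
      have h3 : |ε * v i| ≤ R := by
        rw [abs_mul, abs_of_nonneg hε.1]
        exact (mul_le_mul hε.2 ((norm_le_pi_norm v i).trans hv) (abs_nonneg _) zero_le_one).trans
          (by simp)
      have h4 : Z i k = ε * v i - ∑ l, colBlock J Z i l * u l := by linarith
      rw [h4]
      exact (abs_sub _ _).trans (by linarith)
    · exact (hent i k hk).trans (by
          simp only [hR']
          nlinarith [(Nat.cast_nonneg (Fintype.card ι) : (0 : ℝ) ≤ _)])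
  exact ⟨G, R', hGc, hGK, fun ε Z => integral_nonneg fun v => hH0 _ _ _, hGH⟩

set_option maxHeartbeats 400000 in
theorem tendsto_average_siegel [Fintype ι] {J : ι → Fin n} {k₀ : Fin n} (hJ : ∀ l, J l ≠ k₀) {δ : ℝ}
    (hδ : 0 < δ) {f : (ι → Fin n → ℝ) → ℝ} (hf : Continuous f) (hf0 : ∀ Z, 0 ≤ f Z)
    (hfδ : ∀ Z, f Z ≠ 0 → δ ≤ |(colBlock J Z).det|) {R : ℝ} (hfR : ∀ Z, f Z ≠ 0 → ‖Z‖ ≤ R)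
    (g : SLR n) :
    Tendsto (fun N : ℕ => ∫⁻ B, ENNReal.ofReal (unitBump ι B) *
      siegel (fun Z => ENNReal.ofReal (f Z)) (g * shearSL J k₀ hJ N B)) atTop
      (𝓝 (∫⁻ Z, ENNReal.ofReal (f Z))) := by
  have hwc : Continuous (unitBump ι) := continuous_unitBump
  obtain ⟨G, R', hGc, hGK, hG0, hGH⟩ := exists_averaged_kernel hJ hδ hf hf0 hfδ hfR
  have hn0 : n ≠ 0 := by
    have := k₀.pos
    omega
  have hlim := tendsto_riemann_sum_family (g : Matrix (Fin n) (Fin n) ℝ) g.2 G hGc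
    (isCompact_closedBall (0 : ι → Fin n → ℝ) R') hGK (fun N => ((N : ℝ) ^ n)⁻¹)
    (fun N => ⟨by positivity, by
      rcases Nat.eq_zero_or_pos N with rfl | hN
      · simp [hn0]
      · exact inv_le_one_of_one_le₀ (one_le_pow₀ (by exact_mod_cast hN))⟩)
    (tendsto_inv_atTop_zero.comp ((tendsto_pow_atTop hn0).comp tendsto_natCast_atTop_atTop))
  have hlim2 : ∫⁻ Z, ENNReal.ofReal (f Z) = ENNReal.ofReal (∫ Z, G 0 Z) := by
    rw [ofReal_integral_eq_lintegral_ofReal]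
    · simp only [hGH]
      exact (lintegral_shearKernel hJ hδ hf hf0 hfδ hwc lintegral_unitBump).symm
    · exact (hGc.comp (by fun_prop : Continuous fun Z : ι → Fin n → ℝ =>
        ((0 : ℝ), Z))).integrable_of_hasCompactSupport
        (HasCompactSupport.intro (isCompact_closedBall _ _) fun Z hZ => hGK 0 (by simp) Z hZ)
    · exact ae_of_all _ fun Z => hG0 _ _
  rw [hlim2]
  refine ((ENNReal.continuous_ofReal.tendsto _).comp
    (hlim.comp (tendsto_add_atTop_nat 1))).congr fun N => ?_
  simp only [Function.comp]
  set c : ℝ := ((N + 1 : ℕ) : ℝ) with hc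
  have hc0 : 0 < c := by positivity
  have hterm : ∀ M : ι → Fin n → ℤ, ∫⁻ B, ENNReal.ofReal (unitBump ι B) * ENNReal.ofReal
      (f (rowMul (g * shearSL J k₀ hJ N B).1 (castTuple M))) =
      ENNReal.ofReal (((c ^ n) ^ Fintype.card ι)⁻¹ * G (c ^ n)⁻¹
        (rowMul (g : Matrix (Fin n) (Fin n) ℝ) (castTuple M) / ((N + 1 : ℕ) : ι → Fin n → ℝ))) := by
    intro M
    have hZ : rowMul (g : Matrix (Fin n) (Fin n) ℝ) (castTuple M) / ((N + 1 : ℕ) : ι → Fin n → ℝ)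
        = c⁻¹ • rowMul (g : Matrix (Fin n) (Fin n) ℝ) (castTuple M) := by
      funext i k
      simp only [Pi.div_apply, Pi.natCast_apply, Pi.smul_apply, smul_eq_mul, ← hc]
      rw [div_eq_inv_mul]
    rw [ENNReal.ofReal_mul (by positivity), hGH, hZ,
      ← lintegral_shear hJ hδ hf hf0 hfδ hwc (pow_pos hc0 n)]
    refine lintegral_congr fun B => ?_
    rw [rowMul_mul_shearSL]
  have hmeas : ∀ M : ι → Fin n → ℤ, Measurable fun B =>
      ENNReal.ofReal (unitBump ι B) * ENNReal.ofReal
      (f (rowMul (g * shearSL J k₀ hJ N B).1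
        (castTuple M))) := by
    intro M
    refine (hwc.measurable.ennreal_ofReal).fun_mul (Continuous.measurable ?_).ennreal_ofReal
    refine hf.comp ?_
    simp only [rowMul_mul_shearSL]
    have h1 : ∀ A : Matrix ι ι ℝ, Continuous fun B : ι → ℝ => A *ᵥ B := fun A =>
      Continuous.matrix_mulVec continuous_const continuous_id
    have h2 : ∀ (A : Matrix ι ι ℝ) (z : ι → ℝ) (a : ℝ), Continuous fun B : ι → ℝ =>
      a • (z + A *ᵥ B) := fun A z a => by
        have := h1 A
        fun_prop
    exact (continuous_replCol k₀).comp (continuous_const.prodMk (h2 _ _ _))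
  simp only [siegel, ← ENNReal.tsum_mul_left]
  rw [lintegral_tsum fun M => (hmeas M).aemeasurable]
  simp only [hterm]
  rw [← ENNReal.ofReal_tsum_of_nonneg, tsum_mul_left]
  · congr 1
    rw [Fintype.card_fin, mul_comm (Fintype.card ι) n, pow_mul]
    rw [div_eq_inv_mul]
  · intro M
    exact mul_nonneg (by positivity) (hG0 _ _)
  · refine Summable.mul_left _ (summable_of_hasFiniteSupport ?_)
    have hb : Bornology.IsBounded
        ((fun Z : ι → Fin n → ℝ => c • Z) '' Metric.closedBall 0 R') :=
      ((isCompact_closedBall _ _).image (by fun_prop)).isBounded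
    refine (finite_rowMul_mem hb (g : Matrix (Fin n) (Fin n) ℝ) (by simp)).subset fun M hM =>
      ⟨rowMul (g : Matrix (Fin n) (Fin n) ℝ) (castTuple M) / ((N + 1 : ℕ) : ι → Fin n → ℝ), ?_, ?_⟩
    · by_contra h
      refine hM (hGK _ ⟨by positivity, inv_le_one_of_one_le₀ (one_le_pow₀ ?_)⟩ _ h)
      simp [hc]
    · funext i k
      simp only [Pi.div_apply, Pi.natCast_apply, Pi.smul_apply, smul_eq_mul, ← hc]
      field_simp

end Averaging

section MeanValue

open Filter Topology

variable {ι : Type*} {n : ℕ}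

theorem siegel_mul_left {γ : SLR n} (hγ : γ ∈ SLZ n) (F : (ι → Fin n → ℝ) → ENNReal) (g : SLR n) :
    siegel F (γ * g) = siegel F g := by
  obtain ⟨c, rfl⟩ := hγ
  let e : (ι → Fin n → ℤ) ≃ (ι → Fin n → ℤ) :=
    { toFun := fun M i => M i ᵥ* c.1
      invFun := fun M i => M i ᵥ* (c⁻¹).1
      left_inv := fun M => funext fun i => by
        have : c.1 * (c⁻¹).1 = 1 := by
          have := congrArg Subtype.val (mul_inv_cancel c)
          exact this
        simp only [vecMul_vecMul, this, vecMul_one]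
      right_inv := fun M => funext fun i => by
        have : (c⁻¹).1 * c.1 = 1 := by
          have := congrArg Subtype.val (inv_mul_cancel c)
          exact this
        simp only [vecMul_vecMul, this, vecMul_one] }
  rw [siegel, siegel]
  conv_rhs => rw [← e.tsum_eq]
  refine tsum_congr fun M => ?_
  congr 1
  change rowMul (((SpecialLinearGroup.map (Int.castRingHom ℝ)) c).1 * g.1) (castTuple M) = _
  rw [rowMul_mul]
  congr 1
  funext i k
  simp only [rowMul, castTuple, e, vecMul, dotProduct, Equiv.coe_fn_mk, Int.cast_sum, Int.cast_mul]
  rfl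

/-- The Siegel transform as a function on the space of lattices. -/
noncomputable def siegelX (F : (ι → Fin n → ℝ) → ENNReal) (x : LatSpace n) : ENNReal :=
  siegel F (Quotient.out x)

theorem siegelX_latMk (F : (ι → Fin n → ℝ) → ENNReal) (g : SLR n) :
    siegelX F (latMk n g) = siegel F g := by
  have h : (QuotientGroup.rightRel (SLZ n)).r (Quotient.out (latMk n g)) g := Quotient.mk_out g
  have h2 : g * (Quotient.out (latMk n g))⁻¹ ∈ SLZ n := QuotientGroup.rightRel_apply.mp h
  rw [siegelX]
  conv_rhs => rw [← inv_mul_cancel_right g (Quotient.out (latMk n g))]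
  rw [siegel_mul_left h2]

theorem latMk_surjective (x : LatSpace n) : ∃ g, latMk n g = x := Quotient.exists_rep x

theorem measurable_of_latMk {β : Type*} [MeasurableSpace β] {u : LatSpace n → β}
    (h : Measurable fun g => u (latMk n g)) : Measurable u :=
  measurable_from_quotient.mpr h

theorem measurable_latMk : Measurable (latMk n) :=
  @measurable_quotient_mk' (SLR n) _ (QuotientGroup.rightRel (SLZ n))

theorem measurable_rowMul_SLR (X : ι → Fin n → ℝ) :
    Measurable fun g : SLR n => rowMul g.1 X := by
  have h : Measurable fun a : Fin n → Fin n → ℝ => rowMul (Matrix.of a) X := by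
    refine measurable_pi_lambda _ fun i => measurable_pi_lambda _ fun k => ?_
    simp only [rowMul, vecMul, dotProduct, Matrix.of_apply]
    fun_prop
  exact h.comp measurable_coe_SLR

theorem measurable_siegel [Finite ι] {F : (ι → Fin n → ℝ) → ENNReal} (hF : Measurable F) :
    Measurable (siegel F) :=
  Measurable.tsum fun _ => hF.comp (measurable_rowMul_SLR _)

theorem measurable_siegelX [Finite ι] {F : (ι → Fin n → ℝ) → ENNReal} (hF : Measurable F) :
    Measurable (siegelX F) :=
  measurable_of_latMk (by simpa only [siegelX_latMk] using measurable_siegel hF)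

theorem measurable_mul_right_SLR (a : SLR n) : Measurable fun g : SLR n => g * a := by
  refine measurable_comap_iff.mpr ?_
  have h : Measurable fun b : Fin n → Fin n → ℝ => (fun i j => (Matrix.of b * a.1) i j) := by
    refine measurable_pi_lambda _ fun i => measurable_pi_lambda _ fun k => ?_
    simp only [Matrix.mul_apply, Matrix.of_apply]
    fun_prop
  exact h.comp measurable_coe_SLR

theorem measurable_rTranslate (a : SLR n) : Measurable (rTranslate n a) :=
  measurable_of_latMk (measurable_latMk.comp (measurable_mul_right_SLR a))

theorem continuous_siegel_shear [Fintype ι] {J : ι → Fin n} {k₀ : Fin n} (hJ : ∀ l, J l ≠ k₀)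
    {f : (ι → Fin n → ℝ) → ℝ} (hf : Continuous f) {R : ℝ} (hfR : ∀ Z, f Z ≠ 0 → ‖Z‖ ≤ R)
    (N : ℕ) (g : SLR n) :
    Continuous fun B => siegel (fun Z => ENNReal.ofReal (f Z)) (g * shearSL J k₀ hJ N B) := by
  set c : ℝ := ((N + 1 : ℕ) : ℝ) with hc
  have hc0 : 0 < c := by positivity
  have hcont : ∀ M : ι → Fin n → ℤ, Continuous fun B => ENNReal.ofReal
      (f (rowMul (g * shearSL J k₀ hJ N B).1 (castTuple M))) := by
    intro M
    refine ENNReal.continuous_ofReal.comp (hf.comp ?_)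
    simp only [rowMul_mul_shearSL]
    have h1 : ∀ A : Matrix ι ι ℝ, Continuous fun B : ι → ℝ => A *ᵥ B := fun A =>
      Continuous.matrix_mulVec continuous_const continuous_id
    have h2 : ∀ (A : Matrix ι ι ℝ) (z : ι → ℝ) (a : ℝ), Continuous fun B : ι → ℝ =>
      a • (z + A *ᵥ B) := fun A z a => by
        have := h1 A
        fun_prop
    exact (continuous_replCol k₀).comp (continuous_const.prodMk (h2 _ _ _))
  refine continuous_iff_continuousAt.mpr fun B₀ => ?_
  set r := ‖B₀‖ + 1
  set R' := |R| + |R| / c ^ n + Fintype.card ι * (|R| * r)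
  have hb : Bornology.IsBounded
      ((fun Z : ι → Fin n → ℝ => c • Z) '' Metric.closedBall 0 R') :=
    ((isCompact_closedBall _ _).image (by fun_prop)).isBounded
  have hfin := finite_rowMul_mem hb g.1 (by rw [g.2]; exact one_ne_zero)
  have hev : ∀ᶠ B in 𝓝 B₀, siegel (fun Z => ENNReal.ofReal (f Z)) (g * shearSL J k₀ hJ N B) =
      ∑ M ∈ hfin.toFinset, ENNReal.ofReal
        (f (rowMul (g * shearSL J k₀ hJ N B).1 (castTuple M))) := by
    filter_upwards [Metric.ball_mem_nhds B₀ one_pos] with B hB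
    have hBr : ‖B‖ ≤ r := by
      have h1 := norm_sub_norm_le B B₀
      rw [Metric.mem_ball, dist_eq_norm] at hB
      linarith
    refine tsum_eq_sum fun M hM => ?_
    by_contra hne
    refine hM (hfin.mem_toFinset.mpr ⟨c⁻¹ • rowMul g.1 (castTuple M), ?_, ?_⟩)
    · have hne' : f (rowMul (g * shearSL J k₀ hJ N B).1 (castTuple M)) ≠ 0 := fun h => hne (by
        simp only [h, ENNReal.ofReal_zero])
      have h1 := (hfR _ hne').trans (le_abs_self R)
      rw [rowMul_mul_shearSL, ← hc] at h1
      set Z := c⁻¹ • rowMul g.1 (castTuple M)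
      set v := c ^ n • ((fun i => Z i k₀) + colBlock J Z *ᵥ B) with hv
      have hent : ∀ i k, |replCol k₀ Z v i k| ≤ |R| := fun i k =>
        ((norm_le_pi_norm (replCol k₀ Z v i) k).trans (norm_le_pi_norm (replCol k₀ Z v) i)).trans h1
      have hent1 : ∀ i k, k ≠ k₀ → |Z i k| ≤ |R| := fun i k hk => by
        simpa [replCol, hk] using hent i k
      have hvi : ∀ i, |v i| ≤ |R| := fun i => by simpa [replCol] using hent i k₀
      have hr0 : 0 ≤ r := by positivity
      have hR'0 : 0 ≤ R' := by positivity
      rw [mem_closedBall_zero_iff]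
      refine (pi_norm_le_iff_of_nonneg hR'0).mpr fun i => (pi_norm_le_iff_of_nonneg hR'0).mpr
        fun k => ?_
      rw [Real.norm_eq_abs]
      by_cases hk : k = k₀
      · subst hk
        have h2 : |∑ l, colBlock J Z i l * B l| ≤ Fintype.card ι * (|R| * r) := by
          refine (Finset.abs_sum_le_sum_abs _ _).trans ?_
          rw [← nsmul_eq_mul, ← Finset.card_univ]
          refine Finset.sum_le_card_nsmul _ _ _ fun l _ => ?_
          rw [abs_mul]
          exact mul_le_mul (hent1 i (J l) (hJ l)) ((norm_le_pi_norm B l).trans hBr) (abs_nonneg _)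
            (abs_nonneg _)
        have h3 : v i = c ^ n * (Z i k + ∑ l, colBlock J Z i l * B l) := by
          simp [hv, mulVec, dotProduct, mul_add]
        have h4 : Z i k = v i / c ^ n - ∑ l, colBlock J Z i l * B l := by
          rw [h3]
          field_simp
          ring
        rw [h4]
        refine (abs_sub _ _).trans (add_le_add ?_ h2)
        rw [abs_div, abs_of_pos (by positivity : 0 < c ^ n)]
        have := div_le_div_of_nonneg_right (hvi i) (by positivity : 0 ≤ c ^ n)
        linarith [abs_nonneg R]
      · have h2 := hent1 i k hk
        have h3 : 0 ≤ |R| / c ^ n := by positivity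
        have h4 : 0 ≤ (Fintype.card ι : ℝ) * (|R| * r) := by positivity
        exact h2.trans (by simp only [R']; linarith)
    · simp [hc0.ne']
  refine ContinuousAt.congr ?_ (hev.mono fun B hB => hB.symm)
  exact (continuous_finsetSum _ fun M _ => hcont M).continuousAt

theorem lintegral_siegelX_rTranslate {μ : Measure (LatSpace n)}
    (hinv : ∀ a : SLR n, μ.map (rTranslate n a) = μ) (a : SLR n) {u : LatSpace n → ENNReal}
    (hu : Measurable u) : ∫⁻ x, u (rTranslate n a x) ∂μ = ∫⁻ x, u x ∂μ := by
  rw [← lintegral_map hu (measurable_rTranslate a), hinv]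

/-- If averages of a function over a family of measure preserving changes of variable converge to
a constant pointwise, then its integral is that constant. -/
theorem lintegral_eq_of_tendsto_average {X Y : Type*} [MeasurableSpace X] [MeasurableSpace Y]
    {μ : Measure X} [IsProbabilityMeasure μ] {ν : Measure Y} [SFinite ν] {W : Y → ENNReal}
    (hW : Measurable W) (hW1 : ∫⁻ B, W B ∂ν = 1) {u₀ : X → ENNReal} (hu₀ : Measurable u₀)
    {u : ℕ → Y → X → ENNReal} (hum : ∀ N, Measurable (Function.uncurry (u N)))
    (hinvu : ∀ h : ENNReal → ENNReal, Measurable h → ∀ N B,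
      ∫⁻ x, h (u N B x) ∂μ = ∫⁻ x, h (u₀ x) ∂μ) {I : ENNReal}
    (hlim : ∀ x, Tendsto (fun N => ∫⁻ B, W B * u N B x ∂ν) atTop (𝓝 I)) :
    ∫⁻ x, u₀ x ∂μ = I := by
  have humS : ∀ N, Measurable fun p : X × Y => u N p.2 p.1 := fun N => (hum N).comp measurable_swap
  have havg : ∀ (h : ENNReal → ENNReal), Measurable h → ∀ N,
      ∫⁻ x, ∫⁻ B, W B * h (u N B x) ∂ν ∂μ = ∫⁻ x, h (u₀ x) ∂μ := by
    intro h hh N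
    rw [lintegral_lintegral_swap]
    · have : ∀ B, ∫⁻ x, W B * h (u N B x) ∂μ = W B * ∫⁻ x, h (u₀ x) ∂μ := by
        intro B
        have hm : Measurable fun x => h (u N B x) := hh.comp ((humS N).comp measurable_prodMk_right)
        rw [lintegral_const_mul _ hm]
        congr 1
        exact hinvu h hh N B
      simp only [this]
      rw [lintegral_mul_const _ hW, hW1, one_mul]
    · refine Measurable.aemeasurable ?_
      exact (hW.comp measurable_snd).mul (hh.comp (humS N))
  refine le_antisymm ?_ ?_
  · have hM : ∀ M : ℕ, ∫⁻ x, min (u₀ x) M ∂μ ≤ I := by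
      intro M
      have hmin : Measurable fun t : ENNReal => min t (M : ENNReal) := by fun_prop
      have h1 : Tendsto (fun N => ∫⁻ x, min (∫⁻ B, W B * u N B x ∂ν) (M : ENNReal) ∂μ) atTop
          (𝓝 (∫⁻ x, min (I) (M : ENNReal) ∂μ)) := by
        refine tendsto_lintegral_of_dominated_convergence (fun _ => (M : ENNReal)) (fun N => ?_)
          (fun N => ae_of_all _ fun x => min_le_right _ _) (by simp) (ae_of_all _ fun x => ?_)
        · refine hmin.comp (Measurable.lintegral_prod_right' (f := fun p : X × Y =>
            W p.2 * u N p.2 p.1) ?_)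
          exact (hW.comp measurable_snd).mul (humS N)
        · exact (hlim x).min tendsto_const_nhds
      have h2 : ∀ N, ∫⁻ x, min (u₀ x) (M : ENNReal) ∂μ ≤
          ∫⁻ x, min (∫⁻ B, W B * u N B x ∂ν) (M : ENNReal) ∂μ := by
        intro N
        rw [← havg _ hmin N]
        refine lintegral_mono fun x => le_min ?_ ?_
        · exact lintegral_mono fun B => mul_le_mul_right (min_le_left _ _) _
        · calc ∫⁻ B, W B * min (u N B x) (M : ENNReal) ∂ν ≤ ∫⁻ B, W B * (M : ENNReal) ∂ν :=
                lintegral_mono fun B => mul_le_mul_right (min_le_right _ _) _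
            _ = M := by rw [lintegral_mul_const _ hW, hW1, one_mul]
      refine (ge_of_tendsto' h1 h2).trans ?_
      simp
    have h3 : ∫⁻ x, u₀ x ∂μ = ⨆ M : ℕ, ∫⁻ x, min (u₀ x) M ∂μ := by
      rw [← lintegral_iSup (fun M => hu₀.min measurable_const)
        fun M M' hMM' x => min_le_min_left _ (by exact_mod_cast hMM')]
      refine lintegral_congr fun x => ?_
      rw [← inf_iSup_eq, ENNReal.iSup_natCast, inf_top_eq]
    rw [h3]
    exact iSup_le hM
  · calc I = ∫⁻ x, I ∂μ := by simp
      _ = ∫⁻ x, liminf (fun N => ∫⁻ B, W B * u N B x ∂ν) atTop ∂μ :=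
        lintegral_congr fun x => (hlim x).liminf_eq.symm
      _ ≤ liminf (fun N => ∫⁻ x, ∫⁻ B, W B * u N B x ∂ν ∂μ) atTop := by
        refine lintegral_liminf_le fun N => ?_
        refine Measurable.lintegral_prod_right' (f := fun p : X × Y =>
            W p.2 * u N p.2 p.1) ?_
        exact (hW.comp measurable_snd).mul (humS N)
      _ = ∫⁻ x, u₀ x ∂μ := by
        simp only [havg (fun t => t) measurable_id]
        exact tendsto_const_nhds.liminf_eq


/-- The mean value theorem for functions supported where a fixed minor does not vanish. -/
theorem lintegral_siegelX_of_continuous [Fintype ι] {μ : Measure (LatSpace n)}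
    [IsProbabilityMeasure μ] (hinv : ∀ a : SLR n, μ.map (rTranslate n a) = μ)
    {J : ι → Fin n} {k₀ : Fin n} (hJ : ∀ l, J l ≠ k₀) {δ : ℝ}
    (hδ : 0 < δ) {f : (ι → Fin n → ℝ) → ℝ} (hf : Continuous f) (hf0 : ∀ Z, 0 ≤ f Z)
    (hfδ : ∀ Z, f Z ≠ 0 → δ ≤ |(colBlock J Z).det|) {R : ℝ} (hfR : ∀ Z, f Z ≠ 0 → ‖Z‖ ≤ R) :
    ∫⁻ x, siegelX (fun Z => ENNReal.ofReal (f Z)) x ∂μ = ∫⁻ Z, ENNReal.ofReal (f Z) := by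
  set F : (ι → Fin n → ℝ) → ENNReal := fun Z => ENNReal.ofReal (f Z)
  have hF : Measurable F := hf.measurable.ennreal_ofReal
  set W : (ι → ℝ) → ENNReal := fun B => ENNReal.ofReal (unitBump ι B)
  have hW : Measurable W := continuous_unitBump.measurable.ennreal_ofReal
  have hW1 : ∫⁻ B, W B = 1 := lintegral_unitBump
  set u : ℕ → (ι → ℝ) → LatSpace n → ENNReal := fun N B x =>
    siegelX F (rTranslate n (shearSL J k₀ hJ N B) x) with hu
  have hug : ∀ N B g, u N B (latMk n g) = siegel F (g * shearSL J k₀ hJ N B) := fun N B g =>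
    siegelX_latMk F _
  have hum : ∀ N, Measurable (Function.uncurry (u N)) := by
    intro N
    refine measurable_uncurry_of_continuous_of_measurable (fun x => ?_) fun B =>
      (measurable_siegelX hF).comp (measurable_rTranslate _)
    obtain ⟨g, rfl⟩ := latMk_surjective x
    simp only [hug]
    exact continuous_siegel_shear hJ hf hfR N g
  have hlim : ∀ x, Tendsto (fun N => ∫⁻ B, W B * u N B x) atTop (𝓝 (∫⁻ Z, F Z)) := by
    intro x
    obtain ⟨g, rfl⟩ := latMk_surjective x
    simp only [hug]
    exact tendsto_average_siegel hJ hδ hf hf0 hfδ hfR g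
  have hinvu : ∀ (h : ENNReal → ENNReal), Measurable h → ∀ N B,
      ∫⁻ x, h (u N B x) ∂μ = ∫⁻ x, h (siegelX F x) ∂μ := fun h hh N B =>
    lintegral_siegelX_rTranslate hinv (shearSL J k₀ hJ N B) (u := fun x => h (siegelX F x))
      (hh.comp (measurable_siegelX hF))
  exact lintegral_eq_of_tendsto_average hW hW1 (measurable_siegelX hF) hum hinvu hlim

end MeanValue

section MeanValueMeasure

open Filter Topology

variable {ι : Type*} {n : ℕ}

theorem exists_colBlock_det_ne_zero [Fintype ι] {Z : ι → Fin n → ℝ} (hZ : LinearIndependent ℝ Z) :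
    ∃ J : ι → Fin n, (colBlock J Z).det ≠ 0 := by
  set c : Fin n → ι → ℝ := fun k i => Z i k with hc
  obtain ⟨κ, a, ha, hsp, hli⟩ := exists_linearIndependent' ℝ c
  have hr : Module.finrank ℝ (Submodule.span ℝ (Set.range c)) = Fintype.card ι := by
    have h1 := (Matrix.of Z).rank_eq_finrank_span_cols
    have h2 : (Matrix.of Z).rank = Fintype.card ι := LinearIndependent.rank_matrix hZ
    rw [← h2, h1]
    rfl
  have : Finite κ := Finite.of_injective a ha
  have : Fintype κ := Fintype.ofFinite κ
  have hcard : Fintype.card κ = Fintype.card ι := by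
    rw [← hr, ← hsp, finrank_span_eq_card hli]
  obtain ⟨e⟩ := Fintype.card_eq.mp hcard.symm
  refine ⟨a ∘ e, ?_⟩
  have h3 : LinearIndependent ℝ (colBlock (a ∘ e) Z).col := by
    have := hli.comp e e.injective
    exact this
  have h4 := linearIndependent_cols_iff_isUnit.mp h3
  exact ((isUnit_iff_isUnit_det _).mp h4).ne_zero

theorem linearIndependent_of_colBlock_det_ne_zero [Fintype ι] {Z : ι → Fin n → ℝ} {J : ι → Fin n}
    (hJ : (colBlock J Z).det ≠ 0) : LinearIndependent ℝ Z := by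
  have h1 : LinearIndependent ℝ (colBlock J Z).row :=
    linearIndependent_rows_iff_isUnit.mpr
      ((isUnit_iff_isUnit_det _).mpr (isUnit_iff_ne_zero.mpr hJ))
  exact LinearIndependent.of_comp (LinearMap.funLeft ℝ ℝ J) h1

theorem linearIndependent_iff_exists_colBlock [Fintype ι] {Z : ι → Fin n → ℝ} :
    LinearIndependent ℝ Z ↔ ∃ J : ι → Fin n, (colBlock J Z).det ≠ 0 :=
  ⟨exists_colBlock_det_ne_zero, fun ⟨_, hJ⟩ => linearIndependent_of_colBlock_det_ne_zero hJ⟩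

theorem measurableSet_det_ne_zero [Fintype ι] (J : ι → Fin n) :
    MeasurableSet {Z : ι → Fin n → ℝ | (colBlock J Z).det ≠ 0} :=
  (isOpen_ne_fun ((continuous_colBlock J).matrix_det) continuous_const).measurableSet

theorem measurableSet_linearIndependent [Fintype ι] :
    MeasurableSet {Z : ι → Fin n → ℝ | LinearIndependent ℝ Z} := by
  simp only [linearIndependent_iff_exists_colBlock, Set.ofPred_exists]
  exact MeasurableSet.iUnion measurableSet_det_ne_zero

/-- The intensity measure of the random set of tuples of lattice vectors. -/
noncomputable def tupleMeasure (ι : Type*) (μ : Measure (LatSpace n)) :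
    Measure (ι → Fin n → ℝ) :=
  μ.bind fun x => Measure.sum fun M : ι → Fin n → ℤ =>
    Measure.dirac (rowMul (Quotient.out x).1 (castTuple M))

theorem lintegral_tupleMeasure [Finite ι] (μ : Measure (LatSpace n))
    {F : (ι → Fin n → ℝ) → ENNReal} (hF : Measurable F) :
    ∫⁻ Z, F Z ∂(tupleMeasure ι μ) = ∫⁻ x, siegelX F x ∂μ := by
  have key : ∀ {G : (ι → Fin n → ℝ) → ENNReal}, Measurable G → ∀ x : LatSpace n,
      ∫⁻ Z, G Z ∂(Measure.sum fun M : ι → Fin n → ℤ =>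
        Measure.dirac (rowMul (Quotient.out x).1 (castTuple M))) = siegelX G x := by
    intro G hG x
    rw [lintegral_sum_measure]
    exact tsum_congr fun M => lintegral_dirac' _ hG
  have hm : Measurable fun x : LatSpace n => Measure.sum fun M : ι → Fin n → ℤ =>
      Measure.dirac (rowMul (Quotient.out x).1 (castTuple M)) := by
    refine Measure.measurable_of_measurable_coe _ fun s hs => ?_
    have h1 : Measurable (s.indicator (1 : (ι → Fin n → ℝ) → ENNReal)) :=
      measurable_one.indicator hs
    have h2 : (fun x : LatSpace n => (Measure.sum fun M : ι → Fin n → ℤ =>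
        Measure.dirac (rowMul (Quotient.out x).1 (castTuple M))) s) =
        siegelX (s.indicator 1) := by
      funext x
      rw [← key h1, lintegral_indicator_one hs]
    rw [h2]
    exact measurable_siegelX h1
  rw [tupleMeasure, Measure.lintegral_bind hm.aemeasurable hF.aemeasurable]
  exact lintegral_congr fun x => key hF x

/-- Continuous cut-offs increasing to the indicator of a nonvanishing minor. -/
noncomputable def minorCutoff [Fintype ι] (J : ι → Fin n) (k : ℕ) (Z : ι → Fin n → ℝ) : ℝ :=
  min 1 (max 0 ((k + 1) * |(colBlock J Z).det| - 1)) * min 1 (max 0 (k + 1 - ‖Z‖))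

theorem continuous_minorCutoff [Fintype ι] (J : ι → Fin n) (k : ℕ) :
    Continuous (minorCutoff J k) := by
  have h : Continuous fun Z : ι → Fin n → ℝ => (colBlock J Z).det :=
    (continuous_colBlock J).matrix_det
  unfold minorCutoff
  fun_prop

theorem minorCutoff_nonneg [Fintype ι] (J : ι → Fin n) (k : ℕ) (Z) : 0 ≤ minorCutoff J k Z :=
  mul_nonneg (le_min zero_le_one (le_max_left _ _)) (le_min zero_le_one (le_max_left _ _))

theorem minorCutoff_le_one [Fintype ι] (J : ι → Fin n) (k : ℕ) (Z) : minorCutoff J k Z ≤ 1 :=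
  mul_le_one₀ (min_le_left _ _) (le_min zero_le_one (le_max_left _ _)) (min_le_left _ _)

theorem le_det_of_minorCutoff_ne_zero [Fintype ι] {J : ι → Fin n} {k : ℕ} {Z}
    (h : minorCutoff J k Z ≠ 0) : ((k : ℝ) + 1)⁻¹ ≤ |(colBlock J Z).det| := by
  by_contra! hlt
  refine h ?_
  have : ((k : ℝ) + 1) * |(colBlock J Z).det| - 1 ≤ 0 := by
    rw [← one_div, lt_div_iff₀' (by positivity)] at hlt
    linarith
  rw [minorCutoff, max_eq_left this]
  simp

theorem norm_le_of_minorCutoff_ne_zero [Fintype ι] {J : ι → Fin n} {k : ℕ} {Z}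
    (h : minorCutoff J k Z ≠ 0) : ‖Z‖ ≤ k + 1 := by
  by_contra! hlt
  refine h ?_
  rw [minorCutoff, max_eq_left (by linarith : (k : ℝ) + 1 - ‖Z‖ ≤ 0)]
  simp

theorem monotone_minorCutoff [Fintype ι] (J : ι → Fin n) (Z) :
    Monotone fun k => minorCutoff J k Z := by
  intro k k' hk
  have hk' : (k : ℝ) ≤ k' := by exact_mod_cast hk
  refine mul_le_mul ?_ ?_ (le_min zero_le_one (le_max_left _ _))
    (le_min zero_le_one (le_max_left _ _))
  · gcongr
  · gcongr

theorem iSup_minorCutoff [Fintype ι] (J : ι → Fin n) (Z) :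
    ⨆ k, ENNReal.ofReal (minorCutoff J k Z) =
      {Z : ι → Fin n → ℝ | (colBlock J Z).det ≠ 0}.indicator 1 Z := by
  by_cases h : (colBlock J Z).det = 0
  · have : ∀ k, minorCutoff J k Z = 0 := fun k => by simp [minorCutoff, h]
    simp [this, h]
  · rw [Set.indicator_of_mem (by exact h)]
    refine le_antisymm (iSup_le fun k => ?_) ?_
    · exact ENNReal.ofReal_le_one.mpr (minorCutoff_le_one J k Z)
    · have hd : 0 < |(colBlock J Z).det| := abs_pos.mpr h
      obtain ⟨k, hk⟩ := exists_nat_ge (max (2 / |(colBlock J Z).det|) ‖Z‖)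
      refine le_iSup_of_le k ?_
      have h1 := (le_max_left _ _).trans hk
      have h2 := (le_max_right _ _).trans hk
      rw [div_le_iff₀ hd] at h1
      rw [minorCutoff, min_eq_left, min_eq_left]
      · simp
      · exact le_max_of_le_right (by linarith)
      · exact le_max_of_le_right (by nlinarith)

theorem tupleMeasure_restrict_minor [Fintype ι] {μ : Measure (LatSpace n)}
    [IsProbabilityMeasure μ] (hinv : ∀ a : SLR n, μ.map (rTranslate n a) = μ)
    {J : ι → Fin n} {k₀ : Fin n} (hJ : ∀ l, J l ≠ k₀) :
    (tupleMeasure ι μ).restrict {Z | (colBlock J Z).det ≠ 0} =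
      (volume : Measure (ι → Fin n → ℝ)).restrict {Z | (colBlock J Z).det ≠ 0} := by
  set G : ℕ → (ι → Fin n → ℝ) → ENNReal := fun k Z => ENNReal.ofReal (minorCutoff J k Z)
  have hG : ∀ k, Measurable (G k) := fun k =>
    (continuous_minorCutoff J k).measurable.ennreal_ofReal
  have hmean : ∀ k (h : BoundedContinuousFunction (ι → Fin n → ℝ) NNReal),
      ∫⁻ Z, h Z ∂((tupleMeasure ι μ).withDensity (G k)) =
      ∫⁻ Z, h Z ∂((volume : Measure (ι → Fin n → ℝ)).withDensity (G k)) := by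
    intro k h
    have hhc : Continuous fun Z => (h Z : ℝ) := by fun_prop
    have hh : Measurable fun Z => (h Z : ENNReal) := by
      have := h.continuous.measurable
      fun_prop
    rw [lintegral_withDensity_eq_lintegral_mul _ (hG k) hh,
      lintegral_withDensity_eq_lintegral_mul _ (hG k) hh,
      lintegral_tupleMeasure _ ((hG k).mul hh)]
    have hp : (G k * fun Z => (h Z : ENNReal)) =
        fun Z => ENNReal.ofReal (minorCutoff J k Z * h Z) := by
      funext Z
      simp only [G, Pi.mul_apply]
      rw [ENNReal.ofReal_mul (minorCutoff_nonneg J k Z), ENNReal.ofReal_coe_nnreal]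
    rw [hp]
    refine lintegral_siegelX_of_continuous hinv hJ (δ := ((k : ℝ) + 1)⁻¹) (by positivity)
      ((continuous_minorCutoff J k).mul hhc)
      (fun Z => mul_nonneg (minorCutoff_nonneg J k Z) (h Z).2)
      (fun Z hZ => le_det_of_minorCutoff_ne_zero (left_ne_zero_of_mul hZ))
      (R := (k : ℝ) + 1)
      (fun Z hZ => norm_le_of_minorCutoff_ne_zero (left_ne_zero_of_mul hZ))
  have hfin : ∀ k, IsFiniteMeasure ((volume : Measure (ι → Fin n → ℝ)).withDensity (G k)) := by
    intro k
    refine isFiniteMeasure_withDensity ?_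
    have h1 : ∫⁻ Z, G k Z ≤
        ∫⁻ Z, (Metric.closedBall (0 : ι → Fin n → ℝ) (k + 1)).indicator 1 Z := by
      refine lintegral_mono fun Z => ?_
      by_cases hZ : minorCutoff J k Z = 0
      · simp [G, hZ]
      · rw [Set.indicator_of_mem (mem_closedBall_zero_iff.mpr (norm_le_of_minorCutoff_ne_zero hZ))]
        exact ENNReal.ofReal_le_one.mpr (minorCutoff_le_one J k Z)
    rw [lintegral_indicator_one Metric.isClosed_closedBall.measurableSet] at h1
    exact (h1.trans_lt measure_closedBall_lt_top).ne
  have heq : ∀ k, (tupleMeasure ι μ).withDensity (G k) =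
      (volume : Measure (ι → Fin n → ℝ)).withDensity (G k) := by
    intro k
    have := hfin k
    exact (ext_of_forall_lintegral_eq_of_IsFiniteMeasure fun h => (hmean k h).symm).symm
  have hmono : Monotone G := fun k k' hk Z =>
    ENNReal.ofReal_le_ofReal (monotone_minorCutoff J Z hk)
  have hres : ∀ ν : Measure (ι → Fin n → ℝ), ∀ s, MeasurableSet s →
      ν.restrict {Z | (colBlock J Z).det ≠ 0} s = ⨆ k, ν.withDensity (G k) s := by
    intro ν s hs
    have h1 : ∀ k, ν.withDensity (G k) s = ∫⁻ Z, G k Z ∂(ν.restrict s) := fun k =>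
      withDensity_apply _ hs
    simp only [h1]
    rw [← lintegral_iSup hG hmono]
    simp only [G, iSup_minorCutoff]
    rw [lintegral_indicator_one (measurableSet_det_ne_zero J), Measure.restrict_apply hs,
      Measure.restrict_apply (measurableSet_det_ne_zero J), Set.inter_comm]
  ext s hs
  rw [hres _ s hs, hres _ s hs]
  simp only [heq]

/-- **Mean value theorem** for functions of linearly independent tuples of lattice vectors. -/
theorem lintegral_siegelX [Fintype ι] {μ : Measure (LatSpace n)}
    [IsProbabilityMeasure μ] (hinv : ∀ a : SLR n, μ.map (rTranslate n a) = μ)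
    (hcard : Fintype.card ι < n) {F : (ι → Fin n → ℝ) → ENNReal} (hF : Measurable F)
    (hdep : ∀ Z, ¬LinearIndependent ℝ Z → F Z = 0) :
    ∫⁻ x, siegelX F x ∂μ = ∫⁻ Z, F Z := by
  have h1 : (tupleMeasure ι μ).restrict (⋃ J : ι → Fin n, {Z | (colBlock J Z).det ≠ 0}) =
      (volume : Measure (ι → Fin n → ℝ)).restrict (⋃ J, {Z | (colBlock J Z).det ≠ 0}) := by
    rw [Measure.restrict_iUnion_congr]
    intro J
    obtain ⟨k₀, hk₀⟩ : ∃ k₀, k₀ ∉ Finset.univ.image J := by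
      by_contra! hall
      have h2 : (Finset.univ : Finset (Fin n)) ⊆ Finset.univ.image J := fun k _ => hall k
      have h3 := (Finset.card_le_card h2).trans Finset.card_image_le
      simp at h3
      omega
    exact tupleMeasure_restrict_minor hinv (k₀ := k₀) fun l hl => hk₀ (by simp [← hl])
  have h2 : (⋃ J : ι → Fin n, {Z : ι → Fin n → ℝ | (colBlock J Z).det ≠ 0}) =
      {Z | LinearIndependent ℝ Z} := by
    ext Z
    simp [linearIndependent_iff_exists_colBlock]
  rw [h2] at h1
  have h3 : ∀ ν : Measure (ι → Fin n → ℝ), ∫⁻ Z, F Z ∂ν =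
      ∫⁻ Z, F Z ∂(ν.restrict {Z | LinearIndependent ℝ Z}) := by
    intro ν
    rw [← lintegral_indicator measurableSet_linearIndependent]
    refine lintegral_congr fun Z => ?_
    by_cases hZ : LinearIndependent ℝ Z
    · rw [Set.indicator_of_mem (by exact hZ)]
    · rw [Set.indicator_of_notMem (by exact hZ), hdep Z hZ]
  rw [← lintegral_tupleMeasure μ hF, h3, h1, ← h3]

theorem ae_linearIndependent [Fintype ι] (hcard : Fintype.card ι ≤ n) :
    ∀ᵐ Z : ι → Fin n → ℝ, LinearIndependent ℝ Z := by
  obtain ⟨J⟩ : Nonempty (ι ↪ Fin n) := Function.Embedding.nonempty_of_card_le (by simpa using hcard)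
  set Z₀ : ι → Fin n → ℝ := fun i k => if J i = k then 1 else 0
  have hline : ∀ Z : ι → Fin n → ℝ, {t : ℝ | (colBlock J (Z + t • Z₀)).det = 0}.Finite := by
    intro Z
    have h1 : ∀ t : ℝ, (colBlock J (Z + t • Z₀)).det = (-colBlock J Z).charpoly.eval t := by
      intro t
      rw [Matrix.eval_charpoly]
      congr 1
      ext i l
      by_cases h : i = l
      · subst h
        simp [colBlock, Z₀, add_comm]
      · have : J i ≠ J l := fun h' => h (J.injective h')
        simp [colBlock, Z₀, h]
    simp only [h1]
    exact (Polynomial.finite_setOfPred_isRoot (Matrix.charpoly_monic _).ne_zero)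
  set A : Set (ι → Fin n → ℝ) := {Z | (colBlock J Z).det = 0}
  have hA : MeasurableSet A :=
    (isClosed_eq ((continuous_colBlock J).matrix_det) continuous_const).measurableSet
  have hA0 : volume A = 0 := by
    have h2 : ∀ t : ℝ, volume ((fun Z => Z + t • Z₀) ⁻¹' A) = volume A := fun t =>
      measure_preimage_add_right _ _ _
    have h3 : ∫⁻ t in Set.Icc (0 : ℝ) 1, volume ((fun Z => Z + t • Z₀) ⁻¹' A) = volume A := by
      simp [h2]
    rw [← h3]
    have h4 : ∀ t : ℝ, volume ((fun Z => Z + t • Z₀) ⁻¹' A) =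
        ∫⁻ Z, A.indicator 1 (Z + t • Z₀) := by
      intro t
      rw [← lintegral_indicator_one (hA.preimage (by fun_prop))]
      rfl
    simp only [h4]
    rw [lintegral_lintegral_swap]
    · have h5 : ∀ Z : ι → Fin n → ℝ,
          ∫⁻ t in Set.Icc (0 : ℝ) 1,
            A.indicator (1 : (ι → Fin n → ℝ) → ENNReal) (Z + t • Z₀) = 0 := by
        intro Z
        have h6 : volume {t : ℝ | (colBlock J (Z + t • Z₀)).det = 0} = 0 := (hline Z).measure_zero _
        refine lintegral_eq_zero_of_ae_eq_zero (ae_restrict_of_ae ?_)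
        filter_upwards [measure_eq_zero_iff_ae_notMem.mp h6] with t ht
        exact Set.indicator_of_notMem (s := A) ht (1 : (ι → Fin n → ℝ) → ENNReal)
      simp [h5]
    · refine Measurable.aemeasurable ?_
      refine (measurable_one.indicator hA).comp ?_
      fun_prop
  refine (compl_mem_ae_iff.mpr hA0 : Aᶜ ∈ ae volume) |> fun h => ?_
  filter_upwards [h] with Z hZ
  exact linearIndependent_of_colBlock_det_ne_zero hZ

end MeanValueMeasure

section Transport

open Filter Topology Set

theorem exists_cdf {u : ℝ → ℝ} (hc : Continuous u) (hi : Integrable u) (h1 : ∫ x, u x = 1) :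
    ∃ F : ℝ → ℝ, (∀ x, HasDerivAt F (u x) x) ∧ Tendsto F atBot (𝓝 0) ∧ Tendsto F atTop (𝓝 1) := by
  refine ⟨fun x => (∫ t in Iic 0, u t) + ∫ t in (0 : ℝ)..x, u t, fun x => ?_, ?_, ?_⟩
  · exact (hc.integral_hasStrictDerivAt 0 x).hasDerivAt.const_add _
  · have h := intervalIntegral_tendsto_integral_Iic (0 : ℝ) hi.integrableOn
      (tendsto_id : Tendsto (fun x : ℝ => x) atBot atBot)
    have h2 := (tendsto_const_nhds (x := ∫ t in Iic 0, u t)).sub h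
    rw [sub_self] at h2
    refine h2.congr fun x => ?_
    rw [intervalIntegral.integral_symm x 0, sub_eq_add_neg]
    rfl
  · have h := intervalIntegral_tendsto_integral_Ioi (0 : ℝ) hi.integrableOn
      (tendsto_id : Tendsto (fun x : ℝ => x) atTop atTop)
    have h2 := (tendsto_const_nhds (x := ∫ t in Iic 0, u t)).add h
    rwa [intervalIntegral.integral_Iic_add_Ioi hi.integrableOn hi.integrableOn, h1] at h2

theorem strictMono_of_pos_hasDerivAt {F u : ℝ → ℝ} (hF : ∀ x, HasDerivAt F (u x) x)
    (hpos : ∀ x, 0 < u x) : StrictMono F :=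
  strictMono_of_deriv_pos fun x => by rw [(hF x).deriv]; exact hpos x

theorem mem_Ioo_of_strictMono {F : ℝ → ℝ} (hF : StrictMono F) (h0 : Tendsto F atBot (𝓝 0))
    (h1 : Tendsto F atTop (𝓝 1)) (x : ℝ) : F x ∈ Ioo (0 : ℝ) 1 :=
  ⟨(hF.monotone.le_of_tendsto h0 (x - 1)).trans_lt (hF (by linarith)),
    (hF (by linarith : x < x + 1)).trans_le (hF.monotone.ge_of_tendsto h1 (x + 1))⟩

theorem exists_eq_of_mem_Ioo {F : ℝ → ℝ} (hF : Continuous F) (h0 : Tendsto F atBot (𝓝 0))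
    (h1 : Tendsto F atTop (𝓝 1)) {y : ℝ} (hy : y ∈ Ioo (0 : ℝ) 1) : ∃ x, F x = y := by
  obtain ⟨a, ha⟩ := (h0.eventually (gt_mem_nhds hy.1)).exists
  obtain ⟨b, hb⟩ := (h1.eventually (lt_mem_nhds hy.2)).exists
  exact mem_range_of_exists_le_of_exists_ge hF ⟨a, ha.le⟩ ⟨b, hb.le⟩

theorem exists_inverse_cdf {F u : ℝ → ℝ} (hF : ∀ x, HasDerivAt F (u x) x) (hpos : ∀ x, 0 < u x)
    (h0 : Tendsto F atBot (𝓝 0)) (h1 : Tendsto F atTop (𝓝 1)) :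
    ∃ Q : ℝ → ℝ, ∀ y ∈ Ioo (0 : ℝ) 1, F (Q y) = y ∧ HasDerivAt Q (u (Q y))⁻¹ y := by
  have hmono := strictMono_of_pos_hasDerivAt hF hpos
  have hcont : Continuous F := continuous_iff_continuousAt.mpr fun x => (hF x).continuousAt
  let e : ℝ ≃o Ioo (0 : ℝ) 1 := StrictMono.orderIsoOfSurjective
    (fun x => ⟨F x, mem_Ioo_of_strictMono hmono h0 h1 x⟩) (fun x y hxy => hmono hxy) fun y => by
      obtain ⟨x, hx⟩ := exists_eq_of_mem_Ioo hcont h0 h1 y.2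
      exact ⟨x, Subtype.ext hx⟩
  have he : ∀ y : Ioo (0 : ℝ) 1, F (e.symm y) = y := fun y =>
    congrArg Subtype.val (e.apply_symm_apply y)
  set Q : ℝ → ℝ := fun y => if h : y ∈ Ioo (0 : ℝ) 1 then e.symm ⟨y, h⟩ else 0
  have hQ : ∀ y ∈ Ioo (0 : ℝ) 1, F (Q y) = y := fun y hy => by
    simp only [Q, dif_pos hy]
    exact he ⟨y, hy⟩
  have hQc : ContinuousOn Q (Ioo (0 : ℝ) 1) := by
    rw [continuousOn_iff_continuous_domRestrict]
    have : (Ioo (0 : ℝ) 1).domRestrict Q = e.symm := by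
      funext y
      simp only [domRestrict_apply, Q, dif_pos y.2]
    rw [this]
    exact e.symm.toHomeomorph.continuous
  refine ⟨Q, fun y hy => ⟨hQ y hy, ?_⟩⟩
  have hnhds := Ioo_mem_nhds hy.1 hy.2
  exact HasDerivAt.of_local_left_inverse (hQc.continuousAt hnhds) (hF _) (hpos _).ne'
    (by filter_upwards [hnhds] with z hz using hQ z hz)

theorem continuous_gauss : Continuous fun t : ℝ => Real.exp (-Real.pi * t ^ 2) := by fun_prop

theorem integrable_gauss : Integrable fun t : ℝ => Real.exp (-Real.pi * t ^ 2) :=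
  integrable_exp_neg_mul_sq Real.pi_pos

theorem integral_gauss : ∫ t : ℝ, Real.exp (-Real.pi * t ^ 2) = 1 := by
  rw [integral_gaussian, div_self Real.pi_ne_zero, Real.sqrt_one]

/-- The monotone transport of a probability density on the line to the Gaussian density. -/
theorem exists_transport {u : ℝ → ℝ} (hc : Continuous u) (hpos : ∀ x, 0 < u x)
    (hi : Integrable u) (h1 : ∫ x, u x = 1) :
    ∃ T T' : ℝ → ℝ, (∀ x, HasDerivAt T (T' x) x) ∧ (∀ x, 0 < T' x) ∧
      ∀ x, u x = T' x * Real.exp (-Real.pi * T x ^ 2) := by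
  obtain ⟨F, hF, hF0, hF1⟩ := exists_cdf hc hi h1
  obtain ⟨G, hG, hG0, hG1⟩ := exists_cdf continuous_gauss integrable_gauss integral_gauss
  obtain ⟨Q, hQ⟩ := exists_inverse_cdf hG (fun _ => Real.exp_pos _) hG0 hG1
  have hmem := mem_Ioo_of_strictMono (strictMono_of_pos_hasDerivAt hF hpos) hF0 hF1
  refine ⟨Q ∘ F, fun x => (Real.exp (-Real.pi * Q (F x) ^ 2))⁻¹ * u x, fun x => ?_, fun x => ?_,
    fun x => ?_⟩
  · exact (hQ _ (hmem x)).2.comp x (hF x)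
  · exact mul_pos (inv_pos.mpr (Real.exp_pos _)) (hpos x)
  · have := (Real.exp_pos (-Real.pi * Q (F x) ^ 2)).ne'
    simp only [Function.comp]
    field_simp

end Transport

section YoungLine

open Filter Topology Set

theorem lintegral_exp_neg_mul_sq {b : ℝ} (hb : 0 < b) (s : ℝ) :
    ∫⁻ t : ℝ, ENNReal.ofReal (Real.exp (-b * (t - s) ^ 2)) = ENNReal.ofReal √(Real.pi / b) := by
  rw [lintegral_sub_right_eq_self (fun t : ℝ => ENNReal.ofReal (Real.exp (-b * t ^ 2))) s,
    ← integral_gaussian, ofReal_integral_eq_lintegral_ofReal (integrable_exp_neg_mul_sq hb)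
      (ae_of_all _ fun t => (Real.exp_pos _).le)]

theorem lintegral_exp_quadratic :
    ∫⁻ p : ℝ × ℝ, ENNReal.ofReal
      (Real.exp (-(4 * Real.pi / 9) * (p.1 ^ 2 - p.1 * p.2 + p.2 ^ 2))) =
      ENNReal.ofReal (3 * √3 / 2) := by
  rw [Measure.volume_eq_prod, lintegral_prod _ (by fun_prop)]
  have h1 : ∀ a b : ℝ, ENNReal.ofReal
      (Real.exp (-(4 * Real.pi / 9) * (a ^ 2 - a * b + b ^ 2))) =
      ENNReal.ofReal (Real.exp (-(Real.pi / 3) * (a - 0) ^ 2)) *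
        ENNReal.ofReal (Real.exp (-(4 * Real.pi / 9) * (b - a / 2) ^ 2)) := by
    intro a b
    rw [← ENNReal.ofReal_mul (Real.exp_pos _).le, ← Real.exp_add]
    congr 2
    ring
  have hpi := Real.pi_pos
  have h2 : √(Real.pi / (Real.pi / 3)) = √3 := by
    congr 1
    field_simp
  have h3 : √(Real.pi / (4 * Real.pi / 9)) = 3 / 2 := by
    rw [show Real.pi / (4 * Real.pi / 9) = (3 / 2) ^ 2 by field_simp; norm_num]
    exact Real.sqrt_sq (by norm_num)
  simp only [h1]
  have h4 : ∀ a : ℝ, ∫⁻ b : ℝ, ENNReal.ofReal (Real.exp (-(Real.pi / 3) * (a - 0) ^ 2)) *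
        ENNReal.ofReal (Real.exp (-(4 * Real.pi / 9) * (b - a / 2) ^ 2)) =
      ENNReal.ofReal (Real.exp (-(Real.pi / 3) * (a - 0) ^ 2)) * ENNReal.ofReal (3 / 2) := by
    intro a
    rw [lintegral_const_mul _ (by fun_prop), lintegral_exp_neg_mul_sq (by positivity), h3]
  simp only [h4]
  rw [lintegral_mul_const _ (by fun_prop), lintegral_exp_neg_mul_sq (by positivity), h2,
    ← ENNReal.ofReal_mul (by positivity)]
  congr 1
  ring

theorem three_mul_rpow_le {a b c : ℝ} (ha : 0 < a) (hb : 0 < b) (hc : 0 < c) :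
    3 * (a * b * c) ^ (2 / 3 : ℝ) ≤ a * b + a * c + b * c := by
  have h := Real.geom_mean_le_arith_mean3_weighted (w₁ := 1 / 3) (w₂ := 1 / 3) (w₃ := 1 / 3)
    (p₁ := a * b) (p₂ := a * c) (p₃ := b * c) (by norm_num) (by norm_num) (by norm_num)
    (by positivity) (by positivity) (by positivity) (by norm_num)
  rw [← Real.mul_rpow (by positivity) (by positivity), ← Real.mul_rpow (by positivity)
    (by positivity), show a * b * (a * c) * (b * c) = (a * b * c) ^ (2 : ℝ) by
      rw [Real.rpow_two]; ring, ← Real.rpow_mul (by positivity)] at h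
  norm_num at h ⊢
  linarith

theorem young_line_of_continuous {u v w : ℝ → ℝ} (hu : Continuous u) (hu0 : ∀ x, 0 < u x)
    (hui : Integrable u) (hu1 : ∫ x, u x = 1) (hv : Continuous v) (hv0 : ∀ x, 0 < v x)
    (hvi : Integrable v) (hv1 : ∫ x, v x = 1) (hw : Continuous w) (hw0 : ∀ x, 0 < w x)
    (hwi : Integrable w) (hw1 : ∫ x, w x = 1) :
    ∫⁻ p : ℝ × ℝ, ENNReal.ofReal ((u p.1 * v p.2 * w (p.1 + p.2)) ^ (2 / 3 : ℝ)) ≤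
      ENNReal.ofReal (√3 / 2) := by
  obtain ⟨T, T', hT, hT0, hTu⟩ := exists_transport hu hu0 hui hu1
  obtain ⟨S, S', hS, hS0, hSv⟩ := exists_transport hv hv0 hvi hv1
  obtain ⟨R, R', hR, hR0, hRw⟩ := exists_transport hw hw0 hwi hw1
  set Θ : ℝ × ℝ → ℝ × ℝ := fun p => (T p.1 + R (p.1 + p.2), S p.2 + R (p.1 + p.2)) with hΘ
  set D : ℝ × ℝ → ℝ × ℝ →L[ℝ] ℝ × ℝ := fun p => LinearMap.toContinuousLinearMap
    (Matrix.toLin (Module.Basis.finTwoProd ℝ) (Module.Basis.finTwoProd ℝ)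
      !![T' p.1 + R' (p.1 + p.2), R' (p.1 + p.2); R' (p.1 + p.2), S' p.2 + R' (p.1 + p.2)]) with hD
  have hder : ∀ p, HasFDerivAt Θ (D p) p := by
    intro p
    have hadd : HasFDerivAt (fun p : ℝ × ℝ => p.1 + p.2) (ContinuousLinearMap.fst ℝ ℝ ℝ +
      ContinuousLinearMap.snd ℝ ℝ ℝ) p := hasFDerivAt_fst.add hasFDerivAt_snd
    have h1 := (hT p.1).comp_hasFDerivAt p (hasFDerivAt_fst (𝕜 := ℝ) (p := p))
    have h2 := (hS p.2).comp_hasFDerivAt p (hasFDerivAt_snd (𝕜 := ℝ) (p := p))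
    have h3 := (hR (p.1 + p.2)).comp_hasFDerivAt p hadd
    have h4 := (h1.add h3).prodMk (h2.add h3)
    refine h4.congr_fderiv ?_
    simp only [hD]
    rw [Matrix.toLin_finTwoProd_toContinuousLinearMap]
    ext <;> simp [add_comm]
  have hdet : ∀ p, (D p).det = T' p.1 * S' p.2 + T' p.1 * R' (p.1 + p.2) +
      S' p.2 * R' (p.1 + p.2) := by
    intro p
    rw [hD]
    simp only [LinearMap.det_toContinuousLinearMap, LinearMap.det_toLin, Matrix.det_fin_two_of]
    ring
  have hTm := strictMono_of_pos_hasDerivAt hT hT0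
  have hSm := strictMono_of_pos_hasDerivAt hS hS0
  have hRm := strictMono_of_pos_hasDerivAt hR hR0
  have hinj : Function.Injective Θ := by
    have key : ∀ p q : ℝ × ℝ, Θ p = Θ q → p.1 + p.2 ≤ q.1 + q.2 → p = q := by
      intro p q hpq hle
      simp only [hΘ, Prod.mk.injEq] at hpq
      have h1 := hRm.monotone hle
      have h2 := hTm.le_iff_le.mp (show T q.1 ≤ T p.1 by linarith)
      have h3 := hSm.le_iff_le.mp (show S q.2 ≤ S p.2 by linarith)
      exact Prod.ext (by linarith) (by linarith)
    intro p q hpq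
    rcases le_total (p.1 + p.2) (q.1 + q.2) with h | h
    · exact key p q hpq h
    · exact (key q p hpq.symm h).symm
  set g : ℝ × ℝ → ENNReal := fun p => ENNReal.ofReal
      (Real.exp (-(4 * Real.pi / 9) * (p.1 ^ 2 - p.1 * p.2 + p.2 ^ 2)))
  have hcv := lintegral_image_eq_lintegral_abs_det_fderiv_mul volume MeasurableSet.univ
    (fun p _ => (hder p).hasFDerivWithinAt) hinj.injOn g
  have hle : ∫⁻ p, ENNReal.ofReal |(D p).det| * g (Θ p) ≤ ENNReal.ofReal (3 * √3 / 2) := by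
    rw [← lintegral_exp_quadratic, ← setLIntegral_univ, ← hcv]
    exact setLIntegral_le_lintegral _ _
  have hpt : ∀ p : ℝ × ℝ, ENNReal.ofReal ((u p.1 * v p.2 * w (p.1 + p.2)) ^ (2 / 3 : ℝ)) ≤
      ENNReal.ofReal (1 / 3) * (ENNReal.ofReal |(D p).det| * g (Θ p)) := by
    intro p
    simp only [g]
    rw [← ENNReal.ofReal_mul (abs_nonneg _), ← ENNReal.ofReal_mul (by norm_num)]
    refine ENNReal.ofReal_le_ofReal ?_
    have ha := hT0 p.1
    have hb := hS0 p.2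
    have hc := hR0 (p.1 + p.2)
    rw [hdet, abs_of_pos (by positivity), hTu, hSv, hRw]
    set a := T' p.1
    set b := S' p.2
    set c := R' (p.1 + p.2)
    set x := T p.1
    set y := S p.2
    set z := R (p.1 + p.2)
    have h1 : a * Real.exp (-Real.pi * x ^ 2) * (b * Real.exp (-Real.pi * y ^ 2)) *
        (c * Real.exp (-Real.pi * z ^ 2)) =
        (a * b * c) * Real.exp (-Real.pi * (x ^ 2 + y ^ 2 + z ^ 2)) := by
      rw [mul_add, mul_add, Real.exp_add, Real.exp_add]
      ring
    rw [h1, Real.mul_rpow (by positivity) (by positivity), ← Real.exp_mul]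
    have h2 := three_mul_rpow_le ha hb hc
    have h3 : Real.exp (-Real.pi * (x ^ 2 + y ^ 2 + z ^ 2) * (2 / 3)) ≤
        Real.exp (-(4 * Real.pi / 9) * ((x + z) ^ 2 - (x + z) * (y + z) + (y + z) ^ 2)) := by
      refine Real.exp_le_exp.mpr ?_
      have : 0 ≤ Real.pi * (x + y - z) ^ 2 := by positivity
      nlinarith
    calc _ ≤ (1 / 3 * (a * b + a * c + b * c)) * _ :=
          mul_le_mul (by linarith) h3 (Real.exp_pos _).le (by positivity)
      _ = _ := by simp only [hΘ]; ring
  refine (lintegral_mono hpt).trans ?_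
  rw [lintegral_const_mul' _ _ ENNReal.ofReal_ne_top]
  refine (mul_le_mul_right hle _).trans_eq ?_
  rw [← ENNReal.ofReal_mul (by norm_num)]
  congr 1
  ring

end YoungLine

section YoungApprox

open Filter Topology Set

theorem exists_continuous_approx {u : ℝ → ENNReal} (hu : Measurable u) (hfin : ∫⁻ x, u x ≠ ⊤) :
    ∃ a : ℕ → ℝ → ℝ, (∀ n, Continuous (a n) ∧ (∀ x, 0 < a n x) ∧ Integrable (a n)) ∧
      (∀ᵐ x, u x ≠ ⊤ ∧ Tendsto (fun n => ENNReal.ofReal (a n x)) atTop (𝓝 (u x))) ∧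
      Tendsto (fun n => ∫⁻ x, ENNReal.ofReal (a n x)) atTop (𝓝 (∫⁻ x, u x)) := by
  set f : ℝ → ℝ := fun x => (u x).toReal with hf
  have hfi : Integrable f := integrable_toReal_of_lintegral_ne_top hu.aemeasurable hfin
  set ε : ℕ → ENNReal := fun n => (1 / 2) ^ n
  have hε : ∑' n, ε n = 2 := by
    simp only [ε, one_div]
    rw [ENNReal.tsum_geometric, ENNReal.one_sub_inv_two, inv_inv]
  have hε0 : ∀ n, ε n ≠ 0 := fun n => pow_ne_zero _ (by simp)
  choose g hgs hgi hgc hgint using fun n => hfi.exists_hasCompactSupport_lintegral_sub_le (hε0 n)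
  set γ : ℝ → ℝ := fun t => Real.exp (-Real.pi * t ^ 2)
  have hγ1 : ∫⁻ x, ENNReal.ofReal (γ x) = 1 := by
    rw [← ofReal_integral_eq_lintegral_ofReal integrable_gauss
      (ae_of_all _ fun t => (Real.exp_pos _).le), integral_gauss, ENNReal.ofReal_one]
  set a : ℕ → ℝ → ℝ := fun n x => max (g n x) 0 + (1 / 2) ^ n * γ x with ha
  have hac : ∀ n, Continuous (a n) := fun n => by
    have := hgc n
    have := continuous_gauss
    fun_prop
  have hai : ∀ n, Integrable (a n) := fun n => (hgint n).pos_part.add (integrable_gauss.const_mul _)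
  have hapos : ∀ n x, 0 < a n x := fun n x => by
    have : 0 < γ x := Real.exp_pos _
    have h2 : 0 ≤ max (g n x) 0 := le_max_right _ _
    have : 0 < (1 / 2 : ℝ) ^ n * γ x := by positivity
    simp only [ha]
    linarith
  have hdist : ∀ n, ∫⁻ x, ‖a n x - f x‖ₑ ≤ 2 * ε n := by
    intro n
    have h1 : ∀ x, ‖a n x - f x‖ₑ ≤ ‖f x - g n x‖ₑ + ε n * ENNReal.ofReal (γ x) := by
      intro x
      have h2 : ε n = ENNReal.ofReal ((1 / 2) ^ n) := by
        rw [ENNReal.ofReal_pow (by norm_num)]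
        simp [ε]
      rw [h2, ← ENNReal.ofReal_mul (by positivity), ← ofReal_norm, ← ofReal_norm,
        ← ENNReal.ofReal_add (norm_nonneg _) (mul_nonneg (by positivity) (Real.exp_pos _).le)]
      refine ENNReal.ofReal_le_ofReal ?_
      have h3 : |max (g n x) 0 - f x| ≤ |f x - g n x| := by
        have h4 : f x = max (f x) 0 := (max_eq_left ENNReal.toReal_nonneg).symm
        rw [abs_sub_comm]
        conv_lhs => rw [h4]
        exact abs_max_sub_max_le_abs _ _ _
      have h5 : 0 ≤ (1 / 2 : ℝ) ^ n * γ x := mul_nonneg (by positivity) (Real.exp_pos _).le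
      simp only [ha, Real.norm_eq_abs]
      rw [add_sub_right_comm]
      refine (abs_add_le _ _).trans ?_
      rw [abs_of_nonneg h5]
      linarith
    refine (lintegral_mono h1).trans ?_
    have hm : Measurable fun x => ENNReal.ofReal (γ x) := by
      have := continuous_gauss.measurable
      fun_prop
    rw [lintegral_add_right _ (hm.const_mul _), lintegral_const_mul _ hm, hγ1, two_mul, mul_one]
    gcongr
    exact hgi n
  have hfm : Measurable f := hu.ennreal_toReal
  refine ⟨a, fun n => ⟨hac n, hapos n, hai n⟩, ?_, ?_⟩
  · have hsum : ∫⁻ x, ∑' n, ‖a n x - f x‖ₑ ≠ ⊤ := by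
      have hme : ∀ n, Measurable fun x => ‖a n x - f x‖ₑ := fun n =>
        ((hac n).measurable.sub hfm).enorm
      rw [lintegral_tsum fun n => (hme n).aemeasurable]
      refine ne_top_of_le_ne_top ?_ (ENNReal.tsum_le_tsum hdist)
      rw [ENNReal.tsum_mul_left, hε]
      norm_num
    have hm : Measurable fun x => ∑' n, ‖a n x - f x‖ₑ :=
      Measurable.tsum fun n => ((hac n).measurable.sub hfm).enorm
    filter_upwards [ae_lt_top hm hsum, ae_lt_top hu hfin] with x hx hux
    have h1 := ENNReal.tendsto_atTop_zero_of_tsum_ne_top hx.ne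
    have h2 : Tendsto (fun n => a n x) atTop (𝓝 (f x)) :=
      tendsto_iff_enorm_sub_tendsto_zero.mpr h1
    have h3 := (ENNReal.continuous_ofReal.tendsto (f x)).comp h2
    rw [hf, ENNReal.ofReal_toReal hux.ne] at h3
    exact ⟨hux.ne, h3⟩
  · have h1 : Tendsto (fun n => ∫⁻ x, ‖a n x - f x‖ₑ) atTop (𝓝 0) := by
      refine tendsto_of_tendsto_of_tendsto_of_le_of_le tendsto_const_nhds ?_
        (fun _ => zero_le) hdist
      have := ENNReal.Tendsto.const_mul (a := 2)
        (ENNReal.tendsto_atTop_zero_of_tsum_ne_top (f := ε) (by rw [hε]; norm_num))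
        (Or.inr (by norm_num))
      simpa using this
    have h2 := tendsto_integral_of_L1 f hfi.aestronglyMeasurable (Eventually.of_forall hai) h1
    have h3 := (ENNReal.continuous_ofReal.tendsto _).comp h2
    have h4 : ENNReal.ofReal (∫ x, f x) = ∫⁻ x, u x := by
      rw [integral_toReal hu.aemeasurable (ae_lt_top hu hfin), ENNReal.ofReal_toReal hfin]
    rw [h4] at h3
    refine h3.congr fun n => ?_
    exact ofReal_integral_eq_lintegral_ofReal (hai n) (ae_of_all _ fun x => (hapos n x).le)

/-- Young's inequality for three functions with exponents `3/2`, with constant `c`. -/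
def YoungBound {E : Type*} [Add E] [MeasurableSpace E] (ν : Measure E) (c : ENNReal) : Prop :=
  ∀ u v w : E → ENNReal, Measurable u → Measurable v → Measurable w →
    ∫⁻ x, ∫⁻ y, (u x * v y * w (x + y)) ^ (2 / 3 : ℝ) ∂ν ∂ν ≤
      c * ((∫⁻ x, u x ∂ν) * (∫⁻ x, v x ∂ν) * ∫⁻ x, w x ∂ν) ^ (2 / 3 : ℝ)

theorem integral_pos_of_continuous_pos {u : ℝ → ℝ} (hu0 : ∀ x, 0 < u x)
    (hui : Integrable u) : 0 < ∫ x, u x := by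
  rw [integral_pos_iff_support_of_nonneg (fun x => (hu0 x).le) hui]
  have : Function.support u = univ := by
    ext x
    simp [(hu0 x).ne']
  simp [this]

theorem young_line_of_continuous_pos {u v w : ℝ → ℝ} (hu : Continuous u) (hu0 : ∀ x, 0 < u x)
    (hui : Integrable u) (hv : Continuous v) (hv0 : ∀ x, 0 < v x) (hvi : Integrable v)
    (hw : Continuous w) (hw0 : ∀ x, 0 < w x) (hwi : Integrable w) :
    ∫⁻ x, ∫⁻ y, (ENNReal.ofReal (u x) * ENNReal.ofReal (v y) *
        ENNReal.ofReal (w (x + y))) ^ (2 / 3 : ℝ) ≤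
      ENNReal.ofReal (√3 / 2) * ((∫⁻ x, ENNReal.ofReal (u x)) * (∫⁻ x, ENNReal.ofReal (v x)) *
        ∫⁻ x, ENNReal.ofReal (w x)) ^ (2 / 3 : ℝ) := by
  have hA := integral_pos_of_continuous_pos hu0 hui
  have hB := integral_pos_of_continuous_pos hv0 hvi
  have hC := integral_pos_of_continuous_pos hw0 hwi
  rw [← ofReal_integral_eq_lintegral_ofReal hui (ae_of_all _ fun x => (hu0 x).le),
    ← ofReal_integral_eq_lintegral_ofReal hvi (ae_of_all _ fun x => (hv0 x).le),
    ← ofReal_integral_eq_lintegral_ofReal hwi (ae_of_all _ fun x => (hw0 x).le)]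
  set A := ∫ x, u x
  set B := ∫ x, v x
  set C := ∫ x, w x
  have h := young_line_of_continuous (u := fun x => A⁻¹ * u x) (v := fun x => B⁻¹ * v x)
    (w := fun x => C⁻¹ * w x) (by fun_prop) (fun x => mul_pos (inv_pos.mpr hA) (hu0 x))
    (hui.const_mul _) (by rw [integral_const_mul]; exact inv_mul_cancel₀ hA.ne')
    (by fun_prop) (fun x => mul_pos (inv_pos.mpr hB) (hv0 x))
    (hvi.const_mul _) (by rw [integral_const_mul]; exact inv_mul_cancel₀ hB.ne')
    (by fun_prop) (fun x => mul_pos (inv_pos.mpr hC) (hw0 x))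
    (hwi.const_mul _) (by rw [integral_const_mul]; exact inv_mul_cancel₀ hC.ne')
  have hm : Measurable fun p : ℝ × ℝ => (ENNReal.ofReal (u p.1) * ENNReal.ofReal (v p.2) *
      ENNReal.ofReal (w (p.1 + p.2))) ^ (2 / 3 : ℝ) := by
    have := hu.measurable
    have := hv.measurable
    have := hw.measurable
    fun_prop
  rw [lintegral_lintegral (f := fun x y => (ENNReal.ofReal (u x) * ENNReal.ofReal (v y) *
        ENNReal.ofReal (w (x + y))) ^ (2 / 3 : ℝ)) hm.aemeasurable, ← Measure.volume_eq_prod]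
  have hpt : ∀ p : ℝ × ℝ, (ENNReal.ofReal (u p.1) * ENNReal.ofReal (v p.2) *
      ENNReal.ofReal (w (p.1 + p.2))) ^ (2 / 3 : ℝ) =
      ENNReal.ofReal ((A * B * C) ^ (2 / 3 : ℝ)) * ENNReal.ofReal
        ((A⁻¹ * u p.1 * (B⁻¹ * v p.2) * (C⁻¹ * w (p.1 + p.2))) ^ (2 / 3 : ℝ)) := by
    intro p
    have h1 := hu0 p.1
    have h2 := hv0 p.2
    have h3 := hw0 (p.1 + p.2)
    rw [← ENNReal.ofReal_mul h1.le, ← ENNReal.ofReal_mul (by positivity),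
      ENNReal.ofReal_rpow_of_nonneg (by positivity) (by norm_num),
      ← ENNReal.ofReal_mul (by positivity), ← Real.mul_rpow (by positivity) (by positivity)]
    congr 2
    field_simp
  simp only [hpt]
  rw [lintegral_const_mul' _ _ ENNReal.ofReal_ne_top, mul_comm (ENNReal.ofReal (√3 / 2)),
    ← ENNReal.ofReal_mul hA.le, ← ENNReal.ofReal_mul (by positivity),
    ENNReal.ofReal_rpow_of_nonneg (by positivity) (by norm_num)]
  exact mul_le_mul_right h _

theorem young_line_of_ne_top {u v w : ℝ → ENNReal} (hu : Measurable u) (hv : Measurable v)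
    (hw : Measurable w) (huf : ∫⁻ x, u x ≠ ⊤) (hvf : ∫⁻ x, v x ≠ ⊤) (hwf : ∫⁻ x, w x ≠ ⊤) :
    ∫⁻ x, ∫⁻ y, (u x * v y * w (x + y)) ^ (2 / 3 : ℝ) ≤
      ENNReal.ofReal (√3 / 2) *
        ((∫⁻ x, u x) * (∫⁻ x, v x) * ∫⁻ x, w x) ^ (2 / 3 : ℝ) := by
  obtain ⟨a, ha, hau, haI⟩ := exists_continuous_approx hu huf
  obtain ⟨b, hb, hbv, hbI⟩ := exists_continuous_approx hv hvf
  obtain ⟨c, hc, hcw, hcI⟩ := exists_continuous_approx hw hwf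
  set Φ : ℕ → ℝ → ℝ → ENNReal := fun n x y => (ENNReal.ofReal (a n x) * ENNReal.ofReal (b n y) *
    ENNReal.ofReal (c n (x + y))) ^ (2 / 3 : ℝ)
  have hΦ : ∀ n, Measurable (Function.uncurry (Φ n)) := by
    intro n
    have := (ha n).1.measurable
    have := (hb n).1.measurable
    have := (hc n).1.measurable
    simp only [Φ, Function.uncurry_def]
    fun_prop
  have hpt : ∀ᵐ x, ∀ᵐ y, Tendsto (fun n => Φ n x y) atTop
      (𝓝 ((u x * v y * w (x + y)) ^ (2 / 3 : ℝ))) := by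
    filter_upwards [hau] with x hx
    filter_upwards [hbv, (measurePreserving_add_left volume x).quasiMeasurePreserving.ae hcw]
      with y hy hxy
    refine (ENNReal.continuous_rpow_const.tendsto _).comp ?_
    have h1 := ENNReal.Tendsto.mul hx.2 (Or.inr hy.1) hy.2 (Or.inr hx.1)
    exact ENNReal.Tendsto.mul h1 (Or.inr hxy.1) hxy.2 (Or.inr (ENNReal.mul_ne_top hx.1 hy.1))
  have hlim : Tendsto (fun n => ENNReal.ofReal (√3 / 2) * ((∫⁻ x, ENNReal.ofReal (a n x)) *
      (∫⁻ x, ENNReal.ofReal (b n x)) * ∫⁻ x, ENNReal.ofReal (c n x)) ^ (2 / 3 : ℝ)) atTop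
      (𝓝 (ENNReal.ofReal (√3 / 2) *
        ((∫⁻ x, u x) * (∫⁻ x, v x) * ∫⁻ x, w x) ^ (2 / 3 : ℝ))) := by
    refine ENNReal.Tendsto.const_mul ?_ (Or.inr ENNReal.ofReal_ne_top)
    refine (ENNReal.continuous_rpow_const.tendsto _).comp ?_
    have h1 := ENNReal.Tendsto.mul haI (Or.inr hvf) hbI (Or.inr huf)
    exact ENNReal.Tendsto.mul h1 (Or.inr hwf) hcI (Or.inr (ENNReal.mul_ne_top huf hvf))
  calc ∫⁻ x, ∫⁻ y, (u x * v y * w (x + y)) ^ (2 / 3 : ℝ)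
      ≤ ∫⁻ x, liminf (fun n => ∫⁻ y, Φ n x y) atTop := by
        refine lintegral_mono_ae (hpt.mono fun x hx => ?_)
        refine le_trans (lintegral_mono_ae (hx.mono fun y hy => hy.liminf_eq.ge)) ?_
        exact lintegral_liminf_le fun n => (hΦ n).of_uncurry_left
    _ ≤ liminf (fun n => ∫⁻ x, ∫⁻ y, Φ n x y) atTop :=
        lintegral_liminf_le fun n => (hΦ n).lintegral_prod_right'
    _ ≤ liminf (fun n => ENNReal.ofReal (√3 / 2) * ((∫⁻ x, ENNReal.ofReal (a n x)) *
          (∫⁻ x, ENNReal.ofReal (b n x)) * ∫⁻ x, ENNReal.ofReal (c n x)) ^ (2 / 3 : ℝ)) atTop :=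
        liminf_le_liminf (Eventually.of_forall fun n =>
          young_line_of_continuous_pos (ha n).1 (ha n).2.1 (ha n).2.2 (hb n).1 (hb n).2.1
            (hb n).2.2 (hc n).1 (hc n).2.1 (hc n).2.2)
    _ = _ := hlim.liminf_eq

theorem youngBound_line : YoungBound (volume : Measure ℝ) (ENNReal.ofReal (√3 / 2)) := by
  intro u v w hu hv hw
  have hc0 : ENNReal.ofReal (√3 / 2) ≠ 0 := by
    rw [Ne, ENNReal.ofReal_eq_zero, not_le]
    positivity
  have h23 : (0 : ℝ) < 2 / 3 := by norm_num
  by_cases hu0 : ∫⁻ x, u x = 0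
  · rw [lintegral_eq_zero_of_ae_eq_zero]
    · exact zero_le
    · filter_upwards [(lintegral_eq_zero_iff hu).mp hu0] with x hx
      simp [hx]
  by_cases hv0 : ∫⁻ x, v x = 0
  · rw [lintegral_eq_zero_of_ae_eq_zero]
    · exact zero_le
    · refine ae_of_all _ fun x => lintegral_eq_zero_of_ae_eq_zero ?_
      filter_upwards [(lintegral_eq_zero_iff hv).mp hv0] with y hy
      simp [hy]
  by_cases hw0 : ∫⁻ x, w x = 0
  · rw [lintegral_eq_zero_of_ae_eq_zero]
    · exact zero_le
    · refine ae_of_all _ fun x => lintegral_eq_zero_of_ae_eq_zero ?_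
      filter_upwards [(measurePreserving_add_left volume x).quasiMeasurePreserving.ae
        ((lintegral_eq_zero_iff hw).mp hw0)] with y hy
      simp [hy]
  by_cases hfin : ∫⁻ x, u x ≠ ⊤ ∧ ∫⁻ x, v x ≠ ⊤ ∧ ∫⁻ x, w x ≠ ⊤
  · exact young_line_of_ne_top hu hv hw hfin.1 hfin.2.1 hfin.2.2
  · have : (∫⁻ x, u x) * (∫⁻ x, v x) * ∫⁻ x, w x = ⊤ := by
      by_cases h1 : ∫⁻ x, u x = ⊤
      · simp [h1, ENNReal.top_mul, hv0, hw0]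
      by_cases h2 : ∫⁻ x, v x = ⊤
      · simp [h2, ENNReal.top_mul, ENNReal.mul_top, hu0, hw0]
      have h3 : ∫⁻ x, w x = ⊤ := by tauto
      simp [h3, ENNReal.mul_top, hu0, hv0]
    rw [this, ENNReal.top_rpow_of_pos h23, ENNReal.mul_top hc0]
    exact le_top

theorem YoungBound.prod {E F : Type*} [Add E] [Add F] [MeasurableSpace E] [MeasurableSpace F]
    [MeasurableAdd₂ E] [MeasurableAdd₂ F] {ν : Measure E} {ρ : Measure F} [SFinite ν] [SFinite ρ]
    {c d : ENNReal} (h : YoungBound ν c) (h' : YoungBound ρ d) :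
    YoungBound (ν.prod ρ) (c * d) := by
  intro u v w hu hv hw
  have hsec : ∀ {g : E × F → ENNReal}, Measurable g → ∀ x, Measurable fun y => g (x, y) :=
    fun hg x => hg.comp measurable_prodMk_left
  have hadd : Measurable fun z : (E × F) × (E × F) => z.1 + z.2 := by
    change Measurable fun z : (E × F) × (E × F) => (z.1.1 + z.2.1, z.1.2 + z.2.2)
    fun_prop
  have hΨ : Measurable fun z : (E × F) × (E × F) =>
      (u z.1 * v z.2 * w (z.1 + z.2)) ^ (2 / 3 : ℝ) :=
    (((hu.comp measurable_fst).mul (hv.comp measurable_snd)).mul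
      (hw.comp hadd)).pow_const _
  calc ∫⁻ p, ∫⁻ q, (u p * v q * w (p + q)) ^ (2 / 3 : ℝ) ∂(ν.prod ρ) ∂(ν.prod ρ)
      = ∫⁻ x, ∫⁻ x', ∫⁻ y, ∫⁻ y', (u (x, x') * v (y, y') * w (x + y, x' + y')) ^ (2 / 3 : ℝ)
          ∂ρ ∂ν ∂ρ ∂ν := by
        rw [lintegral_prod _ hΨ.lintegral_prod_right'.aemeasurable]
        refine lintegral_congr fun x => lintegral_congr fun x' => ?_
        exact lintegral_prod _ (hΨ.comp measurable_prodMk_left).aemeasurable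
    _ = ∫⁻ x, ∫⁻ y, ∫⁻ x', ∫⁻ y', (u (x, x') * v (y, y') * w (x + y, x' + y')) ^ (2 / 3 : ℝ)
          ∂ρ ∂ρ ∂ν ∂ν := by
        refine lintegral_congr fun x => lintegral_lintegral_swap (Measurable.aemeasurable ?_)
        have hg : Measurable fun z : (F × E) × F => ((x, z.1.1), (z.1.2, z.2)) := by fun_prop
        exact (hΨ.comp hg).lintegral_prod_right'
    _ ≤ ∫⁻ x, ∫⁻ y, d * ((∫⁻ x', u (x, x') ∂ρ) * (∫⁻ x', v (y, x') ∂ρ) *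
          ∫⁻ x', w (x + y, x') ∂ρ) ^ (2 / 3 : ℝ) ∂ν ∂ν :=
        lintegral_mono fun x => lintegral_mono fun y =>
          h' _ _ _ (hsec hu x) (hsec hv y) (hsec hw (x + y))
    _ = d * ∫⁻ x, ∫⁻ y, ((∫⁻ x', u (x, x') ∂ρ) * (∫⁻ x', v (y, x') ∂ρ) *
          ∫⁻ x', w (x + y, x') ∂ρ) ^ (2 / 3 : ℝ) ∂ν ∂ν := by
        have hmm : Measurable fun z : E × E => ((∫⁻ x', u (z.1, x') ∂ρ) *
            (∫⁻ x', v (z.2, x') ∂ρ) * ∫⁻ x', w (z.1 + z.2, x') ∂ρ) ^ (2 / 3 : ℝ) := by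
          have h1 := hu.lintegral_prod_right' (ν := ρ)
          have h2 := hv.lintegral_prod_right' (ν := ρ)
          have h3 := hw.lintegral_prod_right' (ν := ρ)
          exact (((h1.comp measurable_fst).mul (h2.comp measurable_snd)).mul
            (h3.comp measurable_add)).pow_const _
        rw [← lintegral_const_mul _ hmm.lintegral_prod_right']
        exact lintegral_congr fun x => lintegral_const_mul _ (hmm.comp measurable_prodMk_left)
    _ ≤ d * (c * ((∫⁻ x, ∫⁻ x', u (x, x') ∂ρ ∂ν) * (∫⁻ x, ∫⁻ x', v (x, x') ∂ρ ∂ν) *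
          ∫⁻ x, ∫⁻ x', w (x, x') ∂ρ ∂ν) ^ (2 / 3 : ℝ)) :=
        mul_le_mul_right (h _ _ _ hu.lintegral_prod_right' hv.lintegral_prod_right'
          hw.lintegral_prod_right') _
    _ = _ := by
        rw [lintegral_prod _ hu.aemeasurable, lintegral_prod _ hv.aemeasurable,
          lintegral_prod _ hw.aemeasurable]
        ring

end YoungApprox

section YoungPi

open Set

theorem YoungBound.congr {E F : Type*} [Add E] [Add F] [MeasurableSpace E] [MeasurableSpace F]
    {ν : Measure E} {ρ : Measure F} {c : ENNReal} (h : YoungBound ρ c) (e : E ≃ᵐ F)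
    (he : ∀ x y, e (x + y) = e x + e y) (hmp : MeasurePreserving e ν ρ) : YoungBound ν c := by
  intro u v w hu hv hw
  have key : ∀ g : E → ENNReal, ∫⁻ x, g (e.symm x) ∂ρ = ∫⁻ x, g x ∂ν := fun g => by
    rw [← hmp.lintegral_comp_emb e.measurableEmbedding]
    simp
  have := h _ _ _ (hu.comp e.symm.measurable) (hv.comp e.symm.measurable)
    (hw.comp e.symm.measurable)
  simp only [Function.comp_apply, key] at this
  refine le_of_eq_of_le ?_ this
  rw [← hmp.lintegral_comp_emb e.measurableEmbedding]
  refine lintegral_congr fun x => ?_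
  rw [← hmp.lintegral_comp_emb e.measurableEmbedding]
  refine lintegral_congr fun y => ?_
  simp [← he]

theorem youngBound_pi (n : ℕ) :
    YoungBound (volume : Measure (Fin n → ℝ)) (ENNReal.ofReal (√3 / 2) ^ n) := by
  induction n with
  | zero =>
    intro u v w _ _ _
    rw [show (volume : Measure (Fin 0 → ℝ)) = Measure.dirac 0 from Measure.pi_of_empty _ _]
    simp
  | succ n ih =>
    rw [pow_succ']
    exact (youngBound_line.prod ih).congr (MeasurableEquiv.piFinSuccAbove (fun _ => ℝ) 0)
      (fun x y => rfl) (volume_preserving_piFinSuccAbove (fun _ => ℝ) 0)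

theorem lintegral_indicator_add_le {n : ℕ} {A B C : Set (Fin n → ℝ)} {W : ENNReal}
    (hA : MeasurableSet A) (hB : MeasurableSet B) (hC : MeasurableSet C)
    (hAW : volume A = W) (hBW : volume B = W) (hCW : volume C = W) :
    ∫⁻ x, ∫⁻ y, A.indicator (1 : (Fin n → ℝ) → ENNReal) x * B.indicator 1 y *
      C.indicator 1 (x + y) ≤ ENNReal.ofReal (√3 / 2) ^ n * W ^ 2 := by
  have h := youngBound_pi n (A.indicator 1) (B.indicator 1) (C.indicator 1)
    (measurable_one.indicator hA) (measurable_one.indicator hB) (measurable_one.indicator hC)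
  rw [lintegral_indicator_one hA, lintegral_indicator_one hB, lintegral_indicator_one hC,
    hAW, hBW, hCW] at h
  have hW : (W * W * W) ^ (2 / 3 : ℝ) = W ^ 2 := by
    rw [show W * W * W = W ^ 3 by ring, ← ENNReal.rpow_natCast, ← ENNReal.rpow_mul,
      ← ENNReal.rpow_natCast]
    norm_num
  rw [hW] at h
  refine le_of_eq_of_le (lintegral_congr fun x => lintegral_congr fun y => ?_) h
  by_cases h1 : x ∈ A <;> by_cases h2 : y ∈ B <;> by_cases h3 : x + y ∈ C <;> simp [h1, h2, h3]

theorem lintegral_indicator_signed_le {n : ℕ} {A : Set (Fin n → ℝ)} {W : ENNReal}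
    (hA : MeasurableSet A) (hAW : volume A = W) {a b : ℝ} (ha : a = 1 ∨ a = -1)
    (hb : b = 1 ∨ b = -1) (z : Fin n → ℝ) :
    ∫⁻ x, ∫⁻ y, A.indicator (1 : (Fin n → ℝ) → ENNReal) x * A.indicator 1 y *
      A.indicator 1 (a • x + b • y + z) ≤ ENNReal.ofReal (√3 / 2) ^ n * W ^ 2 := by
  have hset : ∀ c : ℝ, c = 1 ∨ c = -1 → MeasurableSet {x | c • x ∈ A} ∧
      volume {x : Fin n → ℝ | c • x ∈ A} = W ∧
      ∀ g : (Fin n → ℝ) → ENNReal, ∫⁻ x, g (c • x) = ∫⁻ x, g x := by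
    intro c hc
    refine ⟨hA.preimage (measurable_const_smul c), ?_, fun g => ?_⟩
    · rcases hc with rfl | rfl
      · simpa using hAW
      · simp only [neg_smul, one_smul]
        exact (Measure.measure_preimage_neg volume A).trans hAW
    · rcases hc with rfl | rfl
      · simp
      · simpa using lintegral_neg_eq_self (μ := volume) g
  obtain ⟨ha1, ha2, ha3⟩ := hset a ha
  obtain ⟨hb1, hb2, hb3⟩ := hset b hb
  have hC : MeasurableSet {x | x + z ∈ A} := hA.preimage (measurable_add_const z)
  have hC2 : volume {x | x + z ∈ A} = W := (measure_preimage_add_right volume z A).trans hAW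
  have haa : ∀ x : Fin n → ℝ, a • a • x = x := by
    intro x; rcases ha with rfl | rfl <;> simp
  have hbb : ∀ x : Fin n → ℝ, b • b • x = x := by
    intro x; rcases hb with rfl | rfl <;> simp
  refine le_of_eq_of_le ?_ (lintegral_indicator_add_le ha1 hb1 hC ha2 hb2 hC2)
  rw [← ha3]
  refine lintegral_congr fun x => ?_
  rw [← hb3]
  refine lintegral_congr fun y => ?_
  simp only [indicator, mem_ofPred_eq, haa, hbb, Pi.one_apply]

theorem volume_signed_sum_mem_le {n : ℕ} {A : Set (Fin n → ℝ)} {W : ENNReal}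
    (hA : MeasurableSet A) (hAW : volume A = W) {κ : Type*} [Fintype κ] {d : κ → ℝ} {p q : κ}
    (hpq : p ≠ q) (hp : d p = 1 ∨ d p = -1) (hq : d q = 1 ∨ d q = -1) :
    volume {Z : κ → Fin n → ℝ | (∀ l, Z l ∈ A) ∧ ∑ l, d l • Z l ∈ A} ≤
      ENNReal.ofReal (√3 / 2) ^ n * W ^ Fintype.card κ := by
  set R : Set (κ → Fin n → ℝ) := {Z | (∀ l, Z l ∈ A) ∧ ∑ l, d l • Z l ∈ A}
  set T : Set (κ → Fin n → ℝ) := Set.pi univ fun _ => A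
  have hT : MeasurableSet T := MeasurableSet.univ_pi fun _ => hA
  have hR : MeasurableSet R := by
    have h1 : Measurable fun Z : κ → Fin n → ℝ => ∑ l, d l • Z l := by fun_prop
    have : R = T ∩ (fun Z : κ → Fin n → ℝ => ∑ l, d l • Z l) ⁻¹' A := by
      ext Z; simp [R, T]
    rw [this]
    exact hT.inter (h1 hA)
  have hTW : volume T = W ^ Fintype.card κ := by
    rw [volume_pi_pi]
    simp [hAW]
  rw [← hTW, ← lintegral_indicator_one hR, ← lintegral_indicator_one hT,
    ← lintegral_const_mul' _ _ (by simp), volume_pi]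
  refine lintegral_le_of_lmarginal_le {p, q} (measurable_one.indicator hR)
    ((measurable_one.indicator hT).const_mul _) fun x => ?_
  have hpq' : p ∉ ({q} : Finset κ) := by simpa using hpq
  rw [lmarginal_insert _ (measurable_one.indicator hR) hpq',
    lmarginal_insert _ ((measurable_one.indicator hT).const_mul _) hpq', lmarginal_singleton,
    lmarginal_singleton]
  set y : (Fin n → ℝ) → (Fin n → ℝ) → κ → Fin n → ℝ :=
    fun a b => Function.update (Function.update x p a) q b
  change ∫⁻ a, ∫⁻ b, R.indicator 1 (y a b) ≤ ∫⁻ a, ∫⁻ b, _ * T.indicator 1 (y a b)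
  have hyp : ∀ a b, y a b p = a := fun a b => by simp [y, hpq]
  have hyq : ∀ a b, y a b q = b := fun a b => by simp [y]
  have hyo : ∀ a b l, l ≠ p → l ≠ q → y a b l = x l := fun a b l h1 h2 => by simp [y, h1, h2]
  have hyT : ∀ a b, y a b ∈ T ↔ a ∈ A ∧ b ∈ A ∧ ∀ l, l ≠ p → l ≠ q → x l ∈ A := by
    intro a b
    simp only [T, mem_univ_pi]
    constructor
    · intro h
      exact ⟨hyp a b ▸ h p, hyq a b ▸ h q, fun l h1 h2 => hyo a b l h1 h2 ▸ h l⟩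
    · rintro ⟨h1, h2, h3⟩ l
      by_cases hlp : l = p
      · rw [hlp, hyp]; exact h1
      by_cases hlq : l = q
      · rw [hlq, hyq]; exact h2
      rw [hyo a b l hlp hlq]
      exact h3 l hlp hlq
  by_cases hx : ∀ l, l ≠ p → l ≠ q → x l ∈ A
  · obtain ⟨z, hz⟩ : ∃ z : Fin n → ℝ, ∀ a b, ∑ l, d l • y a b l = d p • a + d q • b + z := by
      refine ⟨∑ l ∈ (Finset.univ.erase p).erase q, d l • x l, fun a b => ?_⟩
      rw [← Finset.add_sum_erase _ _ (Finset.mem_univ p),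
        ← Finset.add_sum_erase _ _ (Finset.mem_erase.mpr ⟨hpq.symm, Finset.mem_univ q⟩), hyp, hyq,
        add_assoc]
      congr 2
      refine Finset.sum_congr rfl fun l hl => ?_
      simp only [Finset.mem_erase] at hl
      rw [hyo a b l hl.2.1 hl.1]
    refine le_of_eq_of_le ?_ ((lintegral_indicator_signed_le hA hAW hp hq z).trans_eq ?_)
    · refine lintegral_congr fun a => lintegral_congr fun b => ?_
      have : y a b ∈ R ↔ a ∈ A ∧ b ∈ A ∧ d p • a + d q • b + z ∈ A := by
        have h1 : y a b ∈ R ↔ y a b ∈ T ∧ ∑ l, d l • y a b l ∈ A := by simp [R, T]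
        rw [h1, hyT, hz]
        tauto
      by_cases h1 : a ∈ A <;> by_cases h2 : b ∈ A <;>
        by_cases h3 : d p • a + d q • b + z ∈ A <;> simp [h1, h2, h3, indicator, this]
    · have : ∀ a b, (ENNReal.ofReal (√3 / 2) ^ n *
          T.indicator (1 : (κ → Fin n → ℝ) → ENNReal) (y a b)) =
          ENNReal.ofReal (√3 / 2) ^ n * (A.indicator (1 : (Fin n → ℝ) → ENNReal) a *
            A.indicator (1 : (Fin n → ℝ) → ENNReal) b) := by
        intro a b
        by_cases h1 : a ∈ A <;> by_cases h2 : b ∈ A <;> simp [indicator, hyT, h1, h2]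
        intro l h1 h2 h3
        exact absurd (hx l h1 h2) h3
      simp only [this]
      simp only [lintegral_const_mul' _ _ (show ENNReal.ofReal (√3 / 2) ^ n ≠ ⊤ by simp)]
      congr 1
      simp only [lintegral_const_mul _ (measurable_one.indicator hA),
        lintegral_mul_const _ (measurable_one.indicator hA), lintegral_indicator_one hA, hAW]
      ring
  · refine le_of_eq_of_le ?_ zero_le
    refine lintegral_eq_zero_of_ae_eq_zero (Filter.Eventually.of_forall fun a => ?_)
    refine lintegral_eq_zero_of_ae_eq_zero (Filter.Eventually.of_forall fun b => ?_)
    refine indicator_of_notMem (fun h => hx ?_) _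
    have : y a b ∈ T := by simpa [T] using h.1
    exact ((hyT a b).mp this).2.2

end YoungPi

section Pivots

/-- A finite family of vectors contains a linearly independent subfamily in terms of which all
members of the family have coordinates of absolute value at most one. -/
theorem exists_pivots {E ι : Type*} [AddCommGroup E] [Module ℚ E] [Finite ι] (v : ι → E) :
    ∃ (J : Finset ι) (D : ι → J → ℚ), LinearIndependent ℚ (fun j : J => v j) ∧
      (∀ i, v i = ∑ l, D i l • v l) ∧ ∀ i l, |D i l| ≤ 1 := by
  have := Fintype.ofFinite ι
  set U := Submodule.span ℚ (Set.range v)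
  have hvU : ∀ i, v i ∈ U := fun i => Submodule.subset_span ⟨i, rfl⟩
  let w : ι → U := fun i => ⟨v i, hvU i⟩
  have hw : Submodule.span ℚ (Set.range w) = ⊤ := by
    have : Set.range w = Subtype.val ⁻¹' Set.range v := by
      ext ⟨x, hx⟩
      simp [w]
    rw [this]
    exact Submodule.span_span_coe_preimage
  obtain ⟨κ, a, ha, hsp, hli⟩ := exists_linearIndependent' ℚ w
  have : Finite κ := Finite.of_injective a ha
  have : Fintype κ := Fintype.ofFinite κ
  let b : Module.Basis κ ℚ U := Module.Basis.mk hli (by rw [hsp, hw])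
  have : Nonempty (κ → ι) := ⟨a⟩
  obtain ⟨s, hs⟩ := Finite.exists_max fun s : κ → ι => |b.det (w ∘ s)|
  have hs0 : b.det (w ∘ s) ≠ 0 := by
    have h1 := hs a
    have h2 : w ∘ a = b := by simp [b]
    rw [h2, b.det_self] at h1
    intro h
    rw [h] at h1
    norm_num at h1
  have hbas := (Module.Basis.is_basis_iff_det b (v := w ∘ s)).mpr (isUnit_iff_ne_zero.mpr hs0)
  let c : Module.Basis κ ℚ U := Module.Basis.mk hbas.1 hbas.2.ge
  have hc : ∀ l, c l = w (s l) := fun l => by simp [c]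
  have hrep : ∀ i, w i = ∑ l, c.repr (w i) l • w (s l) := fun i => by
    simp only [← hc]
    exact (c.sum_repr _).symm
  have hcoef : ∀ i l, |c.repr (w i) l| ≤ 1 := by
    intro i l
    have h1 : b.det (w ∘ Function.update s l i) = c.repr (w i) l * b.det (w ∘ s) := by
      rw [Function.comp_update]
      conv_lhs => rw [hrep i]
      rw [AlternatingMap.map_update_sum]
      rw [Finset.sum_eq_single l]
      · rw [AlternatingMap.map_update_smul]
        congr 2
        exact Function.update_eq_self l (w ∘ s)
      · intro k _ hk
        rw [AlternatingMap.map_update_smul]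
        rw [AlternatingMap.map_eq_zero_of_eq _ _ (i := k) (j := l) _ hk, smul_zero]
        simp [Function.update_of_ne hk]
      · simp
    have h2 := hs (Function.update s l i)
    rw [h1, abs_mul] at h2
    exact le_of_mul_le_mul_right (by linarith) (abs_pos.mpr hs0)
  have hsi : Function.Injective s := fun x y hxy => hbas.1.injective (by simp [hxy])
  let e : κ ≃ (Finset.univ.image s) :=
    (Equiv.ofInjective s hsi).trans (Equiv.subtypeEquivRight (by simp))
  have he : ∀ l, ((e l : (Finset.univ.image s)) : ι) = s l := fun l => rfl
  refine ⟨Finset.univ.image s, fun i l => c.repr (w i) (e.symm l), ?_, fun i => ?_,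
    fun i l => hcoef _ _⟩
  · rw [← linearIndependent_equiv e]
    exact hbas.1.map' U.subtype (Submodule.ker_subtype U)
  · rw [← e.sum_comp]
    simp only [Equiv.symm_apply_apply, he]
    have := congrArg U.subtype (hrep i)
    simpa [w] using this

variable {ι : Type*} {n : ℕ}

theorem linearIndependent_castTuple_iff {M : ι → Fin n → ℤ} :
    LinearIndependent ℝ (castTuple M) ↔ LinearIndependent ℚ (fun i j => (M i j : ℚ)) := by
  have h1 := linearIndependent_algebraMap_comp_iff (R := ℤ) (S := ℝ) (v := M)
  have h2 := linearIndependent_algebraMap_comp_iff (R := ℤ) (S := ℚ) (v := M)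
  exact h1.trans h2.symm

theorem linearIndependent_rowMul_iff (g : SLR n) {Z : ι → Fin n → ℝ} :
    LinearIndependent ℝ (rowMul g.1 Z) ↔ LinearIndependent ℝ Z := by
  have hinj : Function.Injective (Matrix.vecMulLinear g.1) := by
    refine Matrix.vecMul_injective_of_isUnit ?_
    rw [isUnit_iff_isUnit_det, g.2]
    exact isUnit_one
  exact LinearMap.linearIndependent_iff (Matrix.vecMulLinear g.1) (LinearMap.ker_eq_bot.mpr hinj)

end Pivots

section CongruenceSublattice

variable {ι κ : Type*} [Fintype κ] {n : ℕ}

/-- The lattice of integral vectors on which a rational matrix takes integral values. -/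
def integralLocus (D : ι → κ → ℚ) : Submodule ℤ (κ → ℤ) where
  carrier := {a | ∀ i, ∃ z : ℤ, ∑ l, D i l * a l = z}
  zero_mem' := fun i => ⟨0, by simp⟩
  add_mem' := by
    intro a b ha hb i
    obtain ⟨y, hy⟩ := ha i
    obtain ⟨z, hz⟩ := hb i
    exact ⟨y + z, by push_cast; rw [← hy, ← hz, ← Finset.sum_add_distrib]; simp [mul_add]⟩
  smul_mem' := by
    intro c a ha i
    obtain ⟨y, hy⟩ := ha i
    refine ⟨c * y, ?_⟩
    push_cast
    rw [← hy, Finset.mul_sum]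
    refine Finset.sum_congr rfl fun l _ => ?_
    simp only [Pi.smul_apply, smul_eq_mul]
    push_cast
    ring

theorem finrank_integralLocus [Fintype ι] (D : ι → κ → ℚ) :
    Module.finrank ℤ (integralLocus D) = Fintype.card κ := by
  set d : ℤ := ∏ i, ∏ l, ((D i l).den : ℤ)
  have hd : d ≠ 0 := Finset.prod_ne_zero_iff.mpr fun i _ => Finset.prod_ne_zero_iff.mpr fun l _ =>
    by exact_mod_cast (D i l).den_ne_zero
  have hmem : ∀ a : κ → ℤ, d • a ∈ integralLocus D := by
    intro a i
    have : ∀ l, ∃ z : ℤ, D i l * d = z := by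
      intro l
      have h1 : ((D i l).den : ℤ) ∣ d :=
        (Finset.dvd_prod_of_mem (fun l => ((D i l).den : ℤ)) (Finset.mem_univ l)).trans
          (Finset.dvd_prod_of_mem (fun i => ∏ l, ((D i l).den : ℤ)) (Finset.mem_univ i))
      obtain ⟨c, hc⟩ := h1
      refine ⟨(D i l).num * c, ?_⟩
      rw [hc]
      push_cast
      rw [← mul_assoc, Rat.mul_den_eq_num]
    choose z hz using this
    refine ⟨∑ l, z l * a l, ?_⟩
    push_cast
    refine Finset.sum_congr rfl fun l _ => ?_
    rw [← hz]
    simp only [Pi.smul_apply, smul_eq_mul]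
    push_cast
    ring
  have h1 : Module.finrank ℤ (κ → ℤ) = Fintype.card κ := Module.finrank_fintype_fun_eq_card ℤ
  apply le_antisymm
  · rw [← h1]
    exact LinearMap.finrank_le_finrank_of_injective (f := (integralLocus D).subtype)
      Subtype.val_injective
  · rw [← h1]
    refine LinearMap.finrank_le_finrank_of_injective
      (f := (d • (LinearMap.id : (κ → ℤ) →ₗ[ℤ] (κ → ℤ))).codRestrict _ hmem) fun a b hab => ?_
    have := congrArg Subtype.val hab
    exact smul_right_injective _ hd this

theorem exists_integralLocus_matrix [Fintype ι] [DecidableEq κ] (D : ι → κ → ℚ) :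
    ∃ P : Matrix κ κ ℤ, P.det ≠ 0 ∧ (∀ a ∈ integralLocus D, ∃ b, P *ᵥ b = a) ∧
      ∀ i l, ((D i l).den : ℤ) ∣ P.det := by
  have : Module.Free ℤ (integralLocus D) := inferInstance
  have e : (κ → ℤ) ≃ₗ[ℤ] integralLocus D := LinearEquiv.ofFinrankEq _ _ (by
    rw [finrank_integralLocus, Module.finrank_fintype_fun_eq_card])
  set P : Matrix κ κ ℤ := LinearMap.toMatrix' ((integralLocus D).subtype ∘ₗ e.toLinearMap)
  have hP : ∀ b, P *ᵥ b = e b := fun b => by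
    rw [← Matrix.toLin'_apply, Matrix.toLin'_toMatrix']
    rfl
  have hdet : P.det ≠ 0 := by
    intro h
    obtain ⟨b, hb, hb0⟩ := Matrix.exists_mulVec_eq_zero_iff.mpr h
    rw [hP] at hb0
    exact hb (e.map_eq_zero_iff.mp (Subtype.ext hb0))
  refine ⟨P, hdet, fun a ha => ⟨e.symm ⟨a, ha⟩, by simp [hP]⟩, fun i l => ?_⟩
  obtain ⟨z, hz⟩ := (e (P.adjugate *ᵥ Pi.single l 1)).2 i
  rw [← hP, mulVec_mulVec, mul_adjugate, smul_mulVec, one_mulVec] at hz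
  have h2 : D i l * P.det = z := by
    rw [← hz, Finset.sum_eq_single l]
    · simp
    · intro k _ hk
      simp [hk]
    · simp
  have h3 : D i l = (z : ℚ) / (P.det : ℤ) := by
    rw [eq_div_iff (by exact_mod_cast hdet), h2]
  rw [h3, ← Rat.divInt_eq_div]
  exact Rat.den_dvd _ _

/-- A matrix acting on tuples of vectors by mixing the members of the tuple. -/
def mixRows (P : Matrix κ κ ℝ) : (κ → Fin n → ℝ) →ₗ[ℝ] (κ → Fin n → ℝ) where
  toFun Z l := ∑ k, P l k • Z k
  map_add' Z Z' := by
    funext l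
    simp [Finset.sum_add_distrib]
  map_smul' c Z := by
    funext l
    simp only [Pi.smul_apply, RingHom.id_apply, Finset.smul_sum]
    exact Finset.sum_congr rfl fun k _ => smul_comm _ _ _

theorem mixRows_apply (P : Matrix κ κ ℝ) (Z : κ → Fin n → ℝ) (l : κ) :
    mixRows P Z l = ∑ k, P l k • Z k := rfl

theorem det_mixRows [DecidableEq κ] (P : Matrix κ κ ℝ) :
    LinearMap.det (mixRows (n := n) P) = P.det ^ n := by
  let e : (κ → Fin n → ℝ) ≃ₗ[ℝ] (Fin n → κ → ℝ) :=
    { Equiv.piComm (fun (_ : κ) (_ : Fin n) => ℝ) with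
      map_add' := fun _ _ => rfl
      map_smul' := fun _ _ => rfl }
  have he : ∀ Z k l, e Z k l = Z l k := fun _ _ _ => rfl
  have hes : ∀ Z k l, e.symm Z k l = Z l k := fun _ _ _ => rfl
  have h1 : (LinearMap.pi fun j : Fin n => (Matrix.toLin' P).comp (LinearMap.proj j)) =
      (e.toLinearMap ∘ₗ mixRows P) ∘ₗ e.symm.toLinearMap := by
    ext Z j l
    simp [he, hes, mixRows_apply, mulVec, dotProduct]
  have h2 := LinearMap.det_conj (mixRows (n := n) P) e
  rw [← LinearMap.comp_assoc] at h2
  rw [← h2, ← h1, LinearMap.det_pi]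
  simp

theorem volume_mixRows_preimage [DecidableEq κ] {P : Matrix κ κ ℝ} (hP : P.det ≠ 0)
    (s : Set (κ → Fin n → ℝ)) :
    volume (mixRows P ⁻¹' s) = ENNReal.ofReal |(P.det ^ n)⁻¹| * volume s := by
  rw [← det_mixRows]
  exact Measure.addHaar_preimage_linearMap volume (by rw [det_mixRows]; exact pow_ne_zero _ hP) s

theorem rowMul_mixRows (g : Matrix (Fin n) (Fin n) ℝ) (P : Matrix κ κ ℝ) (Z : κ → Fin n → ℝ) :
    rowMul g (mixRows P Z) = mixRows P (rowMul g Z) := by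
  funext l
  simp only [rowMul, mixRows_apply, sum_vecMul, smul_vecMul]

theorem linearIndependent_of_mixRows {P : Matrix κ κ ℝ} {Z : κ → Fin n → ℝ}
    (h : LinearIndependent ℝ (mixRows P Z)) : LinearIndependent ℝ Z := by
  rw [linearIndependent_iff_card_le_finrank_span] at h ⊢
  refine h.trans (Submodule.finrank_mono (Submodule.span_le.mpr ?_))
  rintro _ ⟨l, rfl⟩
  rw [mixRows_apply]
  exact Submodule.sum_mem _ fun k _ => Submodule.smul_mem _ _ (Submodule.subset_span ⟨k, rfl⟩)

/-- The expected number of independent tuples of lattice vectors in `A` satisfying the integrality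
conditions imposed by `D` is at most `q ^ (-n) * vol A ^ m`, for every denominator `q` in `D`. -/
theorem exists_lintegral_congruence_le [Fintype ι] {μ : Measure (LatSpace n)}
    [IsProbabilityMeasure μ] (hinv : ∀ a : SLR n, μ.map (rTranslate n a) = μ)
    (hcard : Fintype.card κ < n) {A : Set (Fin n → ℝ)} (hA : MeasurableSet A) (D : ι → κ → ℚ)
    (i : ι) (l : κ) :
    ∃ G : (κ → Fin n → ℝ) → ENNReal, Measurable G ∧
      (∀ g : SLR n, ∑' N : κ → Fin n → ℤ, (if LinearIndependent ℝ (castTuple N) ∧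
          (∀ j, (fun k => N k j) ∈ integralLocus D) ∧ ∀ k, rowMul g.1 (castTuple N) k ∈ A
          then 1 else 0 : ENNReal) ≤ siegel G g) ∧
      ∫⁻ x, siegelX G x ∂μ ≤ ((D i l).den ^ n : ENNReal)⁻¹ * volume A ^ Fintype.card κ := by
  obtain ⟨P, hP0, hPs, hPd⟩ := exists_integralLocus_matrix D
  set Q : Matrix κ κ ℝ := P.map (Int.castRingHom ℝ)
  have hQdet : Q.det = (P.det : ℝ) := ((Int.castRingHom ℝ).map_det P).symm
  have hQ0 : Q.det ≠ 0 := by rw [hQdet]; exact_mod_cast hP0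
  set T : Set (κ → Fin n → ℝ) := Set.pi Set.univ fun _ => A
  have hT : MeasurableSet T := MeasurableSet.univ_pi fun _ => hA
  have hcont : Continuous (mixRows (n := n) Q) := LinearMap.continuous_of_finiteDimensional _
  set R : Set (κ → Fin n → ℝ) := {Z | LinearIndependent ℝ Z} ∩ mixRows Q ⁻¹' T
  have hR : MeasurableSet R := measurableSet_linearIndependent.inter (hcont.measurable hT)
  refine ⟨R.indicator 1, measurable_one.indicator hR, fun g => ?_, ?_⟩
  · set B : Set (κ → Fin n → ℤ) := {N | LinearIndependent ℝ (castTuple N) ∧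
          (∀ j, (fun k => N k j) ∈ integralLocus D) ∧ ∀ k, rowMul g.1 (castTuple N) k ∈ A}
    have hB : ∀ N : B, ∃ N' : κ → Fin n → ℤ, mixRows Q (castTuple N') = castTuple N.1 := by
      rintro ⟨N, h1, h2, h3⟩
      choose b hb using fun j => hPs _ (h2 j)
      refine ⟨fun k j => b j k, ?_⟩
      funext k j
      have := congrFun (hb j) k
      simp only [mulVec, dotProduct] at this
      simp only [mixRows_apply, castTuple, ← this, Q, Finset.sum_apply, Pi.smul_apply, smul_eq_mul,
        map_apply]
      push_cast
      rfl
    choose φ' hφ' using hB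
    have hinj : Function.Injective φ' := by
      intro N N' h
      have h1 : castTuple N.1 = castTuple N'.1 := by rw [← hφ', ← hφ', h]
      refine Subtype.ext (funext fun k => funext fun j => ?_)
      simpa [castTuple] using congrFun (congrFun h1 k) j
    calc _ = ∑' N : κ → Fin n → ℤ, B.indicator (fun _ => (1 : ENNReal)) N :=
          tsum_congr fun N => by simp only [Set.indicator_apply]; rfl
      _ = ∑' N : B, (1 : ENNReal) := (tsum_subtype B _).symm
      _ ≤ ∑' N : B, R.indicator 1 (rowMul g.1 (castTuple (φ' N))) := by
          refine ENNReal.tsum_le_tsum fun N => ?_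
          have h1 : rowMul g.1 (castTuple (φ' N)) ∈ R := by
            refine ⟨?_, ?_⟩
            · refine (linearIndependent_rowMul_iff g).mpr ?_
              refine linearIndependent_of_mixRows (P := Q) ?_
              rw [hφ']
              exact N.2.1
            · rw [Set.mem_preimage, ← rowMul_mixRows, hφ']
              simpa [T] using N.2.2.2
          simp [h1]
      _ ≤ siegel (R.indicator 1) g :=
          ENNReal.tsum_comp_le_tsum_of_injective hinj
            fun N' => R.indicator (1 : (κ → Fin n → ℝ) → ENNReal) (rowMul g.1 (castTuple N'))
  · rw [lintegral_siegelX hinv hcard (measurable_one.indicator hR)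
      fun Z hZ => Set.indicator_of_notMem (fun h => hZ h.1) _, lintegral_indicator_one hR]
    refine (measure_mono Set.inter_subset_right).trans ?_
    rw [volume_mixRows_preimage hQ0, volume_pi_pi]
    simp only [Finset.prod_const, Finset.card_univ]
    refine mul_le_mul_left ?_ _
    rw [abs_inv, abs_pow, ENNReal.ofReal_inv_of_pos (by positivity), ENNReal.inv_le_inv,
      ENNReal.ofReal_pow (abs_nonneg _)]
    refine pow_le_pow_left₀ zero_le ?_ n
    rw [← ENNReal.ofReal_natCast]
    refine ENNReal.ofReal_le_ofReal ?_
    rw [hQdet, ← Int.cast_abs]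
    have h1 := Int.le_of_dvd (abs_pos.mpr hP0) ((dvd_abs _ _).mpr (hPd i l))
    exact_mod_cast h1

end CongruenceSublattice

section CountingMatrices

variable {ι κ : Type*} [Fintype ι] [Fintype κ]

/-- The largest denominator among the entries of a rational matrix. -/
def maxDen (D : ι → κ → ℚ) : ℕ := Finset.univ.sup fun p : ι × κ => (D p.1 p.2).den

theorem den_le_maxDen (D : ι → κ → ℚ) (i : ι) (l : κ) : (D i l).den ≤ maxDen D :=
  Finset.le_sup (f := fun p : ι × κ => (D p.1 p.2).den) (Finset.mem_univ (i, l))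

theorem exists_den_eq_maxDen [Nonempty ι] [Nonempty κ] (D : ι → κ → ℚ) :
    ∃ i l, (D i l).den = maxDen D := by
  obtain ⟨p, _, hp⟩ := Finset.exists_mem_eq_sup Finset.univ Finset.univ_nonempty
    fun p : ι × κ => (D p.1 p.2).den
  exact ⟨p.1, p.2, hp.symm⟩

/-- The rational numbers of absolute value at most one and denominator at most `q`. -/
noncomputable def fareyRat (q : ℕ) : Finset ℚ :=
  (Finset.Icc (-q : ℤ) q ×ˢ Finset.Icc 1 q).image fun p => (p.1 : ℚ) / p.2

theorem card_fareyRat_le (q : ℕ) : (fareyRat q).card ≤ (2 * q + 1) * q := by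
  refine Finset.card_image_le.trans ?_
  rw [Finset.card_product, Int.card_Icc, Nat.card_Icc]
  refine Nat.mul_le_mul ?_ ?_ <;> omega

theorem mem_fareyRat {x : ℚ} {q : ℕ} (hx : |x| ≤ 1) (hq : x.den ≤ q) : x ∈ fareyRat q := by
  refine Finset.mem_image.mpr ⟨(x.num, x.den), ?_, Rat.num_div_den x⟩
  have h1 : |x.num| ≤ x.den := by
    have h2 : |(x.num : ℚ)| ≤ x.den := by
      rw [← Rat.mul_den_eq_num x, abs_mul, Nat.abs_cast]
      exact mul_le_of_le_one_left (Nat.cast_nonneg _) hx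
    exact_mod_cast h2
  have h3 := x.den_pos
  have h4 := abs_le.mp h1
  simp only [Finset.mem_product, Finset.mem_Icc]
  omega

/-- The weight of a matrix of pivot coordinates. -/
noncomputable def denWeight (n q : ℕ) : ENNReal :=
  if q = 1 then ENNReal.ofReal (√3 / 2) ^ n else ((q : ENNReal) ^ n)⁻¹

theorem half_pow_le {n t : ℕ} (h : n ≤ 2 * t) : ((1 : ℝ) / 2) ^ t ≤ 0.999 ^ n :=
  calc ((1 : ℝ) / 2) ^ t ≤ (0.999 ^ 2) ^ t := pow_le_pow_left₀ (by norm_num) (by norm_num) t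
    _ = 0.999 ^ (2 * t) := (pow_mul _ _ _).symm
    _ ≤ 0.999 ^ n := pow_le_pow_of_le_one (by norm_num) (by norm_num) h

theorem denWeight_mul_le {n e q : ℕ} (hn : 4 ≤ n) (he : 8 * e ≤ n) (hq : 1 ≤ q) :
    denWeight n q * (((2 * q + 1) * q : ℕ) : ENNReal) ^ e ≤
      ENNReal.ofReal (4 * 0.999 ^ n * (1 / (q : ℝ) ^ 2)) := by
  rw [← ENNReal.ofReal_natCast, ← ENNReal.ofReal_pow (Nat.cast_nonneg _)]
  rcases hq.eq_or_lt with rfl | hq2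
  · rw [denWeight, if_pos rfl, ← ENNReal.ofReal_pow (by positivity),
      ← ENNReal.ofReal_mul (by positivity)]
    refine ENNReal.ofReal_le_ofReal ?_
    have h3 : √3 ≤ 1.7321 := Real.sqrt_le_iff.mpr (by norm_num)
    have h1 : ((((2 * 1 + 1) * 1 : ℕ) : ℝ)) ^ e ≤ 1.148 ^ n :=
      calc ((((2 * 1 + 1) * 1 : ℕ) : ℝ)) ^ e ≤ (1.148 ^ 8) ^ e :=
            pow_le_pow_left₀ (by norm_num) (by norm_num) e
        _ = 1.148 ^ (8 * e) := (pow_mul _ _ _).symm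
        _ ≤ 1.148 ^ n := pow_le_pow_right₀ (by norm_num) he
    calc (√3 / 2) ^ n * ((((2 * 1 + 1) * 1 : ℕ) : ℝ)) ^ e
        ≤ (√3 / 2) ^ n * 1.148 ^ n := by gcongr
      _ = (√3 / 2 * 1.148) ^ n := (mul_pow _ _ _).symm
      _ ≤ 0.999 ^ n := pow_le_pow_left₀ (by positivity) (by linarith) n
      _ ≤ _ := by
        have : (0 : ℝ) < 0.999 ^ n := by positivity
        norm_num
  · rw [denWeight, if_neg (by omega), ← ENNReal.ofReal_natCast,
      ← ENNReal.ofReal_pow (Nat.cast_nonneg _), ← ENNReal.ofReal_inv_of_pos (by positivity),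
      ← ENNReal.ofReal_mul (by positivity)]
    refine ENNReal.ofReal_le_ofReal ?_
    obtain ⟨t, rfl⟩ : ∃ t, n = 4 * e + (t + 2) := ⟨n - 4 * e - 2, by omega⟩
    have hq2' : (2 : ℝ) ≤ q := by exact_mod_cast hq2
    have h1 : ((((2 * q + 1) * q : ℕ) : ℝ)) ^ e ≤ (q : ℝ) ^ (4 * e) := by
      rw [pow_mul]
      refine pow_le_pow_left₀ (by positivity) ?_ e
      push_cast
      nlinarith [mul_self_nonneg ((q : ℝ) - 2), mul_nonneg (sub_nonneg.mpr hq2')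
        (sub_nonneg.mpr hq2'), pow_le_pow_left₀ (by norm_num) hq2' 3,
        mul_le_mul_of_nonneg_right hq2' (sq_nonneg (q : ℝ))]
    have h2 : ((1 : ℝ) / 2) ^ (t + 2) ≤ 0.999 ^ (4 * e + (t + 2)) := half_pow_le (by omega)
    calc ((q : ℝ) ^ (4 * e + (t + 2)))⁻¹ * ((((2 * q + 1) * q : ℕ) : ℝ)) ^ e
        ≤ ((q : ℝ) ^ (4 * e + (t + 2)))⁻¹ * (q : ℝ) ^ (4 * e) := by gcongr
      _ = (1 / (q : ℝ)) ^ t * (1 / (q : ℝ) ^ 2) := by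
        have : (q : ℝ) ≠ 0 := by positivity
        rw [_root_.one_div_pow]
        field_simp
        ring
      _ ≤ (1 / 2) ^ t * (1 / (q : ℝ) ^ 2) := by gcongr
      _ = 4 * (1 / 2) ^ (t + 2) * (1 / (q : ℝ) ^ 2) := by ring
      _ ≤ _ := by gcongr

theorem tsum_denWeight_le [Nonempty ι] [Nonempty κ] {n : ℕ} (hn : 4 ≤ n)
    (he : 8 * (Fintype.card ι * Fintype.card κ) ≤ n) :
    ∑' D : ι → κ → ℚ, (if ∀ i l, |D i l| ≤ 1 then denWeight n (maxDen D) else 0) ≤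
      ENNReal.ofReal (12 * 0.999 ^ n) := by
  have hcount : ∀ q : ℕ, ∑' D : ι → κ → ℚ,
      (if (∀ i l, |D i l| ≤ 1) ∧ maxDen D = q then 1 else 0 : ENNReal) ≤
      (((2 * q + 1) * q : ℕ) : ENNReal) ^ (Fintype.card ι * Fintype.card κ) := by
    intro q
    set s : Finset (ι → κ → ℚ) :=
      Fintype.piFinset fun _ => Fintype.piFinset fun _ => fareyRat q
    calc _ ≤ ∑' D : ι → κ → ℚ, (if D ∈ s then 1 else 0 : ENNReal) := by
          refine ENNReal.tsum_le_tsum fun D => ?_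
          by_cases hD : (∀ i l, |D i l| ≤ 1) ∧ maxDen D = q
          · have : D ∈ s := by
              simp only [s, Fintype.mem_piFinset]
              exact fun i l => mem_fareyRat (hD.1 i l) (hD.2 ▸ den_le_maxDen D i l)
            simp [hD, this]
          · simp [hD]
      _ = (s.card : ENNReal) := by
          rw [tsum_eq_sum (s := s) (fun D hD => if_neg hD),
            Finset.sum_congr rfl fun D hD => if_pos hD]
          simp
      _ ≤ _ := by
          have h1 : s.card = ((fareyRat q).card ^ Fintype.card κ) ^ Fintype.card ι := by
            simp [s, Fintype.card_piFinset]
          rw [h1, ← pow_mul, mul_comm (Fintype.card κ)]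
          exact_mod_cast Nat.pow_le_pow_left (card_fareyRat_le q) _
  have hsplit : ∀ D : ι → κ → ℚ, (if ∀ i l, |D i l| ≤ 1 then denWeight n (maxDen D) else 0) ≤
      ∑' q : ℕ, denWeight n (q + 1) *
        (if (∀ i l, |D i l| ≤ 1) ∧ maxDen D = q + 1 then 1 else 0 : ENNReal) := by
    intro D
    by_cases hD : ∀ i l, |D i l| ≤ 1
    · obtain ⟨i, l, hil⟩ := exists_den_eq_maxDen D
      have h1 := (D i l).den_pos
      obtain ⟨q, hq⟩ : ∃ q, maxDen D = q + 1 := ⟨maxDen D - 1, by omega⟩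
      refine le_trans ?_ (ENNReal.le_tsum q)
      simp [hD, hq]
    · simp [hD]
  have hz := hasSum_zeta_two
  have hz1 : HasSum (fun q : ℕ => (1 : ℝ) / ((q + 1 : ℕ) : ℝ) ^ 2) (Real.pi ^ 2 / 6) := by
    simpa using (hasSum_nat_add_iff' 1).mpr hz
  calc _ ≤ ∑' D : ι → κ → ℚ, ∑' q : ℕ, denWeight n (q + 1) *
        (if (∀ i l, |D i l| ≤ 1) ∧ maxDen D = q + 1 then 1 else 0 : ENNReal) :=
        ENNReal.tsum_le_tsum hsplit
    _ = ∑' q : ℕ, denWeight n (q + 1) * ∑' D : ι → κ → ℚ,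
        (if (∀ i l, |D i l| ≤ 1) ∧ maxDen D = q + 1 then 1 else 0 : ENNReal) := by
        rw [ENNReal.tsum_comm]
        simp only [ENNReal.tsum_mul_left]
    _ ≤ ∑' q : ℕ, ENNReal.ofReal (4 * 0.999 ^ n * (1 / ((q + 1 : ℕ) : ℝ) ^ 2)) :=
        ENNReal.tsum_le_tsum fun q => (mul_le_mul_right (hcount (q + 1)) _).trans
          (denWeight_mul_le hn he (Nat.le_add_left 1 q))
    _ = ENNReal.ofReal (4 * 0.999 ^ n * (Real.pi ^ 2 / 6)) := by
        have h1 := hz1.mul_left (4 * 0.999 ^ n)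
        rw [← ENNReal.ofReal_tsum_of_nonneg (fun q => by positivity) h1.summable, h1.tsum_eq]
    _ ≤ _ := by
        refine ENNReal.ofReal_le_ofReal ?_
        have h1 : Real.pi ^ 2 ≤ 3.15 ^ 2 :=
          pow_le_pow_left₀ Real.pi_pos.le Real.pi_lt_d2.le 2
        have h2 : (0 : ℝ) < 0.999 ^ n := by positivity
        nlinarith

end CountingMatrices

section PivotSets

variable {τ : Type*} {n : ℕ}

/-- The injective tuples of lattice vectors in `A` whose members indexed by `J` are independent
and whose other members have the coordinates `D` with respect to those. -/
def pivotSet (A : Set (Fin n → ℝ)) (g : SLR n) (J : Finset τ) (D : {i // i ∉ J} → J → ℚ) :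
    Set (τ → Fin n → ℤ) :=
  {M | LinearIndependent ℝ (castTuple fun l : J => M l) ∧
    (∀ (i : {i // i ∉ J}) (j), (M i j : ℚ) = ∑ l, D i l * M l j) ∧ Function.Injective M ∧
    ∀ i, rowMul g.1 (castTuple M) i ∈ A}

variable {A : Set (Fin n → ℝ)} {g : SLR n} {J : Finset τ} {D : {i // i ∉ J} → J → ℚ}

theorem injOn_restrict_pivotSet :
    Set.InjOn (fun (M : τ → Fin n → ℤ) (l : J) => M l) (pivotSet A g J D) := by
  intro M hM M' hM' h
  have hl : ∀ l : J, M l = M' l := fun l => congrFun h l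
  funext i j
  by_cases hi : i ∈ J
  · exact congrFun (hl ⟨i, hi⟩) j
  · have h1 := hM.2.1 ⟨i, hi⟩ j
    have h2 := hM'.2.1 ⟨i, hi⟩ j
    simp only [hl] at h1
    rw [← h2] at h1
    exact_mod_cast h1

theorem rowMul_eq_sum_of_mem_pivotSet {M : τ → Fin n → ℤ} (hM : M ∈ pivotSet A g J D)
    (i : {i // i ∉ J}) : rowMul g.1 (castTuple M) i =
      ∑ l, (D i l : ℝ) • rowMul g.1 (castTuple fun l : J => M l) l := by
  have h1 : castTuple M i = ∑ l, (D i l : ℝ) • castTuple (fun l : J => M l) l := by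
    funext j
    have := congrArg (fun x : ℚ => (x : ℝ)) (hM.2.1 i j)
    simp only [Finset.sum_apply, Pi.smul_apply, castTuple, smul_eq_mul]
    push_cast at this
    exact this
  simp only [rowMul, h1, sum_vecMul, smul_vecMul]

theorem rowMul_injective (g : SLR n) :
    Function.Injective fun m : Fin n → ℤ => (fun j => (m j : ℝ)) ᵥ* g.1 := by
  have hinj : Function.Injective (fun v : Fin n → ℝ => v ᵥ* g.1) := by
    refine Matrix.vecMul_injective_of_isUnit ?_
    rw [isUnit_iff_isUnit_det, g.2]
    exact isUnit_one
  intro a b hab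
  have := hinj hab
  funext j
  exact_mod_cast congrFun this j

theorem tsum_indicator_pivotSet_le {G : (J → Fin n → ℤ) → ENNReal}
    (hG : ∀ M ∈ pivotSet A g J D, 1 ≤ G fun l => M l) :
    ∑' M, (pivotSet A g J D).indicator (fun _ => (1 : ENNReal)) M ≤ ∑' N, G N := by
  rw [← tsum_subtype (pivotSet A g J D) (fun _ => (1 : ENNReal))]
  exact (ENNReal.tsum_le_tsum fun M => hG M.1 M.2).trans
    (ENNReal.tsum_comp_le_tsum_of_injective injOn_restrict_pivotSet.injective G)

theorem exists_two_nonzero_of_mem_pivotSet [Fintype τ] (hA0 : (0 : Fin n → ℝ) ∉ A)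
    (hAneg : ∀ x ∈ A, -x ∉ A) (hD1 : ∀ i l, |D i l| ≤ 1) (hden : ∀ i l, (D i l).den = 1)
    {M : τ → Fin n → ℤ} (hM : M ∈ pivotSet A g J D) (i : {i // i ∉ J}) :
    ∃ p q, p ≠ q ∧ ((D i p : ℝ) = 1 ∨ (D i p : ℝ) = -1) ∧
      ((D i q : ℝ) = 1 ∨ (D i q : ℝ) = -1) := by
  have hval : ∀ l, D i l ≠ 0 → (D i l : ℝ) = 1 ∨ (D i l : ℝ) = -1 := by
    intro l hl
    have h1 : D i l = (D i l).num := (Rat.coe_int_num_of_den_eq_one (hden i l)).symm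
    have h2 := hD1 i l
    rw [h1] at h2 hl ⊢
    generalize (D i l).num = z at *
    have h3 : |z| ≤ 1 := by exact_mod_cast h2
    have h4 : z ≠ 0 := by exact_mod_cast hl
    have h5 := abs_le.mp h3
    have : z = 1 ∨ z = -1 := by omega
    rcases this with rfl | rfl <;> simp
  have hsum := rowMul_eq_sum_of_mem_pivotSet hM i
  have hmem := hM.2.2.2
  obtain ⟨p, hp⟩ : ∃ p, D i p ≠ 0 := by
    by_contra! h
    simp only [h, Rat.cast_zero, zero_smul, Finset.sum_const_zero] at hsum
    exact hA0 (hsum ▸ hmem i)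
  by_cases hq : ∃ q, q ≠ p ∧ D i q ≠ 0
  · obtain ⟨q, hqp, hq⟩ := hq
    exact ⟨p, q, hqp.symm, hval p hp, hval q hq⟩
  · exfalso
    push Not at hq
    rw [Finset.sum_eq_single p (fun l _ hl => by simp [hq l hl]) (by simp)] at hsum
    have hrow : rowMul g.1 (castTuple fun l : J => M l) p = rowMul g.1 (castTuple M) p := rfl
    rw [hrow] at hsum
    rcases hval p hp with h1 | h1
    · rw [h1, one_smul] at hsum
      have := hM.2.2.1 (rowMul_injective g hsum)
      exact i.2 (this ▸ p.2)
    · rw [h1, neg_one_smul] at hsum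
      exact hAneg _ (hmem p) (hsum ▸ hmem i)

theorem exists_pivot_majorant [Fintype τ] {μ : Measure (LatSpace n)} [IsProbabilityMeasure μ]
    (hinv : ∀ a : SLR n, μ.map (rTranslate n a) = μ) (hA : MeasurableSet A)
    (hA0 : (0 : Fin n → ℝ) ∉ A) (hAneg : ∀ x ∈ A, -x ∉ A) (hcard : J.card < n)
    (hJ : J.Nonempty) (hJc : ∃ i, i ∉ J) (hD1 : ∀ i l, |D i l| ≤ 1) :
    ∃ G : (J → Fin n → ℝ) → ENNReal, Measurable G ∧
      (∀ g, ∑' M, (pivotSet A g J D).indicator (fun _ => (1 : ENNReal)) M ≤ siegel G g) ∧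
      ∫⁻ x, siegelX G x ∂μ ≤ denWeight n (maxDen D) * volume A ^ J.card := by
  have hcard' : Fintype.card J < n := by rwa [Fintype.card_coe]
  have hne : Nonempty J := hJ.to_subtype
  have hne' : Nonempty {i // i ∉ J} := nonempty_subtype.mpr hJc
  by_cases hden : maxDen D = 1
  · have hden' : ∀ i l, (D i l).den = 1 := fun i l =>
      le_antisymm (hden ▸ den_le_maxDen D i l) (D i l).den_pos
    let i : {i // i ∉ J} := Classical.arbitrary _
    by_cases hpq : ∃ p q, p ≠ q ∧ ((D i p : ℝ) = 1 ∨ (D i p : ℝ) = -1) ∧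
      ((D i q : ℝ) = 1 ∨ (D i q : ℝ) = -1)
    · obtain ⟨p, q, hpq, hp, hq⟩ := hpq
      have hsumc : Measurable fun Z : J → Fin n → ℝ => ∑ l, (D i l : ℝ) • Z l := by fun_prop
      set R : Set (J → Fin n → ℝ) := {Z | LinearIndependent ℝ Z} ∩
        {Z | (∀ l, Z l ∈ A) ∧ ∑ l, (D i l : ℝ) • Z l ∈ A}
      have hR : MeasurableSet R := by
        refine measurableSet_linearIndependent.inter (MeasurableSet.inter ?_ (hsumc hA))
        have : {Z : J → Fin n → ℝ | ∀ l, Z l ∈ A} = Set.pi Set.univ fun _ => A := by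
          ext Z; simp
        rw [show (fun Z : J → Fin n → ℝ => ∀ l, Z l ∈ A) = _ from this]
        exact MeasurableSet.univ_pi fun _ => hA
      refine ⟨R.indicator 1, measurable_one.indicator hR, fun g => ?_, ?_⟩
      · refine tsum_indicator_pivotSet_le
          (G := fun N => R.indicator (1 : (J → Fin n → ℝ) → ENNReal) (rowMul g.1 (castTuple N)))
          fun M hM => ?_
        have : rowMul g.1 (castTuple fun l : J => M l) ∈ R :=
          ⟨(linearIndependent_rowMul_iff g).mpr hM.1, fun l => hM.2.2.2 l,
            rowMul_eq_sum_of_mem_pivotSet hM i ▸ hM.2.2.2 i⟩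
        simp [this]
      · rw [lintegral_siegelX hinv hcard' (measurable_one.indicator hR)
          fun Z hZ => Set.indicator_of_notMem (fun h => hZ h.1) _, lintegral_indicator_one hR]
        refine (measure_mono Set.inter_subset_right).trans ?_
        rw [denWeight, if_pos hden, ← Fintype.card_coe J]
        exact volume_signed_sum_mem_le hA rfl hpq hp hq
    · refine ⟨0, measurable_zero, fun g => ?_, ?_⟩
      · refine tsum_indicator_pivotSet_le
          (G := fun N => (0 : (J → Fin n → ℝ) → ENNReal) (rowMul g.1 (castTuple N)))
          fun M hM => ?_
        exact absurd (exists_two_nonzero_of_mem_pivotSet hA0 hAneg hD1 hden' hM i) hpq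
      · have : ∀ x : LatSpace n, siegelX (0 : (J → Fin n → ℝ) → ENNReal) x = 0 := fun x => by
          simp [siegelX, siegel]
        simp [this]
  · obtain ⟨i, l, hil⟩ := exists_den_eq_maxDen D
    obtain ⟨G, hG, hG1, hG2⟩ := exists_lintegral_congruence_le hinv hcard' hA D i l
    refine ⟨G, hG, fun g => (tsum_indicator_pivotSet_le fun M hM => ?_).trans (hG1 g), ?_⟩
    · rw [if_pos]
      refine ⟨hM.1, fun j i => ⟨M i j, ?_⟩, fun k => hM.2.2.2 k⟩
      exact (hM.2.1 i j).symm
    · rw [denWeight, if_neg hden, ← hil, ← Fintype.card_coe J]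
      exact hG2

end PivotSets

section DependentTuples

variable {τ : Type*} {n : ℕ}

/-- The injective linearly dependent tuples of vectors in `A`. -/
def depTuples (τ : Type*) (A : Set (Fin n → ℝ)) : Set (τ → Fin n → ℝ) :=
  {Z | ¬LinearIndependent ℝ Z ∧ Function.Injective Z ∧ ∀ i, Z i ∈ A}

variable {A : Set (Fin n → ℝ)}

theorem exists_mem_pivotSet [Fintype τ] (hA0 : (0 : Fin n → ℝ) ∉ A) {g : SLR n}
    {M : τ → Fin n → ℤ} (hM : rowMul g.1 (castTuple M) ∈ depTuples τ A) :
    ∃ (J : Finset τ) (D : {i // i ∉ J} → J → ℚ), J.Nonempty ∧ (∃ i, i ∉ J) ∧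
      (∀ i l, |D i l| ≤ 1) ∧ M ∈ pivotSet A g J D := by
  obtain ⟨hdep, hinj, hmem⟩ := hM
  rw [linearIndependent_rowMul_iff] at hdep
  obtain ⟨J, D, hJ, hD, hD1⟩ := exists_pivots fun i j => (M i j : ℚ)
  have hJc : ∃ i, i ∉ J := by
    by_contra! h
    refine hdep (linearIndependent_castTuple_iff.mpr ?_)
    exact (linearIndependent_equiv (Equiv.subtypeUnivEquiv h)
      (f := fun i j => (M i j : ℚ))).mp hJ
  refine ⟨J, fun i => D i, ?_, hJc, fun i l => hD1 i l,
    linearIndependent_castTuple_iff.mpr hJ, fun i j => ?_, fun a b hab => ?_, hmem⟩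
  · by_contra h
    obtain ⟨i, hi⟩ := hJc
    have hM0 : ∀ j, M i j = 0 := fun j => by
      have h1 := congrFun (hD i) j
      have : IsEmpty J := Finset.isEmpty_coe_sort.mpr (Finset.not_nonempty_iff_eq_empty.mp h)
      rw [Finset.univ_eq_empty, Finset.sum_empty] at h1
      simpa using h1
    refine hA0 ?_
    have h2 : rowMul g.1 (castTuple M) i = 0 := by
      have : castTuple M i = 0 := by
        funext j
        simp [castTuple, hM0 j]
      simp only [rowMul, this, zero_vecMul]
    exact h2 ▸ hmem i
  · have h1 := congrFun (hD i) j
    simpa only [Finset.sum_apply, Pi.smul_apply, smul_eq_mul] using h1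
  · refine hinj ?_
    have : castTuple M a = castTuple M b := by
      funext j
      exact congrArg (fun z : ℤ => (z : ℝ)) (congrFun hab j)
    simp only [rowMul, this]

theorem siegel_depTuples_le [Fintype τ] (hA0 : (0 : Fin n → ℝ) ∉ A) (g : SLR n) :
    siegel ((depTuples τ A).indicator 1) g ≤
      ∑ J : Finset τ, if J.Nonempty ∧ ∃ i, i ∉ J then
        ∑' D : {i // i ∉ J} → J → ℚ, (if ∀ i l, |D i l| ≤ 1 then
          ∑' M, (pivotSet A g J D).indicator (fun _ => (1 : ENNReal)) M else 0) else 0 := by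
  set a : (J : Finset τ) → ({i // i ∉ J} → J → ℚ) → (τ → Fin n → ℤ) → ENNReal := fun J D M =>
    if (J.Nonempty ∧ ∃ i, i ∉ J) ∧ ∀ i l, |D i l| ≤ 1 then
      (pivotSet A g J D).indicator (fun _ => (1 : ENNReal)) M else 0 with ha
  have key : ∀ M, (depTuples τ A).indicator (1 : (τ → Fin n → ℝ) → ENNReal)
      (rowMul g.1 (castTuple M)) ≤ ∑ J, ∑' D, a J D M := by
    intro M
    by_cases hM : rowMul g.1 (castTuple M) ∈ depTuples τ A
    · obtain ⟨J, D, hJ, hJc, hD, hMJ⟩ := exists_mem_pivotSet hA0 hM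
      rw [Set.indicator_of_mem hM]
      calc (1 : ENNReal) = a J D M := by
            simp only [ha, hJ, hJc, and_self, true_and]
            rw [if_pos hD, Set.indicator_of_mem hMJ]
        _ ≤ ∑' D, a J D M := ENNReal.le_tsum D
        _ ≤ _ := Finset.single_le_sum (f := fun J => ∑' D, a J D M) (fun _ _ => zero_le)
          (Finset.mem_univ J)
    · rw [Set.indicator_of_notMem hM]
      exact zero_le
  calc siegel ((depTuples τ A).indicator 1) g ≤ ∑' M, ∑ J, ∑' D, a J D M :=
        ENNReal.tsum_le_tsum key
    _ = ∑ J, ∑' D, ∑' M, a J D M := by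
        rw [Summable.tsum_finsetSum fun _ _ => ENNReal.summable]
        exact Finset.sum_congr rfl fun J _ => ENNReal.tsum_comm
    _ = _ := by
        refine Finset.sum_congr rfl fun J _ => ?_
        by_cases hJ : J.Nonempty ∧ ∃ i, i ∉ J
        · rw [if_pos hJ]
          refine tsum_congr fun D => ?_
          by_cases hD : ∀ i l, |D i l| ≤ 1
          · simp only [ha, if_pos (And.intro hJ hD), if_pos hD]
          · simp only [ha, if_neg hD, if_neg (fun h : _ ∧ _ => hD h.2), tsum_zero]
        · simp only [ha, if_neg hJ, if_neg (fun h : _ ∧ _ => hJ h.1), tsum_zero]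

theorem lintegral_siegelX_depTuples_le [Fintype τ] {μ : Measure (LatSpace n)}
    [IsProbabilityMeasure μ] (hinv : ∀ a : SLR n, μ.map (rTranslate n a) = μ)
    (hA : MeasurableSet A) (hA0 : (0 : Fin n → ℝ) ∉ A) (hAneg : ∀ x ∈ A, -x ∉ A)
    (hcard : 2 * Fintype.card τ ^ 2 ≤ n) :
    ∫⁻ x, siegelX ((depTuples τ A).indicator 1) x ∂μ ≤
      ENNReal.ofReal (12 * 0.999 ^ n) * (1 + volume A) ^ Fintype.card τ := by
  set P : Finset τ → Prop := fun J => J.Nonempty ∧ ∃ i, i ∉ J with hP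
  have hlt : ∀ J : Finset τ, P J → J.card < n := by
    intro J hJ
    have h1 : 1 ≤ J.card := hJ.1.card_pos
    have h2 : J.card ≤ Fintype.card τ := Finset.card_le_univ J
    nlinarith
  have hex : ∀ (J : Finset τ) (D : {i // i ∉ J} → J → ℚ), ∃ G : (J → Fin n → ℝ) → ENNReal,
      Measurable G ∧ (P J ∧ (∀ i l, |D i l| ≤ 1) →
        (∀ g, ∑' M, (pivotSet A g J D).indicator (fun _ => (1 : ENNReal)) M ≤ siegel G g) ∧
        ∫⁻ x, siegelX G x ∂μ ≤ denWeight n (maxDen D) * volume A ^ J.card) := by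
    intro J D
    by_cases h : P J ∧ ∀ i l, |D i l| ≤ 1
    · obtain ⟨G, hG, h1, h2⟩ :=
        exists_pivot_majorant hinv hA hA0 hAneg (hlt J h.1) h.1.1 h.1.2 h.2
      exact ⟨G, hG, fun _ => ⟨h1, h2⟩⟩
    · exact ⟨0, measurable_zero, fun h' => absurd h' h⟩
  choose G hG hG' using hex
  have hpt : ∀ x, siegelX ((depTuples τ A).indicator 1) x ≤ ∑ J, if P J then
      ∑' D : {i // i ∉ J} → J → ℚ, (if ∀ i l, |D i l| ≤ 1 then siegelX (G J D) x else 0)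
      else 0 := by
    intro x
    obtain ⟨g, rfl⟩ := latMk_surjective x
    simp only [siegelX_latMk]
    refine (siegel_depTuples_le hA0 g).trans (Finset.sum_le_sum fun J _ => ?_)
    by_cases hJ : P J
    · rw [if_pos hJ, if_pos hJ]
      refine ENNReal.tsum_le_tsum fun D => ?_
      split_ifs with hD
      · exact (hG' J D ⟨hJ, hD⟩).1 g
      · exact le_rfl
    · rw [if_neg hJ, if_neg hJ]
  have hmeas : ∀ (J : Finset τ) (D : {i // i ∉ J} → J → ℚ), Measurable fun x =>
      if ∀ i l, |D i l| ≤ 1 then siegelX (G J D) x else 0 := by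
    intro J D
    split_ifs
    · exact measurable_siegelX (hG J D)
    · exact measurable_const
  have hJle : ∀ J : Finset τ, ∫⁻ x, (if P J then ∑' D : {i // i ∉ J} → J → ℚ,
      (if ∀ i l, |D i l| ≤ 1 then siegelX (G J D) x else 0) else 0) ∂μ ≤
      ENNReal.ofReal (12 * 0.999 ^ n) * volume A ^ J.card := by
    intro J
    by_cases hJ : P J
    · simp only [if_pos hJ]
      rw [lintegral_tsum fun D => (hmeas J D).aemeasurable]
      have hne : Nonempty J := hJ.1.to_subtype
      have hne' : Nonempty {i // i ∉ J} := nonempty_subtype.mpr hJ.2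
      have hc1 : 1 ≤ Fintype.card J := Fintype.card_pos
      have hc2 : 1 ≤ Fintype.card {i // i ∉ J} := Fintype.card_pos
      have hc3 : Fintype.card {i // i ∉ J} + Fintype.card J = Fintype.card τ := by
        rw [Fintype.card_subtype_compl (fun i => i ∈ J)]
        have : Fintype.card {i // i ∈ J} ≤ Fintype.card τ := Fintype.card_subtype_le _
        omega
      have h8 : 8 * (Fintype.card {i // i ∉ J} * Fintype.card J) ≤ n := by
        refine le_trans ?_ hcard
        rw [← hc3]
        zify
        nlinarith [sq_nonneg ((Fintype.card {i // i ∉ J} : ℤ) - Fintype.card J)]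
      have h4 : 4 ≤ n := by nlinarith
      calc ∑' D : {i // i ∉ J} → J → ℚ,
            ∫⁻ x, (if ∀ i l, |D i l| ≤ 1 then siegelX (G J D) x else 0) ∂μ
          ≤ ∑' D : {i // i ∉ J} → J → ℚ,
            (if ∀ i l, |D i l| ≤ 1 then denWeight n (maxDen D) else 0) * volume A ^ J.card := by
            refine ENNReal.tsum_le_tsum fun D => ?_
            split_ifs with hD
            · exact (hG' J D ⟨hJ, hD⟩).2
            · simp
        _ ≤ _ := by
            rw [ENNReal.tsum_mul_right]
            exact mul_le_mul_left (tsum_denWeight_le h4 h8) _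
    · simp [if_neg hJ]
  calc ∫⁻ x, siegelX ((depTuples τ A).indicator 1) x ∂μ
      ≤ ∑ J, ∫⁻ x, (if P J then ∑' D : {i // i ∉ J} → J → ℚ,
          (if ∀ i l, |D i l| ≤ 1 then siegelX (G J D) x else 0) else 0) ∂μ := by
        rw [← lintegral_finsetSum]
        · exact lintegral_mono hpt
        · intro J _
          by_cases hJ : P J
          · simp only [if_pos hJ]
            exact Measurable.tsum fun D => hmeas J D
          · simp only [if_neg hJ]
            exact measurable_const
    _ ≤ ∑ J : Finset τ, ENNReal.ofReal (12 * 0.999 ^ n) * volume A ^ J.card :=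
        Finset.sum_le_sum fun J _ => hJle J
    _ = _ := by
        rw [← Finset.mul_sum]
        congr 1
        rw [add_comm, ← Fintype.sum_pow_mul_eq_add_pow]
        simp

end DependentTuples

section Bonferroni

/-- Effect of one more element on the truncated inclusion-exclusion sum. -/
theorem sum_bonferroni_succ {j : ℕ} (d N : ℕ) :
    (∑ i ∈ Finset.range (d + 1), (-1 : ℤ) ^ i * ((j + i).choose j * (N + 1).choose (j + 1 + i)))
      = (∑ i ∈ Finset.range (d + 1), (-1 : ℤ) ^ i * ((j + i).choose j * N.choose (j + 1 + i))) +
        N.choose j * ∑ i ∈ Finset.range (d + 1), (-1 : ℤ) ^ i * (N - j).choose i := by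
  rw [Finset.mul_sum, ← Finset.sum_add_distrib]
  refine Finset.sum_congr rfl fun i _ => ?_
  have h1 : (N + 1).choose (j + 1 + i) = N.choose (j + i) + N.choose (j + 1 + i) := by
    rw [show j + 1 + i = (j + i) + 1 by ring, Nat.choose_succ_succ]
  have h2 : (j + i).choose j * N.choose (j + i) = N.choose j * (N - j).choose i := by
    have := Nat.choose_mul (n := N) (Nat.le_add_right j i)
    rw [Nat.add_sub_cancel_left] at this
    rw [mul_comm, this]
  have h2' : ((j + i).choose j * N.choose (j + i) : ℤ) = N.choose j * (N - j).choose i := by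
    exact_mod_cast h2
  rw [h1]
  push_cast
  linear_combination (-1) ^ i * h2'

theorem alternating_sum_choose_range (m d : ℕ) :
    ∑ i ∈ Finset.range (d + 1), (-1 : ℤ) ^ i * (m + 1).choose i = (-1) ^ d * m.choose d := by
  induction d with
  | zero => simp
  | succ d ih =>
    rw [Finset.sum_range_succ, ih, Nat.choose_succ_succ]
    push_cast
    ring

/-- Bonferroni inequalities, with the sign of the last term made explicit. -/
theorem bonferroni (j d N : ℕ) :
    0 ≤ (-1 : ℤ) ^ d * ((∑ i ∈ Finset.range (d + 1),
      (-1 : ℤ) ^ i * ((j + i).choose j * N.choose (j + 1 + i))) - if j + 1 ≤ N then 1 else 0) := by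
  induction N with
  | zero =>
    have : ∀ i, Nat.choose 0 (j + 1 + i) = 0 := fun i => Nat.choose_eq_zero_of_lt (by omega)
    simp [this]
  | succ N ih =>
    rw [sum_bonferroni_succ]
    rcases lt_trichotomy N j with h | h | h
    · rw [if_neg (by omega)] at ih ⊢
      simpa [Nat.choose_eq_zero_of_lt h] using ih
    · subst h
      rw [if_neg (by omega)] at ih
      have h1 : ∑ i ∈ Finset.range (d + 1), (-1 : ℤ) ^ i * (N - N).choose i = 1 := by
        rw [Finset.sum_range_succ']
        simp
      rw [h1]
      simpa using ih
    · rw [if_pos (by omega)] at ih ⊢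
      obtain ⟨m, rfl⟩ : ∃ m, N = j + (m + 1) := ⟨N - j - 1, by omega⟩
      rw [Nat.add_sub_cancel_left, alternating_sum_choose_range]
      have h2 : (0 : ℤ) ≤ (j + (m + 1)).choose j * m.choose d := by positivity
      have h3 : ((-1 : ℤ) ^ d) * (-1) ^ d = 1 := by rw [← mul_pow]; simp
      linear_combination ih + h2 - ((j + (m + 1)).choose j * m.choose d : ℤ) * h3

end Bonferroni

section LatticePoints

variable {n : ℕ} {A : Set (Fin n → ℝ)} {g : SLR n}

theorem hasAtLeast_iff_le_encard {α : Type*} {S : Set α} {k : ℕ} :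
    hasAtLeast S k ↔ (k : ℕ∞) ≤ S.encard := by
  constructor
  · rintro ⟨t, ht, rfl⟩
    rw [← Set.encard_coe_eq_coe_finsetCard]
    exact Set.encard_le_encard ht
  · intro h
    obtain ⟨t, ht, htk⟩ := Set.exists_subset_encard_eq h
    have hfin : t.Finite := Set.finite_of_encard_eq_coe htk
    refine ⟨hfin.toFinset, by simpa using ht, ?_⟩
    rw [hfin.encard_eq_coe_toFinset_card] at htk
    exact_mod_cast htk

/-- The integer vectors `m` with `m g ∈ A`. -/
def latPts (A : Set (Fin n → ℝ)) (g : SLR n) : Set (Fin n → ℤ) :=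
  {m | (fun j => (m j : ℝ)) ᵥ* g.1 ∈ A}

theorem encard_latticeOf_inter : (latticeOf n g ∩ A).encard = (latPts A g).encard := by
  rw [← (rowMul_injective g).encard_image (latPts A g)]
  congr 1
  ext x
  constructor
  · rintro ⟨⟨m, rfl⟩, hx⟩
    exact ⟨m, hx, rfl⟩
  · rintro ⟨m, hm, rfl⟩
    exact ⟨⟨m, rfl⟩, hm⟩

/-- The injective tuples of vectors in `A`. -/
def injTuples (τ : Type*) (A : Set (Fin n → ℝ)) : Set (τ → Fin n → ℝ) :=
  {Z | Function.Injective Z ∧ ∀ i, Z i ∈ A}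

theorem rowMul_mem_injTuples_iff {τ : Type*} {M : τ → Fin n → ℤ} :
    rowMul g.1 (castTuple M) ∈ injTuples τ A ↔
      Function.Injective M ∧ ∀ i, M i ∈ latPts A g :=
  and_congr_left' ((rowMul_injective g).of_comp_iff M)

theorem siegel_injTuples (hfin : (latPts A g).Finite) (h : ℕ) :
    siegel ((injTuples (Fin h) A).indicator 1) g =
      ((latPts A g).ncard.descFactorial h : ENNReal) := by
  set s : Set (Fin h → Fin n → ℤ) := {M | Function.Injective M ∧ ∀ i, M i ∈ latPts A g}
  have h1 : ∀ M : Fin h → Fin n → ℤ, (injTuples (Fin h) A).indicator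
      (1 : (Fin h → Fin n → ℝ) → ENNReal) (rowMul g.1 (castTuple M)) = s.indicator 1 M := by
    intro M
    by_cases hM : M ∈ s
    · rw [Set.indicator_of_mem hM, Set.indicator_of_mem (rowMul_mem_injTuples_iff.mpr hM)]
      rfl
    · rw [Set.indicator_of_notMem hM,
        Set.indicator_of_notMem fun h' => hM (rowMul_mem_injTuples_iff.mp h')]
  have hft : Fintype (latPts A g) := hfin.fintype
  let e : (Fin h ↪ latPts A g) ≃ s :=
    { toFun := fun f => ⟨fun i => f i, Subtype.val_injective.comp f.injective, fun i => (f i).2⟩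
      invFun := fun M => ⟨fun i => ⟨M.1 i, M.2.2 i⟩, fun a b hab =>
        M.2.1 (congrArg Subtype.val hab)⟩
      left_inv := fun f => rfl
      right_inv := fun M => rfl }
  rw [siegel, tsum_congr h1, ← tsum_subtype s (1 : (Fin h → Fin n → ℤ) → ENNReal), ← e.tsum_eq,
    tsum_fintype]
  simp only [Pi.one_apply, Finset.sum_const, nsmul_eq_mul, mul_one, Finset.card_univ,
    Fintype.card_embedding_eq, Fintype.card_fin]
  rw [← Nat.card_coe_set_eq, Nat.card_eq_fintype_card]

theorem finite_latPts (h : siegel ((injTuples (Fin 1) A).indicator 1) g ≠ ⊤) :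
    (latPts A g).Finite := by
  have h1 : ∑' m, (latPts A g).indicator (1 : (Fin n → ℤ) → ENNReal) m ≤
      siegel ((injTuples (Fin 1) A).indicator 1) g := by
    have hinj : Function.Injective fun (m : Fin n → ℤ) (_ : Fin 1) => m := fun a b hab =>
      congrFun hab 0
    refine le_trans (ENNReal.tsum_le_tsum fun m => ?_)
      (ENNReal.tsum_comp_le_tsum_of_injective hinj _)
    by_cases hm : m ∈ latPts A g
    · rw [Set.indicator_of_mem hm, Set.indicator_of_mem]
      · rfl
      · exact rowMul_mem_injTuples_iff.mpr ⟨Function.injective_of_subsingleton _, fun _ => hm⟩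
    · rw [Set.indicator_of_notMem hm]
      exact zero_le
  rw [← tsum_subtype] at h1
  by_contra hinf
  have : Infinite (latPts A g) := Set.infinite_coe_iff.mpr hinf
  refine h (top_le_iff.mp (le_trans (le_of_eq ?_) h1))
  exact (ENNReal.tsum_const_eq_top_of_ne_zero one_ne_zero).symm

theorem measurableSet_injTuples {τ : Type*} [Finite τ] (hA : MeasurableSet A) :
    MeasurableSet (injTuples τ A) := by
  have : injTuples τ A = (⋂ i, ⋂ j, {Z | Z i = Z j → i = j}) ∩ Set.pi Set.univ fun _ => A := by
    ext Z
    simp [injTuples, Function.Injective]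
  rw [this]
  refine MeasurableSet.inter (.iInter fun i => .iInter fun j => ?_) (.univ_pi fun _ => hA)
  exact (measurableSet_eq_fun (measurable_pi_apply i) (measurable_pi_apply j)).imp (.const _)

theorem siegelX_add {τ : Type*} (F₁ F₂ : (τ → Fin n → ℝ) → ENNReal) (x : LatSpace n) :
    siegelX (F₁ + F₂) x = siegelX F₁ x + siegelX F₂ x :=
  ENNReal.tsum_add

theorem exists_lintegral_injTuples [Fintype τ] [Nonempty τ] {μ : Measure (LatSpace n)}
    [IsProbabilityMeasure μ] (hinv : ∀ a : SLR n, μ.map (rTranslate n a) = μ)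
    (hA : MeasurableSet A) (hA0 : (0 : Fin n → ℝ) ∉ A) (hAneg : ∀ x ∈ A, -x ∉ A)
    (hcard : 2 * Fintype.card τ ^ 2 ≤ n) :
    ∃ d ≤ ENNReal.ofReal (12 * 0.999 ^ n) * (1 + volume A) ^ Fintype.card τ,
      ∫⁻ x, siegelX ((injTuples τ A).indicator 1) x ∂μ = volume A ^ Fintype.card τ + d := by
  refine ⟨_, lintegral_siegelX_depTuples_le hinv hA hA0 hAneg hcard, ?_⟩
  have hlt : Fintype.card τ < n := by
    have : 1 ≤ Fintype.card τ := Fintype.card_pos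
    nlinarith
  set I : Set (τ → Fin n → ℝ) := {Z | LinearIndependent ℝ Z} ∩ Set.pi Set.univ fun _ => A
  have hI : MeasurableSet I := measurableSet_linearIndependent.inter (.univ_pi fun _ => hA)
  have hsplit : (injTuples τ A).indicator (1 : (τ → Fin n → ℝ) → ENNReal) =
      I.indicator 1 + (depTuples τ A).indicator 1 := by
    have hdisj : Disjoint I (depTuples τ A) :=
      Set.disjoint_left.mpr fun Z hZ hZ' => hZ'.1 hZ.1
    have hun : I ∪ depTuples τ A = injTuples τ A := by
      ext Z
      constructor
      · rintro (hZ | hZ)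
        · exact ⟨hZ.1.injective, fun i => hZ.2 i (Set.mem_univ i)⟩
        · exact hZ.2
      · intro hZ
        by_cases h : LinearIndependent ℝ Z
        · exact Or.inl ⟨h, fun i _ => hZ.2 i⟩
        · exact Or.inr ⟨h, hZ⟩
    rw [← hun, Set.indicator_union_of_disjoint hdisj]
    rfl
  simp only [hsplit, siegelX_add]
  rw [lintegral_add_left (measurable_siegelX (measurable_one.indicator hI)),
    lintegral_siegelX hinv hlt (measurable_one.indicator hI)
      fun Z hZ => Set.indicator_of_notMem (fun h => hZ h.1) _, lintegral_indicator_one hI]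
  congr 1
  have hae : I =ᵐ[volume] Set.pi Set.univ fun _ => A := by
    filter_upwards [ae_linearIndependent hlt.le] with Z hZ
    exact propext ⟨fun h => h.2, fun h => ⟨hZ, h⟩⟩
  rw [measure_congr hae, volume_pi_pi, Finset.prod_const, Finset.card_univ]

end LatticePoints

section PosHalf

variable {n : ℕ} {S : Set (Fin n → ℝ)}

theorem measurableSet_posHalf (hS : MeasurableSet S) : MeasurableSet (posHalf n S) := by
  have : posHalf n S = S ∩ ⋃ i : Fin n, {x | 0 < x i} ∩ ⋂ j : Fin n, {x | j < i → x j = 0} := by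
    ext x
    simp [posHalf]
  rw [this]
  refine hS.inter (.iUnion fun i => MeasurableSet.inter ?_ (.iInter fun j => ?_))
  · exact measurableSet_lt measurable_const (measurable_pi_apply i)
  · exact (MeasurableSet.const _).imp
      (measurableSet_eq_fun (measurable_pi_apply j) measurable_const)

theorem zero_notMem_posHalf : (0 : Fin n → ℝ) ∉ posHalf n S := by
  rintro ⟨-, i, hi, -⟩
  exact lt_irrefl _ hi

theorem neg_notMem_posHalf {x : Fin n → ℝ} (hx : x ∈ posHalf n S) : -x ∉ posHalf n S := by
  obtain ⟨-, i, hi, hi'⟩ := hx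
  rintro ⟨-, j, hj, hj'⟩
  rw [Pi.neg_apply] at hj
  rcases lt_trichotomy i j with h | rfl | h
  · have := hj' i h
    rw [Pi.neg_apply] at this
    linarith
  · linarith
  · have := hi' j h
    linarith

theorem mem_posHalf_or_neg_mem_posHalf (hS : ∀ x, x ∈ S ↔ -x ∈ S) {x : Fin n → ℝ} (hx : x ∈ S)
    (hx0 : x ≠ 0) : x ∈ posHalf n S ∨ -x ∈ posHalf n S := by
  obtain ⟨i, hi, hmin⟩ := wellFounded_lt.has_min {i | x i ≠ 0} (Function.ne_iff.mp hx0)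
  have hz : ∀ j < i, x j = 0 := fun j hj => by
    by_contra h
    exact hmin j h hj
  rcases lt_or_gt_of_ne (show x i ≠ 0 from hi) with h | h
  · exact Or.inr ⟨(hS x).mp hx, i, by simpa using h, fun j hj => by simp [hz j hj]⟩
  · exact Or.inl ⟨hx, i, h, hz⟩

theorem volume_posHalf (hn : n ≠ 0) (hSm : MeasurableSet S) (hS : ∀ x, x ∈ S ↔ -x ∈ S) :
    volume S = 2 * volume (posHalf n S) := by
  have : Nonempty (Fin n) := Fin.pos_iff_nonempty.mp (Nat.pos_of_ne_zero hn)
  have hae : S =ᵐ[volume] (posHalf n S ∪ -posHalf n S : Set (Fin n → ℝ)) := by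
    filter_upwards [compl_mem_ae_iff.mpr (measure_singleton (0 : Fin n → ℝ))] with x hx
    refine propext ⟨fun h => mem_posHalf_or_neg_mem_posHalf hS h hx, ?_⟩
    rintro (h | h)
    · exact h.1
    · exact (hS x).mpr h.1
  have hdisj : Disjoint (posHalf n S) (-posHalf n S) :=
    Set.disjoint_left.mpr fun x hx hx' => neg_notMem_posHalf hx hx'
  rw [measure_congr hae, measure_union hdisj (measurableSet_posHalf hSm).neg, Measure.measure_neg,
    two_mul]

end PosHalf

section Truncation

variable {n : ℕ}

/-- The coefficients of the truncated inclusion-exclusion sums. -/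
noncomputable def bonfCoeff (k h : ℕ) : ℝ := 1 / (h * (h - k)! * (k - 1)!)

theorem bonfCoeff_nonneg (k h : ℕ) : 0 ≤ bonfCoeff k h := by
  unfold bonfCoeff
  positivity

theorem bonfCoeff_le {k h : ℕ} (hk : 1 ≤ k) (hkh : k ≤ h) : bonfCoeff k h ≤ 1 / k ! := by
  refine one_div_le_one_div_of_le (by positivity) ?_
  have h1 : k ! = k * (k - 1)! := (Nat.mul_factorial_pred (by omega)).symm
  have h2 : k * (k - 1)! ≤ h * (h - k)! * (k - 1)! := by
    refine Nat.mul_le_mul_right _ (hkh.trans (Nat.le_mul_of_pos_right _ (Nat.factorial_pos _)))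
  rw [h1]
  exact_mod_cast h2

theorem bonfCoeff_mul_descFactorial (j i N : ℕ) :
    bonfCoeff (j + 1) (j + 1 + i) * N.descFactorial (j + 1 + i) =
      (j + i).choose j * N.choose (j + 1 + i) := by
  have h1 : ((j + i).choose j * j ! * i ! : ℝ) = (j + i)! := by
    have := Nat.choose_mul_factorial_mul_factorial (Nat.le_add_right j i)
    rw [Nat.add_sub_cancel_left] at this
    exact_mod_cast this
  have h2 : (j + 1 + i)! = (j + 1 + i) * (j + i)! := by
    rw [show j + 1 + i = (j + i) + 1 by ring, Nat.factorial_succ]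
  rw [Nat.descFactorial_eq_factorial_mul_choose, bonfCoeff, Nat.add_sub_cancel_left,
    Nat.add_sub_cancel, h2]
  push_cast
  rw [← h1]
  have : ((j : ℝ) + 1 + i) ≠ 0 := by positivity
  have : (i ! : ℝ) ≠ 0 := by positivity
  have : (j ! : ℝ) ≠ 0 := by positivity
  field_simp

theorem bonferroni_descFactorial {k a : ℕ} (hk : 1 ≤ k) (hka : k ≤ a) (N : ℕ) :
    0 ≤ (-1 : ℝ) ^ (a - k) * ((∑ h ∈ Finset.Icc k a,
      (-1 : ℝ) ^ (h - k) * bonfCoeff k h * N.descFactorial h) - if k ≤ N then 1 else 0) := by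
  obtain ⟨j, rfl⟩ : ∃ j, k = j + 1 := ⟨k - 1, by omega⟩
  obtain ⟨d, rfl⟩ := Nat.exists_eq_add_of_le hka
  have h1 : Finset.Icc (j + 1) (j + 1 + d) = Finset.Ico (j + 1) (j + 1 + d + 1) := by
    ext h
    simp only [Finset.mem_Icc, Finset.mem_Ico]
    omega
  rw [h1, Finset.sum_Ico_eq_sum_range, add_assoc (j + 1) d 1, Nat.add_sub_cancel_left,
    Nat.add_sub_cancel_left]
  have h2 := bonferroni j d N
  have h3 : (0 : ℝ) ≤ (((-1 : ℤ) ^ d * ((∑ i ∈ Finset.range (d + 1),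
      (-1 : ℤ) ^ i * ((j + i).choose j * N.choose (j + 1 + i))) -
        if j + 1 ≤ N then 1 else 0) : ℤ) : ℝ) := by exact_mod_cast h2
  push_cast at h3
  simp only [Nat.add_sub_cancel_left, mul_assoc, bonfCoeff_mul_descFactorial]
  exact h3

end Truncation

section MeanTruncation

variable {n : ℕ}

/-- The number of injective `h`-tuples of vectors of the lattice in `A`. -/
noncomputable def tupleCount (A : Set (Fin n → ℝ)) (h : ℕ) (x : LatSpace n) : ℝ :=
  (siegelX ((injTuples (Fin h) A).indicator 1) x).toReal

variable {A : Set (Fin n → ℝ)} {μ : Measure (LatSpace n)} [IsProbabilityMeasure μ]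

theorem exists_integral_tupleCount (hinv : ∀ a : SLR n, μ.map (rTranslate n a) = μ)
    (hA : MeasurableSet A) (hA0 : (0 : Fin n → ℝ) ∉ A) (hAneg : ∀ x ∈ A, -x ∉ A) {W : ℝ}
    (hW : 0 ≤ W) (hvol : volume A = ENNReal.ofReal W) {h : ℕ} (hh : 1 ≤ h)
    (hcard : 2 * h ^ 2 ≤ n) :
    (∀ᵐ x ∂μ, siegelX ((injTuples (Fin h) A).indicator 1) x < ⊤) ∧
      Integrable (tupleCount A h) μ ∧ ∃ d : ℝ, 0 ≤ d ∧ d ≤ 12 * 0.999 ^ n * (W + 1) ^ h ∧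
        ∫ x, tupleCount A h x ∂μ = W ^ h + d := by
  have hne : Nonempty (Fin h) := Fin.pos_iff_nonempty.mp hh
  have hmeas := measurable_siegelX (n := n)
    (measurable_one.indicator (measurableSet_injTuples (τ := Fin h) hA) (β := ENNReal))
  obtain ⟨d, hd, hval⟩ := exists_lintegral_injTuples (τ := Fin h) hinv hA hA0 hAneg
    (by rwa [Fintype.card_fin])
  rw [Fintype.card_fin, hvol] at hd hval
  have hbd : ENNReal.ofReal (12 * 0.999 ^ n) * (1 + ENNReal.ofReal W) ^ h =
      ENNReal.ofReal (12 * 0.999 ^ n * (W + 1) ^ h) := by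
    rw [ENNReal.ofReal_mul (p := 12 * 0.999 ^ n) (by positivity),
      ENNReal.ofReal_pow (by positivity : 0 ≤ W + 1),
      ENNReal.ofReal_add hW zero_le_one, ENNReal.ofReal_one, add_comm]
  rw [hbd] at hd
  have hdtop : d ≠ ⊤ := ne_top_of_le_ne_top ENNReal.ofReal_ne_top hd
  have hWtop : ENNReal.ofReal W ^ h ≠ ⊤ := ENNReal.pow_ne_top ENNReal.ofReal_ne_top
  have htop : ∫⁻ x, siegelX ((injTuples (Fin h) A).indicator 1) x ∂μ ≠ ⊤ := by
    rw [hval]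
    exact ENNReal.add_ne_top.mpr ⟨hWtop, hdtop⟩
  have hae := ae_lt_top hmeas htop
  refine ⟨hae, integrable_toReal_of_lintegral_ne_top hmeas.aemeasurable htop, d.toReal,
    ENNReal.toReal_nonneg, ENNReal.toReal_le_of_le_ofReal (by positivity) hd, ?_⟩
  simp only [tupleCount]
  rw [integral_toReal hmeas.aemeasurable hae, hval, ENNReal.toReal_add hWtop hdtop,
    ENNReal.toReal_pow, ENNReal.toReal_ofReal hW]

theorem ae_exists_count (hinv : ∀ a : SLR n, μ.map (rTranslate n a) = μ)
    (hA : MeasurableSet A) (hA0 : (0 : Fin n → ℝ) ∉ A) (hAneg : ∀ x ∈ A, -x ∉ A) {W : ℝ}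
    (hW : 0 ≤ W) (hvol : volume A = ENNReal.ofReal W) (hn : 2 ≤ n) {k : ℕ} {f : LatSpace n → ℝ}
    (hf : ∀ g, f (latMk n g) = if hasAtLeast (latticeOf n g ∩ A) k then 1 else 0) :
    ∀ᵐ x ∂μ, ∃ N : ℕ, (∀ h, tupleCount A h x = N.descFactorial h) ∧
      f x = if k ≤ N then 1 else 0 := by
  filter_upwards [(exists_integral_tupleCount hinv hA hA0 hAneg hW hvol le_rfl
    (by simpa using hn)).1] with x hx
  obtain ⟨g, rfl⟩ := latMk_surjective x
  rw [siegelX_latMk] at hx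
  have hfin := finite_latPts hx.ne
  refine ⟨(latPts A g).ncard, fun h => ?_, ?_⟩
  · rw [tupleCount, siegelX_latMk, siegel_injTuples hfin, ENNReal.toReal_natCast]
  · rw [hf, hasAtLeast_iff_le_encard, encard_latticeOf_inter, ← hfin.cast_ncard_eq]
    simp only [Nat.cast_le]

theorem bonferroni_integral (hinv : ∀ a : SLR n, μ.map (rTranslate n a) = μ)
    (hA : MeasurableSet A) (hA0 : (0 : Fin n → ℝ) ∉ A) (hAneg : ∀ x ∈ A, -x ∉ A) {W : ℝ}
    (hW : 0 ≤ W) (hvol : volume A = ENNReal.ofReal W) (hn : 2 ≤ n) {k a : ℕ} (hk : 1 ≤ k)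
    (hka : k ≤ a) (ha : (a : ℝ) ≤ Real.sqrt ((n : ℝ) / 2)) {f : LatSpace n → ℝ}
    (hf : ∀ g, f (latMk n g) = if hasAtLeast (latticeOf n g ∩ A) k then 1 else 0) :
    0 ≤ (-1 : ℝ) ^ (a - k) * ((∑ h ∈ Finset.Icc k a, (-1 : ℝ) ^ (h - k) * bonfCoeff k h * W ^ h) -
      ∫ x, f x ∂μ) +
        (12 / k !) * Real.sqrt ((n : ℝ) / 2) * 0.999 ^ n * (W + 1) ^ Real.sqrt ((n : ℝ) / 2) := by
  have hsq : ∀ h ∈ Finset.Icc k a, 1 ≤ h ∧ 2 * h ^ 2 ≤ n := by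
    intro h hh
    obtain ⟨h1, h2⟩ := Finset.mem_Icc.mp hh
    refine ⟨hk.trans h1, ?_⟩
    have h3 : (h : ℝ) ≤ Real.sqrt ((n : ℝ) / 2) := le_trans (by exact_mod_cast h2) ha
    rw [Real.le_sqrt (by positivity) (by positivity)] at h3
    have : (2 * h ^ 2 : ℝ) ≤ n := by linarith
    exact_mod_cast this
  have hmom : ∀ h, ∃ d : ℝ, h ∈ Finset.Icc k a → Integrable (tupleCount A h) μ ∧ 0 ≤ d ∧
      d ≤ 12 * 0.999 ^ n * (W + 1) ^ h ∧ ∫ x, tupleCount A h x ∂μ = W ^ h + d := by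
    intro h
    by_cases hh : h ∈ Finset.Icc k a
    · obtain ⟨-, h1, d, h2⟩ := exists_integral_tupleCount hinv hA hA0 hAneg hW hvol
        (hsq h hh).1 (hsq h hh).2
      exact ⟨d, fun _ => ⟨h1, h2⟩⟩
    · exact ⟨0, fun h' => absurd h' hh⟩
  choose d hd using hmom
  have hcount := ae_exists_count hinv hA hA0 hAneg hW hvol hn hf
  have hTint : Integrable
      (fun x => ∑ h ∈ Finset.Icc k a, (-1 : ℝ) ^ (h - k) * bonfCoeff k h * tupleCount A h x) μ :=
    integrable_finsetSum _ fun h hh => (hd h hh).1.const_mul _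
  have hfint : Integrable f μ := by
    have hmeas : AEStronglyMeasurable f μ := by
      have hkk := (hd k (Finset.left_mem_Icc.mpr hka)).1.aestronglyMeasurable.aemeasurable
      have hg : Measurable fun t : ℝ => if t = 0 then (0 : ℝ) else 1 :=
        Measurable.ite (measurableSet_singleton 0) measurable_const measurable_const
      refine (hg.comp_aemeasurable hkk).aestronglyMeasurable.congr ?_
      filter_upwards [hcount] with x hx
      obtain ⟨N, hN, hfx⟩ := hx
      simp only [Function.comp, hN, hfx, Nat.cast_eq_zero, Nat.descFactorial_eq_zero_iff_lt]
      split_ifs <;> first | rfl | omega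
    refine Integrable.of_bound hmeas 1 ?_
    filter_upwards [hcount] with x hx
    obtain ⟨N, -, hfx⟩ := hx
    rw [hfx]
    split_ifs <;> simp
  have hnonneg : 0 ≤ ∫ x, (-1 : ℝ) ^ (a - k) * ((∑ h ∈ Finset.Icc k a,
      (-1 : ℝ) ^ (h - k) * bonfCoeff k h * tupleCount A h x) - f x) ∂μ := by
    refine integral_nonneg_of_ae ?_
    filter_upwards [hcount] with x hx
    obtain ⟨N, hN, hfx⟩ := hx
    simp only [hN, hfx]
    exact bonferroni_descFactorial hk hka N
  rw [integral_const_mul, integral_sub hTint hfint,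
    integral_finsetSum _ fun h hh => (hd h hh).1.const_mul _] at hnonneg
  have hsum : ∑ h ∈ Finset.Icc k a, ∫ x, (-1 : ℝ) ^ (h - k) * bonfCoeff k h * tupleCount A h x ∂μ =
      (∑ h ∈ Finset.Icc k a, (-1 : ℝ) ^ (h - k) * bonfCoeff k h * W ^ h) +
        ∑ h ∈ Finset.Icc k a, (-1 : ℝ) ^ (h - k) * bonfCoeff k h * d h := by
    rw [← Finset.sum_add_distrib]
    refine Finset.sum_congr rfl fun h hh => ?_
    rw [integral_const_mul, (hd h hh).2.2.2, mul_add]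
  rw [hsum] at hnonneg
  set R := Real.sqrt ((n : ℝ) / 2)
  have herr : |(-1 : ℝ) ^ (a - k) *
      ∑ h ∈ Finset.Icc k a, (-1 : ℝ) ^ (h - k) * bonfCoeff k h * d h| ≤
      (12 / k !) * R * 0.999 ^ n * (W + 1) ^ R := by
    rw [abs_mul, abs_pow, abs_neg, abs_one, one_pow, one_mul]
    calc |∑ h ∈ Finset.Icc k a, (-1 : ℝ) ^ (h - k) * bonfCoeff k h * d h|
        ≤ ∑ h ∈ Finset.Icc k a, |(-1 : ℝ) ^ (h - k) * bonfCoeff k h * d h| :=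
          Finset.abs_sum_le_sum_abs _ _
      _ ≤ ∑ h ∈ Finset.Icc k a, (1 / (k ! : ℝ)) * (12 * 0.999 ^ n * (W + 1) ^ R) := by
          refine Finset.sum_le_sum fun h hh => ?_
          obtain ⟨-, hd0, hd1, -⟩ := hd h hh
          rw [abs_mul, abs_mul, abs_pow, abs_neg, abs_one, one_pow, one_mul, abs_of_nonneg hd0,
            abs_of_nonneg (bonfCoeff_nonneg k h)]
          refine mul_le_mul (bonfCoeff_le hk (Finset.mem_Icc.mp hh).1) (hd1.trans ?_) hd0
            (by positivity)
          have hhR : (h : ℝ) ≤ R := le_trans (by exact_mod_cast (Finset.mem_Icc.mp hh).2) ha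
          rw [← Real.rpow_natCast (W + 1)]
          exact mul_le_mul_of_nonneg_left (Real.rpow_le_rpow_of_exponent_le (by linarith) hhR)
            (by positivity)
      _ ≤ _ := by
          rw [Finset.sum_const, nsmul_eq_mul, Nat.card_Icc]
          have hcardR : ((a + 1 - k : ℕ) : ℝ) ≤ R :=
            le_trans (by exact_mod_cast (show a + 1 - k ≤ a by omega)) ha
          have hrpow : 0 ≤ (W + 1) ^ R := Real.rpow_nonneg (by linarith) _
          calc ((a + 1 - k : ℕ) : ℝ) * (1 / (k ! : ℝ) * (12 * 0.999 ^ n * (W + 1) ^ R))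
              ≤ R * (1 / (k ! : ℝ) * (12 * 0.999 ^ n * (W + 1) ^ R)) := by gcongr
            _ = _ := by ring
  have := (abs_le.mp herr).2
  rw [add_sub_right_comm, mul_add] at hnonneg
  linarith

end MeanTruncation

/-- **Main Theorem.** Let `n ≥ 2`, `S ⊆ ℝ^n` a Borel measurable set symmetric about the
origin with Lebesgue measure `V`, `k` a positive integer. For integers `α, β` with
`k ≤ α ≤ √(n/2)`, `k ≤ β ≤ √(n/2)`, `α − k` even, `β − k` odd, the integral
`∫_{X_n} F_{S,k}(L) dμ_n` (where `F_{S,k}(L) = 1` iff `L` has at least `k` nonzero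
vectors up to sign in `S`, i.e. `|L ∩ S'| ≥ k`) satisfies
`Σ_{h=k}^{β} (−1)^{h−k}(V/2)^h/(h(h−k)!(k−1)!) − E ≤ ∫ F_{S,k} dμ_n
  ≤ Σ_{h=k}^{α} (−1)^{h−k}(V/2)^h/(h(h−k)!(k−1)!) + E`,
with `E = (12/k!)·√(n/2)·(0.999)^n·(V/2+1)^{√(n/2)}`. -/
theorem stmt0 (n k α β : ℕ) (hn : 2 ≤ n) (hk : 1 ≤ k)
    (hkα : k ≤ α) (hα : (α : ℝ) ≤ Real.sqrt ((n : ℝ) / 2))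
    (hkβ : k ≤ β) (hβ : (β : ℝ) ≤ Real.sqrt ((n : ℝ) / 2))
    (heven : Even (α - k)) (hodd : Odd (β - k))
    (S : Set (Fin n → ℝ)) (hSmeas : MeasurableSet S)
    (hSsymm : ∀ x, x ∈ S ↔ -x ∈ S)
    (V : ℝ) (hV0 : 0 ≤ V) (hvol : MeasureTheory.volume S = ENNReal.ofReal V)
    (μ : MeasureTheory.Measure (LatSpace n)) [MeasureTheory.IsProbabilityMeasure μ]
    (hinv : ∀ a : SLR n, μ.map (rTranslate n a) = μ)
    (f : LatSpace n → ℝ)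
    (hf : ∀ g : SLR n, f (latMk n g) =
      if hasAtLeast (latticeOf n g ∩ posHalf n S) k then 1 else 0) :
    (∑ h ∈ Finset.Icc k β,
        ((-1 : ℝ)) ^ (h - k) * (V / 2) ^ h / (h * (h - k)! * (k - 1)!))
      - (12 / (k)!) * Real.sqrt ((n : ℝ) / 2) * (0.999 : ℝ) ^ n *
          (V / 2 + 1) ^ (Real.sqrt ((n : ℝ) / 2))
      ≤ ∫ x, f x ∂μ ∧
    ∫ x, f x ∂μ
      ≤ (∑ h ∈ Finset.Icc k α,
          ((-1 : ℝ)) ^ (h - k) * (V / 2) ^ h / (h * (h - k)! * (k - 1)!))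
        + (12 / (k)!) * Real.sqrt ((n : ℝ) / 2) * (0.999 : ℝ) ^ n *
            (V / 2 + 1) ^ (Real.sqrt ((n : ℝ) / 2)) := by
  have hA := measurableSet_posHalf hSmeas
  have hvolA : volume (posHalf n S) = ENNReal.ofReal (V / 2) := by
    rw [ENNReal.ofReal_div_of_pos two_pos, ← hvol, volume_posHalf (by omega) hSmeas hSsymm,
      ENNReal.ofReal_ofNat]
    rw [mul_comm, ENNReal.mul_div_cancel_right two_ne_zero ENNReal.ofNat_ne_top]
  have key := fun {a : ℕ} (hka : k ≤ a) (ha : (a : ℝ) ≤ Real.sqrt ((n : ℝ) / 2)) =>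
    bonferroni_integral hinv hA zero_notMem_posHalf (fun _ => neg_notMem_posHalf)
      (div_nonneg hV0 zero_le_two) hvolA hn hk hka ha hf
  have hsum : ∀ a, ∑ h ∈ Finset.Icc k a,
      (-1 : ℝ) ^ (h - k) * (V / 2) ^ h / (h * (h - k)! * (k - 1)!) =
        ∑ h ∈ Finset.Icc k a, (-1 : ℝ) ^ (h - k) * bonfCoeff k h * (V / 2) ^ h := fun a =>
    Finset.sum_congr rfl fun h _ => by rw [bonfCoeff]; ring
  rw [hsum, hsum]
  have h1 := key hkα hα
  have h2 := key hkβ hβ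
  rw [heven.neg_one_pow] at h1
  rw [hodd.neg_one_pow] at h2
  constructor <;> linarith
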